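/- Fix q > 0 and λ > 0. For every θ ∈ [0,1], lim_{ε↓0} lim_{n→∞} (1/n) log Z_{n,λ,q}[ |V_{εn}| = ⌊θn⌋ ] = Φ(θ,λ,q), and the convergence is uniform for λ belonging to compact subsets of (0,∞)∖{q}. -/

import Mathlib

open Filter Topology Set

noncomputable section

/-- Size of the connected component of `K_n(ω)` containing the vertex `v`. -/
def compSize {n : ℕ} (G : SimpleGraph (Fin n)) (v : Fin n) : ℕ :=
  (G.connectedComponentMk v).supp.ncard

/-- Random cluster weight of a configuration `G` on the complete graph `K_m`,
with edge weight `p` and cluster weight `q`. -/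
def rcW (m : ℕ) (p q : ℝ) (G : SimpleGraph (Fin m)) : ℝ :=
  p ^ G.edgeSet.ncard * (1 - p) ^ (m * (m - 1) / 2 - G.edgeSet.ncard) *
    q ^ Nat.card G.ConnectedComponent

/-- Total random-cluster weight of an event, with explicit edge weight `p`. -/
def ZP (m : ℕ) (p q : ℝ) (A : Set (SimpleGraph (Fin m))) : ℝ :=
  ∑ᶠ G ∈ A, rcW m p q G

/-- `Z_{n,λ,q}[A]`, i.e. the total weight of the event `A` with `p = λ/n`. -/
def Zrc (n : ℕ) (lam q : ℝ) (A : Set (SimpleGraph (Fin n))) : ℝ :=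
  ZP n (lam / n) q A

/-- The partition function `Z_{n,λ,q}`. -/
def Ztot (n : ℕ) (lam q : ℝ) : ℝ := Zrc n lam q Set.univ

/-- The random cluster probability `φ_{n,λ,q}[A]`. -/
def phiRC (n : ℕ) (lam q : ℝ) (A : Set (SimpleGraph (Fin n))) : ℝ :=
  Zrc n lam q A / Ztot n lam q

/-- The event `K` that the configuration is connected. -/
def Kev (n : ℕ) : Set (SimpleGraph (Fin n)) := {G | G.Connected}

/-- The event `B_r` that no connected component has size larger than `r`. -/
def Bev (n : ℕ) (r : ℝ) : Set (SimpleGraph (Fin n)) :=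
  {G | ∀ v, (compSize G v : ℝ) ≤ r}

/-- The event `L` that the configuration is acyclic. -/
def Lev (n : ℕ) : Set (SimpleGraph (Fin n)) := {G | G.IsAcyclic}

/-- The set `V_r` of vertices lying in components of size larger than `r`. -/
def Vbig {n : ℕ} (G : SimpleGraph (Fin n)) (r : ℝ) : Set (Fin n) :=
  {v | r < (compSize G v : ℝ)}

/-- The number `N_r` of connected components of size larger than `r`. -/
def Nbig {n : ℕ} (G : SimpleGraph (Fin n)) (r : ℝ) : ℕ :=
  {C : G.ConnectedComponent | r < (C.supp.ncard : ℝ)}.ncard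

def pi1 (x : ℝ) : ℝ := 1 - Real.exp (-x)

def Psi (x : ℝ) : ℝ := min (Real.log x - (x - 1/x) / 2) 0

def Sent (θ : ℝ) : ℝ := θ * Real.log θ + (1 - θ) * Real.log (1 - θ)

def Phi (θ lam q : ℝ) : ℝ :=
  -Sent θ + (1 - θ) * Real.log (1 - pi1 (lam * θ)) + θ * Real.log (pi1 (lam * θ)) +
    (1 - θ) * (Psi (lam * (1 - θ) / q) - ((q - 1) / (2 * q)) * (lam * (1 - θ)) + Real.log q)

/-- Coefficients of `exp (∑ b_k z^k)`. -/
def expC (b : ℕ → ℝ) : ℕ → ℝ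
  | 0 => 1
  | (N+1) => (∑ i : Fin (N+1), ((i:ℝ)+1) * b (i+1) * expC b (N - i)) / (N+1)

lemma expC_zero (b : ℕ → ℝ) : expC b 0 = 1 := by rw [expC]

lemma expC_succ (b : ℕ → ℝ) (N : ℕ) : ((N:ℝ)+1) * expC b (N+1) =
    ∑ i ∈ Finset.range (N+1), ((i:ℝ)+1) * b (i+1) * expC b (N - i) := by
  rw [expC, Finset.sum_range]
  field_simp

lemma expC_unique (b y : ℕ → ℝ) (h0 : y 0 = 1) (h : ∀ N : ℕ, ((N:ℝ)+1) * y (N+1) =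
    ∑ i ∈ Finset.range (N+1), ((i:ℝ)+1) * b (i+1) * y (N - i)) (N : ℕ) : y N = expC b N := by
  induction N using Nat.strong_induction_on with
  | _ N ih =>
    cases N with
    | zero => rw [h0, expC_zero]
    | succ N =>
      have h1 : ((N:ℝ)+1) * y (N+1) = ((N:ℝ)+1) * expC b (N+1) := by
        rw [h, expC_succ]
        refine Finset.sum_congr rfl fun i hi => ?_
        rw [ih (N-i) (by omega)]
      have : ((N:ℝ)+1) ≠ 0 := by positivity
      exact mul_left_cancel₀ this h1

lemma expC_nonneg (b : ℕ → ℝ) (hb : ∀ k, 0 ≤ b k) (N : ℕ) : 0 ≤ expC b N := by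
  induction N using Nat.strong_induction_on with
  | _ N ih =>
    cases N with
    | zero => rw [expC_zero]; norm_num
    | succ N =>
      rw [expC]
      refine div_nonneg (Finset.sum_nonneg fun i _ => ?_) (by positivity)
      have := ih (N - i) (by omega)
      have := hb (i+1)
      positivity

lemma expC_mono (b c : ℕ → ℝ) (hb : ∀ k, 0 ≤ b k) (hbc : ∀ k, b k ≤ c k) (N : ℕ) :
    expC b N ≤ expC c N := by
  induction N using Nat.strong_induction_on with
  | _ N ih =>
    cases N with
    | zero => rw [expC_zero, expC_zero]
    | succ N =>
      rw [expC, expC]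
      refine div_le_div_of_nonneg_right (Finset.sum_le_sum fun i _ => ?_) (by positivity)
      have h1 := ih (N - i) (by omega)
      have h2 := hbc (i+1)
      have h3 := hb (i+1)
      have h4 := expC_nonneg b hb (N - i)
      have h5 : 0 ≤ c (i+1) := h3.trans h2
      gcongr

lemma expC_congr (b c : ℕ → ℝ) (N : ℕ) (hbc : ∀ k, 1 ≤ k → k ≤ N → b k = c k) :
    expC b N = expC c N := by
  induction N using Nat.strong_induction_on with
  | _ N ih =>
    cases N with
    | zero => rw [expC_zero, expC_zero]
    | succ N =>
      rw [expC, expC]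
      congr 1
      refine Finset.sum_congr rfl fun i _ => ?_
      rw [ih (N - i) (by omega) (fun k h1 h2 => hbc k h1 (by omega)), hbc (i+1) (by omega) (by omega)]

lemma expC_scale (b : ℕ → ℝ) (x : ℝ) (N : ℕ) :
    expC (fun k => x^k * b k) N = x^N * expC b N := by
  symm
  apply expC_unique (fun k => x^k * b k) (fun N => x^N * expC b N)
  · simp [expC_zero]
  · intro N
    have : ((N:ℝ)+1) * (x^(N+1) * expC b (N+1)) = x^(N+1) * (((N:ℝ)+1) * expC b (N+1)) := by ring
    rw [this, expC_succ, Finset.mul_sum]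
    refine Finset.sum_congr rfl fun i hi => ?_
    have hi' : i ≤ N := by simpa [Nat.lt_succ_iff] using hi
    have : x^(N+1) = x^(i+1) * x^(N-i) := by rw [← pow_add]; congr 1; omega
    rw [this]; ring

lemma expC_deriv (b : ℕ → ℝ) : PowerSeries.derivative ℝ (PowerSeries.mk (expC b)) =
    PowerSeries.mk (fun i => ((i:ℝ)+1) * b (i+1)) * PowerSeries.mk (expC b) := by
  ext n
  rw [PowerSeries.coeff_derivative, PowerSeries.coeff_mul,
    Finset.Nat.sum_antidiagonal_eq_sum_range_succ_mk]
  simp only [PowerSeries.coeff_mk]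
  rw [mul_comm, expC_succ]

lemma expC_add (b c : ℕ → ℝ) (N : ℕ) : expC (fun k => b k + c k) N =
    ∑ i ∈ Finset.range (N+1), expC b i * expC c (N - i) := by
  symm
  have key : PowerSeries.derivative ℝ (PowerSeries.mk (expC b) * PowerSeries.mk (expC c)) =
    PowerSeries.mk (fun i => ((i:ℝ)+1) * (b (i+1) + c (i+1))) *
      (PowerSeries.mk (expC b) * PowerSeries.mk (expC c)) := by
    rw [Derivation.leibniz, expC_deriv, expC_deriv]
    have : PowerSeries.mk (fun i : ℕ => ((i:ℝ)+1) * (b (i+1) + c (i+1))) =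
      PowerSeries.mk (fun i : ℕ => ((i:ℝ)+1) * b (i+1)) + PowerSeries.mk (fun i : ℕ => ((i:ℝ)+1) * c (i+1)) := by
      ext n; simp; ring
    rw [this]; simp only [smul_eq_mul]; ring
  have hco : ∀ N, ∑ i ∈ Finset.range (N+1), expC b i * expC c (N - i) =
      PowerSeries.coeff N (PowerSeries.mk (expC b) * PowerSeries.mk (expC c)) := by
    intro N
    rw [PowerSeries.coeff_mul, Finset.Nat.sum_antidiagonal_eq_sum_range_succ_mk]
    simp
  refine expC_unique (fun k => b k + c k) (fun N => ∑ i ∈ Finset.range (N+1), expC b i * expC c (N - i)) ?_ ?_ N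
  · simp [expC_zero]
  · intro N
    have := congrArg (PowerSeries.coeff N) key
    rw [PowerSeries.coeff_derivative] at this
    simp only [hco]
    rw [mul_comm, this, PowerSeries.coeff_mul, Finset.Nat.sum_antidiagonal_eq_sum_range_succ_mk]
    simp

/-- step lower bound -/
lemma expC_step (b : ℕ → ℝ) (hb : ∀ k, 0 ≤ b k) (k N : ℕ) (hk : 1 ≤ k) :
    (k:ℝ) * b k * expC b N ≤ ((N + k : ℕ):ℝ) * expC b (N + k) := by
  obtain ⟨i, rfl⟩ : ∃ i, k = i + 1 := ⟨k-1, by omega⟩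
  have := expC_succ b (N+i)
  have h2 : (((N + (i+1) : ℕ)):ℝ) = ((N+i : ℕ):ℝ) + 1 := by push_cast; ring
  rw [h2, ← add_assoc, this]
  have h3 : ((i+1:ℕ):ℝ) * b (i+1) * expC b N = ((i:ℝ)+1) * b (i+1) * expC b (N + i - i) := by
    push_cast; simp
  rw [h3]
  apply Finset.single_le_sum (f := fun j : ℕ => ((j:ℝ)+1) * b (j+1) * expC b (N + i - j)) _ (by simp)
  intro j _
  have := hb (j+1)
  have := expC_nonneg b hb (N+i-j)
  positivity

lemma expC_single (K : ℕ) (hK : 1 ≤ K) (x : ℝ) (hx : 0 ≤ x) (j : ℕ) :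
    x^j / (j.factorial : ℝ) ≤ expC (fun k => if k = K then x else 0) (j * K) := by
  have hb : ∀ k, 0 ≤ (fun k => if k = K then x else 0) k := by
    intro k; dsimp; split_ifs <;> simp [hx]
  induction j with
  | zero => simp [expC_zero]
  | succ j ih =>
    have := expC_step _ hb K (j*K) hK
    simp only [if_true] at this
    have h2 : (j+1) * K = j * K + K := by ring
    rw [h2]
    have h3 : (((j*K+K : ℕ)):ℝ) = ((j:ℝ)+1) * K := by push_cast; ring
    rw [h3] at this
    have hK' : (0:ℝ) < K := by exact_mod_cast hK
    have h4 : x * expC (fun k => if k = K then x else 0) (j*K) ≤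
      ((j:ℝ)+1) * expC (fun k => if k = K then x else 0) (j*K+K) := by
      have : (K:ℝ) * (x * expC (fun k => if k = K then x else 0) (j*K)) ≤ K * (((j:ℝ)+1) * expC (fun k => if k = K then x else 0) (j*K+K)) := by
        linarith
      exact le_of_mul_le_mul_left this hK'
    have h5 : x * (x^j / (j.factorial:ℝ)) ≤ ((j:ℝ)+1) * expC (fun k => if k = K then x else 0) (j*K+K) :=
      le_trans (mul_le_mul_of_nonneg_left ih hx) h4
    rw [Nat.factorial_succ]
    push_cast
    rw [div_le_iff₀ (by positivity)]
    have h6 : x * x^j ≤ ((j:ℝ)+1) * expC (fun k => if k = K then x else 0) (j*K+K) * (j.factorial:ℝ) := by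
      rw [mul_div_assoc', div_le_iff₀ (by positivity)] at h5
      exact h5
    rw [pow_succ]; linarith

/-- product lower bound -/
lemma expC_prod (b : ℕ → ℝ) (hb : ∀ k, 0 ≤ b k) (m : ℕ → ℕ) (K : ℕ) :
    ∏ k ∈ Finset.Icc 1 K, (b k)^(m k) / ((m k).factorial : ℝ) ≤
      expC (fun k => if k ≤ K then b k else 0) (∑ k ∈ Finset.Icc 1 K, m k * k) := by
  induction K with
  | zero => simp [expC_zero]
  | succ K ih =>
    rw [Finset.prod_Icc_succ_top (by omega), Finset.sum_Icc_succ_top (by omega)]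
    set N := ∑ k ∈ Finset.Icc 1 K, m k * k
    have hsplit : expC (fun k => if k ≤ K+1 then b k else 0) (N + m (K+1) * (K+1)) =
      expC (fun k => (if k ≤ K then b k else 0) + (if k = K+1 then b (K+1) else 0)) (N + m (K+1) * (K+1)) := by
      apply expC_congr
      intro k _ _
      by_cases h1 : k ≤ K
      · have : k ≠ K+1 := by omega
        simp [h1, this, Nat.le_succ_of_le h1]
      · by_cases h2 : k = K+1
        · subst h2; simp
        · have : ¬ k ≤ K+1 := by omega
          simp [h1, h2, this]
    have hn1 : ∀ k, 0 ≤ (fun k => if k ≤ K then b k else 0) k := by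
      intro k; dsimp; split_ifs <;> simp [hb]
    have hn2 : ∀ k, 0 ≤ (fun k => if k = K+1 then b (K+1) else 0) k := by
      intro k; dsimp; split_ifs <;> simp [hb]
    rw [hsplit, expC_add]
    refine le_trans ?_ (Finset.single_le_sum (f := fun i => expC (fun k => if k ≤ K then b k else 0) i *
      expC (fun k => if k = K+1 then b (K+1) else 0) (N + m (K+1) * (K+1) - i)) ?_ (a := N) ?_)
    · have := expC_single (K+1) (by omega) (b (K+1)) (hb _) (m (K+1))
      simp only [Nat.add_sub_cancel_left]
      apply mul_le_mul ih this
      · have := hb (K+1); positivity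
      · exact expC_nonneg _ hn1 _
    · intro i _
      exact mul_nonneg (expC_nonneg _ hn1 _) (expC_nonneg _ hn2 _)
    · simp

/-- list upper bound -/
lemma expC_list_upper (b : ℕ → ℝ) (hb : ∀ k, 0 ≤ b k) (n M : ℕ) (hn : 1 ≤ n) (hM : M ≤ n)
    (hpos : 0 < expC b M) : ∃ l : List ℕ, (∀ k ∈ l, 1 ≤ k ∧ 0 < b k) ∧ l.sum = M ∧
      expC b M ≤ (n:ℝ)^l.length * (l.map b).prod := by
  induction M using Nat.strong_induction_on with
  | _ M ih =>
    cases M with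
    | zero => exact ⟨[], by simp, by simp, by simp [expC_zero]⟩
    | succ M =>
      have hs := expC_succ b M
      -- exists index i with large term
      obtain ⟨i, hi, hi2⟩ : ∃ i ∈ Finset.range (M+1), expC b (M+1) ≤ ((i:ℝ)+1) * b (i+1) * expC b (M - i) := by
        by_contra hcon
        push Not at hcon
        have : ∑ i ∈ Finset.range (M+1), ((i:ℝ)+1) * b (i+1) * expC b (M - i) < ∑ i ∈ Finset.range (M+1), expC b (M+1) :=
          Finset.sum_lt_sum_of_nonempty (by simp) hcon
        rw [← hs] at this
        simp at this
      have hi' : i ≤ M := by simpa [Nat.lt_succ_iff] using hi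
      have hE0 := expC_nonneg b hb (M - i)
      have hb0 := hb (i+1)
      have hp : 0 < ((i:ℝ)+1) * b (i+1) * expC b (M - i) := lt_of_lt_of_le hpos hi2
      have hbp : 0 < b (i+1) := by
        rcases hb0.eq_or_lt with h | h
        · rw [← h] at hp; simp at hp
        · exact h
      have hEp : 0 < expC b (M - i) := by
        rcases hE0.eq_or_lt with h | h
        · rw [← h] at hp; simp at hp
        · exact h
      obtain ⟨l, hl1, hl2, hl3⟩ := ih (M - i) (by omega) (by omega) hEp
      refine ⟨(i+1) :: l, ?_, ?_, ?_⟩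
      · intro k hk
        rcases List.mem_cons.1 hk with rfl | h
        · exact ⟨by omega, hbp⟩
        · exact hl1 k h
      · simp [hl2]; omega
      · simp only [List.length_cons, List.map_cons, List.prod_cons]
        refine hi2.trans ?_
        have h1 : ((i:ℝ)+1) ≤ n := by
          have : i + 1 ≤ n := by omega
          exact_mod_cast this
        calc ((i:ℝ)+1) * b (i+1) * expC b (M - i) ≤ n * b (i+1) * ((n:ℝ)^l.length * (l.map b).prod) := by
              gcongr
          _ = _ := by ring

lemma expC_list_lower (b : ℕ → ℝ) (hb : ∀ k, 0 ≤ b k) (n : ℕ) (l : List ℕ)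
    (hl : ∀ k ∈ l, 1 ≤ k) (N : ℕ) (hN : N + l.sum ≤ n) :
    (l.map b).prod * expC b N ≤ (n:ℝ)^l.length * expC b (N + l.sum) := by
  induction l with
  | nil => simp
  | cons k l ih =>
    have hk : 1 ≤ k := hl k (by simp)
    have h1 := ih (fun j hj => hl j (by simp [hj])) (by simp at hN; omega)
    have h2 := expC_step b hb k (N + l.sum) hk
    have h3 : N + (k :: l).sum = N + l.sum + k := by simp; omega
    rw [h3]
    simp only [List.length_cons, List.map_cons, List.prod_cons]
    have hbk := hb k
    have hE := expC_nonneg b hb (N + l.sum)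
    have hE2 := expC_nonneg b hb (N + l.sum + k)
    have hk1 : (1:ℝ) ≤ k := by exact_mod_cast hk
    have hn : ((N + l.sum + k : ℕ):ℝ) ≤ n := by
      have : N + l.sum + k ≤ n := by rw [← h3]; exact hN
      exact_mod_cast this
    calc b k * (l.map b).prod * expC b N = b k * ((l.map b).prod * expC b N) := by ring
      _ ≤ b k * ((n:ℝ)^l.length * expC b (N + l.sum)) := by gcongr
      _ = (n:ℝ)^l.length * (1 * b k * expC b (N + l.sum)) := by ring
      _ ≤ (n:ℝ)^l.length * (k * b k * expC b (N + l.sum)) := by gcongr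
      _ ≤ (n:ℝ)^l.length * (((N + l.sum + k : ℕ):ℝ) * expC b (N + l.sum + k)) := by gcongr
      _ ≤ (n:ℝ)^l.length * (n * expC b (N + l.sum + k)) := by gcongr
      _ = _ := by ring

/-- saddle point upper bound -/
lemma expC_upper (b : ℕ → ℝ) (hb : ∀ k, 0 ≤ b k) (N : ℕ) (z : ℝ) (hz : 0 ≤ z) :
    expC b N * z^N ≤ Real.exp (∑ k ∈ Finset.range N, b (k+1) * z^(k+1)) := by
  set B : ℝ → ℝ := fun z => ∑ k ∈ Finset.range N, b (k+1) * z^(k+1) with hB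
  set B' : ℝ → ℝ := fun z => ∑ k ∈ Finset.range N, ((k:ℝ)+1) * b (k+1) * z^k with hB'
  set S : ℝ → ℝ := fun z => ∑ i ∈ Finset.range (N+1), expC b i * z^i with hS
  set S' : ℝ → ℝ := fun z => ∑ i ∈ Finset.range N, ((i:ℝ)+1) * expC b (i+1) * z^i with hS'
  have dB : ∀ z, HasDerivAt B (B' z) z := by
    intro z
    have : ∀ k ∈ Finset.range N, HasDerivAt (fun z => b (k+1) * z^(k+1)) (((k:ℝ)+1) * b (k+1) * z^k) z := by
      intro k _
      have := (hasDerivAt_pow (k+1) z).const_mul (b (k+1))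
      exact this.congr_deriv (by push_cast; ring)
    exact HasDerivAt.fun_sum this
  have dS : ∀ z, HasDerivAt S (S' z) z := by
    intro z
    have h1 : S = fun z => (∑ i ∈ Finset.range N, expC b (i+1) * z^(i+1)) + 1 := by
      funext z; rw [hS]; dsimp; rw [Finset.sum_range_succ']; simp [expC_zero]
    have : ∀ k ∈ Finset.range N, HasDerivAt (fun z => expC b (k+1) * z^(k+1)) (((k:ℝ)+1) * expC b (k+1) * z^k) z := by
      intro k _
      have := (hasDerivAt_pow (k+1) z).const_mul (expC b (k+1))
      exact this.congr_deriv (by push_cast; ring)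
    rw [h1]
    exact (HasDerivAt.fun_sum this).add_const 1
  have hle : ∀ z, 0 ≤ z → S' z ≤ B' z * S z := by
    intro z hz
    rw [hS', hB', hS]; dsimp
    have h1 : ∀ i ∈ Finset.range N, ((i:ℝ)+1) * expC b (i+1) * z^i =
      ∑ j ∈ Finset.range (i+1), (((j:ℝ)+1) * b (j+1) * z^j) * (expC b (i-j) * z^(i-j)) := by
      intro i _
      rw [expC_succ, Finset.sum_mul]
      refine Finset.sum_congr rfl fun j hj => ?_
      have : j ≤ i := by simpa [Nat.lt_succ_iff] using hj
      have : z^i = z^j * z^(i-j) := by rw [← pow_add]; congr 1; omega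
      rw [this]; ring
    rw [Finset.sum_congr rfl h1, Finset.sum_mul_sum]
    rw [Finset.sum_sigma', ← Finset.sum_product']
    refine le_trans (le_of_eq ?_) (Finset.sum_le_sum_of_subset_of_nonneg (s := (Finset.range N ×ˢ Finset.range (N+1)).filter (fun x => x.1 + x.2 < N)) (Finset.filter_subset _ _) ?_)
    · refine Finset.sum_bij' (fun x _ => (x.2, x.1 - x.2)) (fun y _ => ⟨y.1 + y.2, y.1⟩) ?_ ?_ ?_ ?_ ?_
      · rintro ⟨i, j⟩ h; simp at h ⊢; omega
      · rintro ⟨i, j⟩ h; simp at h ⊢; omega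
      · rintro ⟨i, j⟩ h; simp at h ⊢; omega
      · rintro ⟨i, j⟩ h; simp at h ⊢
      · rintro ⟨i, j⟩ h; simp
    · rintro ⟨i, j⟩ _ _
      dsimp
      have := hb (i+1)
      have := expC_nonneg b hb j
      positivity
  have hanti : AntitoneOn (fun z => S z * Real.exp (-(B z))) (Set.Ici 0) := by
    have hd : ∀ z, HasDerivAt (fun z => S z * Real.exp (-(B z)))
      (S' z * Real.exp (-(B z)) + S z * (Real.exp (-(B z)) * (-(B' z)))) z :=
      fun z => (dS z).mul ((dB z).neg.exp)
    apply antitoneOn_of_deriv_nonpos (convex_Ici 0)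
    · exact fun z _ => (hd z).continuousAt.continuousWithinAt
    · exact fun z _ => (hd z).differentiableAt.differentiableWithinAt
    · intro z hz
      rw [(hd z).deriv]
      have hz' : 0 ≤ z := by
        have := interior_subset hz; exact this
      have h1 := hle z hz'
      have h2 := Real.exp_pos (-(B z))
      nlinarith
  have h0 : S 0 * Real.exp (-(B 0)) = 1 := by
    simp [hS, hB, Finset.sum_range_succ', expC_zero]
  have h1 := hanti (Set.self_mem_Ici) (show z ∈ Set.Ici 0 from hz) hz
  dsimp only at h1
  rw [h0, Real.exp_neg, ← div_eq_mul_inv, div_le_one (Real.exp_pos _)] at h1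
  refine le_trans ?_ h1
  apply Finset.single_le_sum (f := fun i => expC b i * z^i) _ (by simp)
  intro i _
  have := expC_nonneg b hb i
  positivity

/-- Numbers `cc p m` : probability that `K_{m+1}` with edge probability `p` is connected. -/
def cc (p : ℝ) : ℕ → ℝ
  | N => 1 - ∑ k : Fin N, (N.choose k : ℝ) * cc p k * (1-p)^((k+1)*(N-k))

lemma cc_rec (p : ℝ) (N : ℕ) :
    ∑ k ∈ Finset.range (N+1), (N.choose k : ℝ) * cc p k * (1-p)^((k+1)*(N-k)) = 1 := by
  rw [Finset.sum_range_succ]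
  rw [cc.eq_def p N, Finset.sum_range]
  simp

lemma cc_unique {V : Type*} [DecidableEq V] (p : ℝ) (W : Finset V) (K : Finset V → ℝ)
    (h : ∀ U ⊆ W, ∑ S ∈ U.powerset, K S * (1-p)^((S.card+1)*(U.card - S.card)) = 1) :
    ∀ S ⊆ W, K S = cc p S.card := by
  intro S
  induction S using Finset.strongInduction with
  | _ S ih =>
    intro hS
    have h1 := h S hS
    have h2 : ∑ T ∈ S.powerset, cc p T.card * (1-p)^((T.card+1)*(S.card - T.card)) = 1 := by
      rw [Finset.sum_powerset_apply_card (fun k => cc p k * (1-p)^((k+1)*(S.card - k))) (x := S)]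
      refine (Finset.sum_congr rfl fun k _ => ?_).trans (cc_rec p S.card)
      simp [mul_assoc]
    rw [← Finset.sum_erase_add _ _ (Finset.mem_powerset_self S)] at h1 h2
    have h3 : ∑ T ∈ S.powerset.erase S, K T * (1-p)^((T.card+1)*(S.card - T.card)) =
      ∑ T ∈ S.powerset.erase S, cc p T.card * (1-p)^((T.card+1)*(S.card - T.card)) := by
      refine Finset.sum_congr rfl fun T hT => ?_
      rw [Finset.mem_erase, Finset.mem_powerset] at hT
      rw [ih T (Finset.ssubset_iff_subset_ne.2 ⟨hT.2, hT.1⟩) (hT.2.trans hS)]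
    simp at h1 h2 h3
    linarith

section graphs
set_option linter.unusedSectionVars false
open Classical
variable {V : Type} [Fintype V]

/-- pairs inside `U` -/
def EE (U : Finset V) : Finset (Sym2 V) := U.offDiag.image Sym2.mk.uncurry

lemma mem_EE (U : Finset V) (a b : V) : s(a,b) ∈ EE U ↔ a ∈ U ∧ b ∈ U ∧ a ≠ b := by
  unfold EE
  simp only [Finset.mem_image, Finset.mem_offDiag, Prod.exists]
  constructor
  · rintro ⟨x, y, ⟨hx, hy, hxy⟩, h⟩
    have h' : s(x,y) = s(a,b) := h
    rw [Sym2.eq_iff] at h'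
    rcases h' with ⟨rfl, rfl⟩ | ⟨rfl, rfl⟩
    · exact ⟨hx, hy, hxy⟩
    · exact ⟨hy, hx, hxy.symm⟩
  · rintro ⟨ha, hb, hab⟩
    exact ⟨a, b, ⟨ha, hb, hab⟩, rfl⟩

lemma card_EE (U : Finset V) : (EE U).card = U.card.choose 2 := by
  unfold EE
  exact Sym2.card_image_offDiag U

def comp (ω : Finset (Sym2 V)) (v : V) : Finset V :=
  Finset.univ.filter (fun w => (SimpleGraph.fromEdgeSet (ω : Set (Sym2 V))).Reachable v w)

lemma mem_comp (ω : Finset (Sym2 V)) (v w : V) : w ∈ comp ω v ↔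
    (SimpleGraph.fromEdgeSet (ω : Set (Sym2 V))).Reachable v w := by simp [comp]

def wtE (p : ℝ) (U : Finset V) (ω : Finset (Sym2 V)) : ℝ :=
  p ^ ω.card * (1-p)^((EE U).card - ω.card)

def AA (p : ℝ) (g : ℕ → ℝ) (U : Finset V) : ℝ :=
  ∑ ω ∈ (EE U).powerset, wtE p U ω * ∏ v ∈ U, g (comp ω v).card

def Conn (p : ℝ) (v0 : V) (S : Finset V) : ℝ :=
  ∑ ω ∈ (EE S).powerset.filter (fun ω => comp ω v0 = S), wtE p S ω

lemma reach_transfer (G H : SimpleGraph V) (S : Set V)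
    (h : ∀ a ∈ S, ∀ b, G.Adj a b → b ∈ S ∧ H.Adj a b) {v w : V} (hv : v ∈ S)
    (hr : G.Reachable v w) : w ∈ S ∧ H.Reachable v w := by
  obtain ⟨W⟩ := hr
  induction W with
  | nil => exact ⟨hv, SimpleGraph.Reachable.refl _⟩
  | cons hadj _ ih =>
    have h1 := h _ hv _ hadj
    have h2 := ih h1.1
    exact ⟨h2.1, (h1.2.reachable).trans h2.2⟩

lemma comp_subset (U : Finset V) (ω : Finset (Sym2 V)) (hω : ω ⊆ EE U) (v : V) (hv : v ∈ U) :
    comp ω v ⊆ U := by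
  intro w hw
  rw [mem_comp] at hw
  refine (reach_transfer _ (SimpleGraph.fromEdgeSet (ω : Set (Sym2 V))) (U : Set V) ?_ (by exact_mod_cast hv) hw).1
  intro a ha b hab
  refine ⟨?_, hab⟩
  rw [SimpleGraph.fromEdgeSet_adj] at hab
  exact ((mem_EE U a b).1 (hω (by exact_mod_cast hab.1))).2.1

lemma comp_self (ω : Finset (Sym2 V)) (v : V) : v ∈ comp ω v := by
  rw [mem_comp]

lemma comp_eq_of_mem (ω : Finset (Sym2 V)) (v w : V) (h : w ∈ comp ω v) : comp ω w = comp ω v := by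
  ext u
  rw [mem_comp] at *
  rw [mem_comp]
  exact ⟨fun h2 => h.trans h2, fun h2 => h.symm.trans h2⟩

/-- union of configurations on disjoint sets: component in `S`. -/
lemma comp_union_left (S T : Finset V) (hST : Disjoint S T) (ω₁ ω₂ : Finset (Sym2 V))
    (h1 : ω₁ ⊆ EE S) (h2 : ω₂ ⊆ EE T) (v : V) (hv : v ∈ S) : comp (ω₁ ∪ ω₂) v = comp ω₁ v := by
  ext w
  rw [mem_comp, mem_comp]
  constructor
  · intro h
    refine (reach_transfer _ _ (S : Set V) ?_ (by exact_mod_cast hv) h).2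
    intro a ha b hab
    rw [SimpleGraph.fromEdgeSet_adj] at hab ⊢
    have ha' : a ∈ S := by exact_mod_cast ha
    rcases Finset.mem_union.1 (Finset.mem_coe.1 hab.1) with h | h
    · exact ⟨((mem_EE S a b).1 (h1 h)).2.1, h, hab.2⟩
    · exact absurd ((mem_EE T a b).1 (h2 h)).1 (Finset.disjoint_left.1 hST ha')
  · intro h
    refine SimpleGraph.Reachable.mono ?_ h
    apply SimpleGraph.fromEdgeSet_mono
    simp

lemma EE_mono {S U : Finset V} (h : S ⊆ U) : EE S ⊆ EE U := by
  intro e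
  induction e using Sym2.ind with
  | _ a b =>
    rw [mem_EE, mem_EE]
    exact fun ⟨h1, h2, h3⟩ => ⟨h h1, h h2, h3⟩

lemma EE_disj {S T : Finset V} (h : Disjoint S T) : Disjoint (EE S) (EE T) := by
  rw [Finset.disjoint_left]
  intro e
  induction e using Sym2.ind with
  | _ a b =>
    rw [mem_EE, mem_EE]
    exact fun h1 h2 => Finset.disjoint_left.1 h h1.1 h2.1

lemma choose_add_two (a b : ℕ) : (a+b).choose 2 = a.choose 2 + b.choose 2 + a * b := by
  induction b with
  | zero => simp
  | succ b ih =>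
    rw [← add_assoc, Nat.choose_succ_succ' (a+b) 1, Nat.choose_succ_succ' b 1, ih]
    simp; ring

lemma wtE_union (p : ℝ) (S T : Finset V) (hST : Disjoint S T) (ω₁ ω₂ : Finset (Sym2 V))
    (h1 : ω₁ ⊆ EE S) (h2 : ω₂ ⊆ EE T) : wtE p (S ∪ T) (ω₁ ∪ ω₂) =
      wtE p S ω₁ * wtE p T ω₂ * (1-p)^(S.card * T.card) := by
  unfold wtE
  have hd : Disjoint ω₁ ω₂ := Finset.disjoint_of_subset_left h1 (Finset.disjoint_of_subset_right h2 (EE_disj hST))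
  rw [Finset.card_union_of_disjoint hd]
  have c1 := Finset.card_le_card h1
  have c2 := Finset.card_le_card h2
  have : (EE (S ∪ T)).card - (ω₁.card + ω₂.card) = ((EE S).card - ω₁.card) + ((EE T).card - ω₂.card) + S.card * T.card := by
    rw [card_EE] at *
    rw [card_EE] at *
    rw [Finset.card_union_of_disjoint hST, choose_add_two]
    rw [card_EE]
    omega
  rw [this, pow_add, pow_add, pow_add]; ring

/-- the fibre sum -/
lemma AA_fiber (p : ℝ) (g : ℕ → ℝ) (S T : Finset V) (hST : Disjoint S T) (v0 : V) (hv0 : v0 ∈ S) :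
    ∑ ω ∈ (EE (S ∪ T)).powerset.filter (fun ω => comp ω v0 = S),
      wtE p (S ∪ T) ω * ∏ v ∈ S ∪ T, g (comp ω v).card =
    Conn p v0 S * g S.card ^ S.card * (1-p)^(S.card * T.card) * AA p g T := by
  unfold Conn AA
  rw [mul_assoc, mul_assoc, Finset.sum_mul, ← mul_assoc]
  simp_rw [Finset.mul_sum]
  rw [← Finset.sum_product']
  symm
  refine Finset.sum_bij' (fun x _ => x.1 ∪ x.2) (fun ω _ => (ω ∩ EE S, ω ∩ EE T)) ?_ ?_ ?_ ?_ ?_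
  · rintro ⟨ω₁, ω₂⟩ h
    simp only [Finset.mem_product, Finset.mem_filter, Finset.mem_powerset] at h ⊢
    obtain ⟨⟨h1, h2⟩, h3⟩ := h
    refine ⟨Finset.union_subset (h1.trans (EE_mono Finset.subset_union_left)) (h3.trans (EE_mono Finset.subset_union_right)), ?_⟩
    rw [comp_union_left S T hST _ _ h1 h3 v0 hv0, h2]
  · intro ω h
    simp only [Finset.mem_product, Finset.mem_filter, Finset.mem_powerset] at h ⊢
    obtain ⟨h1, h2⟩ := h
    refine ⟨⟨Finset.inter_subset_right, ?_⟩, Finset.inter_subset_right⟩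
    rw [← h2]
    ext w
    rw [mem_comp, mem_comp]
    constructor
    · intro h
      refine SimpleGraph.Reachable.mono ?_ h
      apply SimpleGraph.fromEdgeSet_mono
      simp
    · intro h
      refine (reach_transfer _ _ (comp ω v0 : Set V) ?_ (by simpa using comp_self ω v0) h).2
      intro a ha b hab
      have ha' : a ∈ comp ω v0 := by exact_mod_cast ha
      have hb' : b ∈ comp ω v0 := by
        rw [mem_comp] at ha' ⊢
        exact ha'.trans hab.reachable
      refine ⟨by exact_mod_cast hb', ?_⟩
      rw [SimpleGraph.fromEdgeSet_adj] at hab ⊢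
      refine ⟨?_, hab.2⟩
      rw [Finset.mem_coe, Finset.mem_inter]
      exact ⟨by exact_mod_cast hab.1, (mem_EE _ _ _).2 ⟨ha', hb', hab.2⟩⟩
  · rintro ⟨ω₁, ω₂⟩ h
    simp only [Finset.mem_product, Finset.mem_filter, Finset.mem_powerset] at h
    obtain ⟨⟨h1, h2⟩, h3⟩ := h
    have hd := EE_disj hST
    have e1 : ω₂ ∩ EE S = ∅ := by
      rw [← Finset.disjoint_iff_inter_eq_empty]
      exact Finset.disjoint_of_subset_left h3 hd.symm
    have e2 : ω₁ ∩ EE T = ∅ := by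
      rw [← Finset.disjoint_iff_inter_eq_empty]
      exact Finset.disjoint_of_subset_left h1 hd
    simp only [Prod.mk.injEq, Finset.union_inter_distrib_right, e1, e2]
    simp [Finset.inter_eq_left.2 h1, Finset.inter_eq_left.2 h3]
  · intro ω h
    simp only [Finset.mem_filter, Finset.mem_powerset] at h
    obtain ⟨h1, h2⟩ := h
    dsimp
    rw [← Finset.inter_union_distrib_left, Finset.inter_eq_left]
    intro e he
    have he2 := h1 he
    induction e using Sym2.ind with
    | _ a b =>
      rw [mem_EE] at he2
      rw [Finset.mem_union, mem_EE, mem_EE]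
      have hadj : (SimpleGraph.fromEdgeSet (ω : Set (Sym2 V))).Adj a b := by
        rw [SimpleGraph.fromEdgeSet_adj]; exact ⟨by exact_mod_cast he, he2.2.2⟩
      have hiff : a ∈ S ↔ b ∈ S := by
        rw [← h2, mem_comp, mem_comp]
        exact ⟨fun h => h.trans hadj.reachable, fun h => h.trans hadj.reachable.symm⟩
      by_cases haS : a ∈ S
      · left; exact ⟨haS, hiff.1 haS, he2.2.2⟩
      · right
        have hbS : b ∉ S := fun h => haS (hiff.2 h)
        have ha := he2.1
        have hb := he2.2.1
        rw [Finset.mem_union] at ha hb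
        exact ⟨ha.resolve_left haS, hb.resolve_left hbS, he2.2.2⟩
  · rintro ⟨ω₁, ω₂⟩ h
    simp only [Finset.mem_product, Finset.mem_filter, Finset.mem_powerset] at h
    obtain ⟨⟨h1, h2⟩, h3⟩ := h
    dsimp
    rw [wtE_union p S T hST _ _ h1 h3, Finset.prod_union hST]
    have e1 : ∏ v ∈ S, g (comp (ω₁ ∪ ω₂) v).card = g S.card ^ S.card := by
      rw [← Finset.prod_const]
      refine Finset.prod_congr rfl fun v hv => ?_
      rw [comp_union_left S T hST _ _ h1 h3 v hv, comp_eq_of_mem ω₁ v0 v (by rw [h2]; exact hv), h2]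
    have e2 : ∏ v ∈ T, g (comp (ω₁ ∪ ω₂) v).card = ∏ v ∈ T, g (comp ω₂ v).card := by
      refine Finset.prod_congr rfl fun v hv => ?_
      rw [Finset.union_comm, comp_union_left T S hST.symm _ _ h3 h1 v hv]
    rw [e1, e2]; ring

lemma AA_rec (p : ℝ) (g : ℕ → ℝ) (U : Finset V) (v0 : V) (hv0 : v0 ∉ U) :
    AA p g (insert v0 U) = ∑ T ∈ U.powerset, Conn p v0 (insert v0 T) * g (T.card+1) ^ (T.card+1) *
      (1-p)^((T.card+1) * (U.card - T.card)) * AA p g (U \ T) := by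
  conv_lhs => unfold AA
  rw [← Finset.sum_fiberwise_of_maps_to (s := (EE (insert v0 U)).powerset) (t := U.powerset)
    (g := fun ω => (comp ω v0).erase v0)]
  · refine Finset.sum_congr rfl fun T hT => ?_
    rw [Finset.mem_powerset] at hT
    have hv0T : v0 ∉ T := fun h => hv0 (hT h)
    have hdis : Disjoint (insert v0 T) (U \ T) := by
      rw [Finset.disjoint_insert_left]
      exact ⟨by simp [hv0], Finset.disjoint_sdiff⟩
    have hun : insert v0 U = insert v0 T ∪ (U \ T) := by
      rw [Finset.insert_union, Finset.union_sdiff_of_subset hT]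
    have := AA_fiber p g (insert v0 T) (U \ T) hdis v0 (by simp)
    rw [← hun, Finset.card_insert_of_notMem hv0T, Finset.card_sdiff_of_subset hT] at this
    rw [← this]
    refine Finset.sum_congr ?_ fun _ _ => rfl
    ext ω
    simp only [Finset.mem_filter]
    refine and_congr_right fun _ => ?_
    constructor
    · rintro rfl
      rw [Finset.insert_erase (comp_self ω v0)]
    · intro h
      rw [h, Finset.erase_insert hv0T]
  · intro ω hω
    rw [Finset.mem_powerset] at *
    have := comp_subset _ ω hω v0 (by simp)
    intro w hw
    rw [Finset.mem_erase] at hw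
    have := this hw.2
    rw [Finset.mem_insert] at this
    exact this.resolve_left hw.1

lemma AA_one (p : ℝ) (U : Finset V) : AA p (fun _ => 1) U = 1 := by
  unfold AA wtE
  simp only [Finset.prod_const_one, mul_one]
  rw [Finset.sum_pow_mul_eq_add_pow]
  simp

lemma Conn_eq (p : ℝ) (v0 : V) (T : Finset V) (hT : v0 ∉ T) : Conn p v0 (insert v0 T) = cc p T.card := by
  refine cc_unique p (Finset.univ.erase v0) (fun T => Conn p v0 (insert v0 T)) ?_ T ?_
  · intro U hU
    have hv : v0 ∉ U := fun h => by have := hU h; simp at this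
    have := AA_rec p (fun _ => 1) U v0 hv
    simp only [AA_one, one_pow, mul_one] at this
    exact this.symm
  · intro w hw
    simp
    rintro rfl; exact hT hw

lemma AA_eq (p : ℝ) (hp : p < 1) (g : ℕ → ℝ) (U : Finset V) : AA p g U =
    (U.card.factorial : ℝ) * (1-p)^(U.card.choose 2) *
      expC (fun k => g k ^ k * (cc p (k-1) / ((1-p)^(k.choose 2) * (k.factorial:ℝ)))) U.card := by
  have hr : (1 - p) ≠ 0 := by linarith
  induction U using Finset.strongInduction with
  | _ U ih =>
    rcases U.eq_empty_or_nonempty with rfl | ⟨v0, hv0⟩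
    · simp [AA, EE, expC_zero, wtE]
    · obtain ⟨U', hU', rfl⟩ : ∃ U', v0 ∉ U' ∧ insert v0 U' = U := ⟨U.erase v0, by simp, Finset.insert_erase hv0⟩
      rw [AA_rec p g U' v0 hU', Finset.card_insert_of_notMem hU']
      set m := U'.card with hm
      set F : ℕ → ℝ := fun k => cc p k * g (k+1)^(k+1) * (1-p)^((k+1)*(m-k)) * (((m-k).factorial : ℝ) * (1-p)^((m-k).choose 2) *
      expC (fun k => g k ^ k * (cc p (k-1) / ((1-p)^(k.choose 2) * (k.factorial:ℝ)))) (m-k)) with hF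
      have h1 : ∀ T ∈ U'.powerset, Conn p v0 (insert v0 T) * g (T.card+1) ^ (T.card+1) *
          (1-p)^((T.card+1) * (U'.card - T.card)) * AA p g (U' \ T) =
          F T.card := by
        intro T hT
        rw [Finset.mem_powerset] at hT
        have hss : U' \ T ⊂ insert v0 U' :=
          lt_of_le_of_lt Finset.sdiff_subset (Finset.ssubset_insert hU')
        rw [Conn_eq p v0 T (fun h => hU' (hT h)), ih (U' \ T) hss, Finset.card_sdiff_of_subset hT]
      rw [Finset.sum_congr rfl h1, Finset.sum_powerset_apply_card F, ← hm]
      have h2 := expC_succ (fun k => g k ^ k * (cc p (k-1) / ((1-p)^(k.choose 2) * (k.factorial:ℝ)))) m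
      have h3 : ((m+1).factorial : ℝ) = (m.factorial:ℝ) * ((m:ℝ)+1) := by
        rw [Nat.factorial_succ]; push_cast; ring
      rw [h3]
      have h4 : ∀ x y z w : ℝ, x * y * z * w = x * z * (y * w) := by intros; ring
      rw [h4, h2, Finset.mul_sum]
      refine Finset.sum_congr rfl fun k hk => ?_
      have hk' : k ≤ m := by simpa [Nat.lt_succ_iff] using hk
      simp only [hF, Nat.add_sub_cancel, nsmul_eq_mul]
      have h5 : (m+1).choose 2 = (k+1).choose 2 + (m-k).choose 2 + (k+1)*(m-k) := by
        rw [← choose_add_two]; congr 1; omega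
      rw [h5, pow_add, pow_add, Nat.cast_choose ℝ hk', Nat.factorial_succ]
      push_cast
      have := Nat.factorial_pos k
      have := Nat.factorial_pos (m-k)
      field_simp
      rw [pow_add]; ring
end graphs

/-- cluster generating coefficients -/
def bb (p q : ℝ) (k : ℕ) : ℝ := q * (cc p (k-1) / ((1-p)^(k.choose 2) * (k.factorial:ℝ)))

/-- restriction to small clusters -/
def bL (p q ρ : ℝ) (k : ℕ) : ℝ := if (k:ℝ) ≤ ρ then bb p q k else 0

/-- restriction to large clusters -/
def bG (p q ρ : ℝ) (k : ℕ) : ℝ := if (k:ℝ) ≤ ρ then 0 else bb p q k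

section graphs2
open Classical

lemma compSize_comp {n : ℕ} (G : SimpleGraph (Fin n)) (v : Fin n) :
    (comp G.edgeFinset v).card = compSize G v := by
  unfold compSize
  rw [← Set.ncard_coe_finset]
  congr 1
  ext w
  rw [Finset.mem_coe, mem_comp, SimpleGraph.coe_edgeFinset, SimpleGraph.fromEdgeSet_edgeSet,
    SimpleGraph.ConnectedComponent.mem_supp_iff, SimpleGraph.ConnectedComponent.eq]
  exact ⟨fun h => h.symm, fun h => h.symm⟩

lemma sum_inv_compSize {n : ℕ} (G : SimpleGraph (Fin n)) :
    ∑ v, (1 / (compSize G v : ℝ)) = Nat.card G.ConnectedComponent := by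
  rw [← Finset.sum_fiberwise (s := Finset.univ) (g := fun v => G.connectedComponentMk v)]
  have : ∀ C : G.ConnectedComponent, ∑ v ∈ Finset.univ.filter (fun v => G.connectedComponentMk v = C),
      (1 / (compSize G v : ℝ)) = 1 := by
    intro C
    have h1 : ∀ v ∈ Finset.univ.filter (fun v => G.connectedComponentMk v = C),
      (1 / (compSize G v : ℝ)) = 1 / (C.supp.ncard : ℝ) := by
      intro v hv
      simp only [Finset.mem_filter] at hv
      unfold compSize; rw [hv.2]
    rw [Finset.sum_congr rfl h1, Finset.sum_const]
    have h2 : (Finset.univ.filter (fun v => G.connectedComponentMk v = C)).card = C.supp.ncard := by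
      rw [← Set.ncard_coe_finset]
      congr 1
      ext v
      simp
    rw [h2, nsmul_eq_mul]
    have h3 : C.supp.ncard ≠ 0 := by
      exact (Set.ncard_pos (Set.toFinite _)).2 C.nonempty_supp |>.ne'
    field_simp
  rw [Finset.sum_congr rfl fun C _ => this C]
  simp

lemma EE_univ_iff {n : ℕ} (ω : Finset (Sym2 (Fin n))) (h : ω ⊆ EE Finset.univ) :
    (SimpleGraph.fromEdgeSet (ω : Set (Sym2 (Fin n)))).edgeFinset = ω := by
  ext e
  rw [SimpleGraph.mem_edgeFinset, SimpleGraph.edgeSet_fromEdgeSet]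
  induction e using Sym2.ind with
  | _ a b =>
    have := @h s(a,b)
    rw [mem_EE] at this
    simp
    exact fun h => (this h).2.2

lemma edge_sub {n : ℕ} (G : SimpleGraph (Fin n)) : G.edgeFinset ⊆ EE Finset.univ := by
  intro e
  induction e using Sym2.ind with
  | _ a b =>
    rw [mem_EE, SimpleGraph.mem_edgeFinset, SimpleGraph.mem_edgeSet]
    exact fun h => ⟨by simp, by simp, h.ne⟩

lemma gen_eq (n : ℕ) (p q ρ x : ℝ) (hq : 0 < q) (hn : 0 < n):
    ∑ G : SimpleGraph (Fin n), rcW n p q G * x ^ (Vbig G ρ).ncard =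
      AA p (fun k => q ^ (1/(k:ℝ)) * (if (k:ℝ) ≤ ρ then 1 else x)) (Finset.univ : Finset (Fin n)) := by
  unfold AA
  refine Finset.sum_bij' (fun G _ => G.edgeFinset) (fun ω _ => SimpleGraph.fromEdgeSet (ω : Set (Sym2 (Fin n)))) ?_ ?_ ?_ ?_ ?_
  · intro G _
    rw [Finset.mem_powerset]; exact edge_sub G
  · intro ω _; simp
  · intro G _; simp
  · intro ω h
    rw [Finset.mem_powerset] at h
    convert EE_univ_iff ω h
  · intro G _
    simp_rw [compSize_comp]
    rw [Finset.prod_mul_distrib]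
    have h1 : ∏ v, q ^ (1/(compSize G v : ℝ)) = q ^ Nat.card G.ConnectedComponent := by
      rw [← Real.rpow_sum_of_pos hq, sum_inv_compSize, Real.rpow_natCast]
    have h2 : ∏ v, (if (compSize G v:ℝ) ≤ ρ then 1 else x) = x ^ (Vbig G ρ).ncard := by
      rw [Finset.prod_ite]
      simp only [Finset.prod_const_one, one_mul, Finset.prod_const]
      congr 1
      rw [← Set.ncard_coe_finset]
      congr 1
      ext v
      simp [Vbig]
    rw [h1, h2]
    unfold rcW wtE
    rw [card_EE, Finset.card_univ, Fintype.card_fin, Nat.choose_two_right,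
      ← SimpleGraph.coe_edgeFinset, Set.ncard_coe_finset]
    ring

lemma Zrc_sum (n : ℕ) (lam q ρ x : ℝ) :
    ∑ m ∈ Finset.range (n+1), Zrc n lam q {G | (Vbig G ρ).ncard = m} * x ^ m =
    ∑ G : SimpleGraph (Fin n), rcW n (lam/n) q G * x ^ (Vbig G ρ).ncard := by
  rw [← Finset.sum_fiberwise_of_maps_to (s := Finset.univ) (t := Finset.range (n+1))
    (g := fun G : SimpleGraph (Fin n) => (Vbig G ρ).ncard)]
  · refine Finset.sum_congr rfl fun m _ => ?_
    unfold Zrc ZP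
    rw [finsum_mem_def, finsum_eq_sum_of_fintype, Finset.sum_mul, Finset.sum_filter]
    refine Finset.sum_congr rfl fun G _ => ?_
    by_cases h : (Vbig G ρ).ncard = m
    · simp [h]
    · simp [h]
  · intro G _
    rw [Finset.mem_range, Nat.lt_succ_iff]
    have := Set.ncard_le_card (Vbig G ρ)
    simpa using this

theorem Zrc_eq (n m : ℕ) (lam q ρ : ℝ) (hq : 0 < q) (hp : lam / n < 1) (hn : 0 < n) (hm : m ≤ n) :
    Zrc n lam q {G | (Vbig G ρ).ncard = m} = (n.factorial : ℝ) * (1 - lam/n)^(n.choose 2) *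
      (expC (bG (lam/n) q ρ) m * expC (bL (lam/n) q ρ) (n-m)) := by
  set p := lam / n with hpdef
  have key : ∀ x : ℝ, ∑ m ∈ Finset.range (n+1), Zrc n lam q {G | (Vbig G ρ).ncard = m} * x ^ m =
      ∑ m ∈ Finset.range (n+1), ((n.factorial : ℝ) * (1 - p)^(n.choose 2) *
      (expC (bG p q ρ) m * expC (bL p q ρ) (n-m))) * x^m := by
    intro x
    rw [Zrc_sum, gen_eq n _ q ρ x hq hn, AA_eq p hp]
    rw [Finset.card_univ, Fintype.card_fin]
    have : expC (fun k => (q ^ (1/(k:ℝ)) * (if (k:ℝ) ≤ ρ then 1 else x)) ^ k *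
        (cc p (k-1) / ((1-p)^(k.choose 2) * (k.factorial:ℝ)))) n =
        expC (fun k => x^k * bG p q ρ k + bL p q ρ k) n := by
      refine expC_congr _ _ n fun k hk _ => ?_
      have hk0 : (k:ℝ) ≠ 0 := by positivity
      have h1 : (q ^ (1/(k:ℝ)))^k = q := by
        rw [← Real.rpow_natCast, ← Real.rpow_mul hq.le]
        field_simp
        simp
      rw [mul_pow, h1]
      unfold bG bL bb
      split_ifs
      · simp
      · ring
    rw [this, expC_add (fun k => x^k * bG p q ρ k) (bL p q ρ), Finset.mul_sum]
    refine Finset.sum_congr rfl fun m _ => ?_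
    rw [expC_scale]; ring
  have := Polynomial.funext (p := ∑ m ∈ Finset.range (n+1), Polynomial.C (Zrc n lam q {G | (Vbig G ρ).ncard = m}) * Polynomial.X ^ m)
    (q := ∑ m ∈ Finset.range (n+1), Polynomial.C ((n.factorial : ℝ) * (1 - p)^(n.choose 2) *
      (expC (bG p q ρ) m * expC (bL p q ρ) (n-m))) * Polynomial.X ^ m) (by
      intro x
      have := key x
      rw [Polynomial.eval_finsetSum, Polynomial.eval_finsetSum]
      simp only [Polynomial.eval_mul, Polynomial.eval_C, Polynomial.eval_pow, Polynomial.eval_X]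
      exact this)
  have h2 := congrArg (fun P => Polynomial.coeff P m) this
  simp only [Polynomial.finsetSum_coeff, Polynomial.coeff_C_mul, Polynomial.coeff_X_pow] at h2
  have hm' : m ∈ Finset.range (n+1) := by simp; omega
  simp only [mul_ite, mul_one, mul_zero, Finset.sum_ite_eq, if_pos hm'] at h2
  exact h2

end graphs2

section parking
set_option linter.unusedSectionVars false
open Classical
variable {V : Type} [Fintype V]

def bx (S : Finset V) (t : Finset ℕ) : Finset (V → ℕ) :=
  Fintype.piFinset (fun v => if v ∈ S then t else {0})

lemma mem_bx (S : Finset V) (t : Finset ℕ) (f : V → ℕ) :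
    f ∈ bx S t ↔ (∀ v ∈ S, f v ∈ t) ∧ ∀ v ∉ S, f v = 0 := by
  unfold bx
  rw [Fintype.mem_piFinset]
  constructor
  · intro h
    exact ⟨fun v hv => by simpa [hv] using h v, fun v hv => by simpa [hv] using h v⟩
  · rintro ⟨h1, h2⟩ v
    by_cases hv : v ∈ S
    · simpa [hv] using h1 v hv
    · simpa [hv] using h2 v hv

lemma sum_bx (S : Finset V) (t : Finset ℕ) (w : ℕ → ℝ) :
    ∑ f ∈ bx S t, ∏ v ∈ S, w (f v) = (∑ i ∈ t, w i) ^ S.card := by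
  have h := Finset.prod_univ_sum (fun v => if v ∈ S then t else {0})
    (fun (v:V) i => if v ∈ S then w i else 1)
  have h1 : ∀ v : V, (∑ i ∈ (if v ∈ S then t else {0}), (if v ∈ S then w i else 1)) =
      if v ∈ S then ∑ i ∈ t, w i else 1 := by
    intro v; split_ifs <;> simp
  rw [Finset.prod_congr rfl fun v _ => h1 v] at h
  rw [Finset.prod_ite_mem, Finset.univ_inter, Finset.prod_const] at h
  rw [h]
  refine Finset.sum_congr rfl fun f _ => ?_
  rw [Finset.prod_ite_mem, Finset.univ_inter]

def GD (S : Finset V) : Finset (V → ℕ) :=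
  (bx S (Finset.range (S.card+1))).filter
    (fun f => ∀ t, 1 ≤ t → t ≤ S.card → t ≤ (S.filter (fun v => f v < t)).card)

lemma mem_GD (S : Finset V) (f : V → ℕ) : f ∈ GD S ↔ f ∈ bx S (Finset.range (S.card+1)) ∧
    ∀ t, 1 ≤ t → t ≤ S.card → t ≤ (S.filter (fun v => f v < t)).card := by
  unfold GD
  simp only [Finset.mem_filter]

def PK (p : ℝ) (S : Finset V) : ℝ := ∑ f ∈ GD S, ∏ v ∈ S, p * (1-p)^(f v)

def jf (U : Finset V) (f : V → ℕ) : ℕ :=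
  Nat.find (p := fun j => (U.filter (fun v => f v ≤ j)).card ≤ j) ⟨U.card, Finset.card_filter_le _ _⟩

def Sf (U : Finset V) (f : V → ℕ) : Finset V := U.filter (fun v => f v ≤ jf U f)

lemma card_Sf (U : Finset V) (f : V → ℕ) : (Sf U f).card = jf U f := by
  have h1 : (Sf U f).card ≤ jf U f :=
    Nat.find_spec (p := fun j => (U.filter (fun v => f v ≤ j)).card ≤ j) ⟨U.card, Finset.card_filter_le _ _⟩
  refine le_antisymm h1 ?_
  rcases Nat.eq_zero_or_pos (jf U f) with h | h
  · omega
  · have h2 := Nat.find_min (p := fun j => (U.filter (fun v => f v ≤ j)).card ≤ j) ⟨U.card, Finset.card_filter_le _ _⟩ (m := jf U f - 1) (by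
      unfold jf at h ⊢; omega)
    have h3 : (U.filter (fun v => f v ≤ jf U f - 1)).card ≤ (Sf U f).card := by
      apply Finset.card_le_card
      intro v
      simp only [Sf, Finset.mem_filter]
      exact fun h => ⟨h.1, by omega⟩
    simp only [not_le] at h2
    omega

lemma Sf_iff (U S : Finset V) (f : V → ℕ) (hSU : S ⊆ U) : Sf U f = S ↔
    (∀ v ∈ S, f v ≤ S.card) ∧ (∀ v ∈ U \ S, S.card < f v) ∧
      ∀ t, 1 ≤ t → t ≤ S.card → t ≤ (S.filter (fun v => f v < t)).card := by
  constructor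
  · rintro rfl
    rw [card_Sf]
    refine ⟨fun v hv => (Finset.mem_filter.1 hv).2, fun v hv => ?_, ?_⟩
    · rw [Finset.mem_sdiff] at hv
      simp only [Sf, Finset.mem_filter, not_and, not_le] at hv
      exact hv.2 hv.1
    · intro t h1 h2
      have h3 := Nat.find_min (p := fun j => (U.filter (fun v => f v ≤ j)).card ≤ j) ⟨U.card, Finset.card_filter_le _ _⟩ (m := t - 1) (by
        unfold jf at h2; omega)
      simp only [not_le] at h3
      have h4 : (U.filter (fun v => f v ≤ t - 1)).card ≤ ((Sf U f).filter (fun v => f v < t)).card := by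
        apply Finset.card_le_card
        intro v
        simp only [Sf, Finset.mem_filter]
        exact fun h => ⟨⟨h.1, by omega⟩, by omega⟩
      omega
  · rintro ⟨h1, h2, h3⟩
    have h4 : U.filter (fun v => f v ≤ S.card) = S := by
      ext v
      simp only [Finset.mem_filter]
      constructor
      · rintro ⟨ha, hb⟩
        by_contra hv
        have := h2 v (Finset.mem_sdiff.2 ⟨ha, hv⟩)
        omega
      · exact fun h => ⟨hSU h, h1 v h⟩
    have h5 : jf U f = S.card := by
      unfold jf
      rw [Nat.find_eq_iff]
      refine ⟨by rw [h4], ?_⟩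
      intro j hj
      have h6 := h3 (j+1) (by omega) (by omega)
      have h7 : (S.filter (fun v => f v < j+1)).card ≤ (U.filter (fun v => f v ≤ j)).card := by
        apply Finset.card_le_card
        intro v
        simp only [Finset.mem_filter]
        exact fun h => ⟨hSU h.1, by omega⟩
      omega
    unfold Sf
    rw [h5, h4]

lemma tail_sum (p : ℝ) (n a : ℕ) (h : a ≤ n) :
    ∑ i ∈ Finset.Ico a (n+1), (if i < n then p * (1-p)^i else (1-p)^n) = (1-p)^a := by
  obtain ⟨d, rfl⟩ := Nat.exists_eq_add_of_le h
  rw [Finset.sum_Ico_succ_top h]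
  have h1 : ∀ i ∈ Finset.Ico a (a+d), (if i < a + d then p * (1-p)^i else (1-p)^(a+d)) = p * (1-p)^i := by
    intro i hi
    rw [if_pos (Finset.mem_Ico.1 hi).2]
  rw [Finset.sum_congr rfl h1]
  simp only [lt_self_iff_false, if_false]
  clear h h1
  induction d with
  | zero => simp
  | succ d ih =>
    rw [← add_assoc, Finset.sum_Ico_succ_top (by omega), ← ih, pow_succ]; ring

lemma PK_fiber (p : ℝ) (U S : Finset V) (hSU : S ⊆ U) :
    ∑ f ∈ (bx U (Finset.range (U.card+2))).filter (fun f => Sf U f = S),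
      ∏ v ∈ U, (if f v < U.card+1 then p * (1-p)^(f v) else (1-p)^(U.card+1)) =
    PK p S * (1-p)^((S.card+1)*(U.card-S.card)) := by
  set w : ℕ → ℝ := fun i => (if i < U.card+1 then p * (1-p)^i else (1-p)^(U.card+1)) with hw
  have hc : S.card ≤ U.card := Finset.card_le_card hSU
  have h1 := sum_bx (U \ S) (Finset.Ico (S.card+1) (U.card+1+1)) w
  rw [hw, tail_sum p (U.card+1) (S.card+1) (by omega), Finset.card_sdiff_of_subset hSU, ← hw] at h1
  rw [pow_mul, ← h1]
  unfold PK
  rw [Finset.sum_mul_sum, ← Finset.sum_product']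
  symm
  refine Finset.sum_bij' (fun x _ => x.1 + x.2) (fun f _ => (fun v => if v ∈ S then f v else 0, fun v => if v ∈ U \ S then f v else 0)) ?_ ?_ ?_ ?_ ?_
  · rintro ⟨g, h⟩ hgh
    simp only [Finset.mem_product, GD, Finset.mem_filter, mem_bx, Finset.mem_range, Finset.mem_Ico] at hgh
    obtain ⟨⟨⟨ha, hb⟩, hcc⟩, hd, he⟩ := hgh
    have hS : ∀ v ∈ S, (g + h) v = g v := by
      intro v hv
      have : h v = 0 := he v (by simp [hv])
      simp [this]
    have hT : ∀ v ∈ U \ S, (g + h) v = h v := by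
      intro v hv
      have : g v = 0 := hb v (by simpa using (Finset.mem_sdiff.1 hv).2)
      simp [this]
    rw [Finset.mem_filter, mem_bx]
    refine ⟨⟨?_, ?_⟩, ?_⟩
    · intro v hv
      rw [Finset.mem_range]
      by_cases hvS : v ∈ S
      · rw [hS v hvS]; have := ha v hvS; omega
      · have hv' := Finset.mem_sdiff.2 ⟨hv, hvS⟩
        rw [hT v hv']; have := hd v hv'; omega
    · intro v hv
      have e1 := hb v (fun h => hv (hSU h))
      have e2 := he v (fun h => hv (Finset.mem_sdiff.1 h).1)
      simp [e1, e2]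
    · rw [Sf_iff U S _ hSU]
      refine ⟨?_, ?_, ?_⟩
      · intro v hv; rw [hS v hv]; have := ha v hv; omega
      · intro v hv; rw [hT v hv]; have := hd v hv; omega
      · intro t h1 h2
        refine (hcc t h1 h2).trans (le_of_eq ?_)
        congr 1
        refine Finset.filter_congr fun v hv => ?_
        rw [hS v hv]
  · intro f hf
    rw [Finset.mem_filter, mem_bx, Sf_iff U S _ hSU] at hf
    obtain ⟨⟨ha, hb⟩, h1, h2, h3⟩ := hf
    simp only [Finset.mem_product, GD, Finset.mem_filter, mem_bx, Finset.mem_range, Finset.mem_Ico]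
    refine ⟨⟨⟨?_, ?_⟩, ?_⟩, ?_, ?_⟩
    · intro v hv; simp only [hv, if_true]; have := h1 v hv; omega
    · intro v hv; simp [hv]
    · intro t ht1 ht2
      refine (h3 t ht1 ht2).trans (le_of_eq ?_)
      congr 1
      refine Finset.filter_congr fun v hv => ?_
      simp [hv]
    · intro v hv
      simp only [hv, if_true]
      have := h2 v hv
      have := Finset.mem_range.1 (ha v (Finset.mem_sdiff.1 hv).1)
      omega
    · intro v hv; simp only [hv, if_false]
  · rintro ⟨g, h⟩ hgh
    simp only [Finset.mem_product, GD, Finset.mem_filter, mem_bx, Finset.mem_range, Finset.mem_Ico] at hgh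
    obtain ⟨⟨⟨ha, hb⟩, hcc⟩, hd, he⟩ := hgh
    rw [Prod.mk.injEq]
    constructor
    · funext v
      by_cases hv : v ∈ S
      · have : h v = 0 := he v (by simp [hv])
        simp [hv, this]
      · simp [hv, hb v hv]
    · funext v
      by_cases hv : v ∈ U \ S
      · have : g v = 0 := hb v (by simpa using (Finset.mem_sdiff.1 hv).2)
        simp only [hv, if_true]; simp [this]
      · simp only [hv, if_false]; simp [he v hv]
  · intro f hf
    rw [Finset.mem_filter, mem_bx] at hf
    funext v
    by_cases hv : v ∈ S
    · simp [hv]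
    · by_cases hU : v ∈ U
      · simp [hv, hU]
      · simp [hv, hU, hf.1.2 v hU]
  · rintro ⟨g, h⟩ hgh
    simp only [Finset.mem_product, GD, Finset.mem_filter, mem_bx, Finset.mem_range, Finset.mem_Ico] at hgh
    obtain ⟨⟨⟨ha, hb⟩, hcc⟩, hd, he⟩ := hgh
    dsimp only
    rw [← Finset.prod_sdiff hSU, mul_comm]
    congr 1
    · refine Finset.prod_congr rfl fun v hv => ?_
      have : g v = 0 := hb v (by simpa using (Finset.mem_sdiff.1 hv).2)
      simp [hw, this]
    · refine Finset.prod_congr rfl fun v hv => ?_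
      have : h v = 0 := he v (by simp [hv])
      have h4 := ha v hv
      have h5 : g v < U.card + 1 := by omega
      simp [this, h5]

lemma PK_eq (p : ℝ) (S : Finset V) : PK p S = cc p S.card := by
  refine cc_unique p Finset.univ (PK p) ?_ S (Finset.subset_univ _)
  intro U _
  rw [Finset.sum_congr rfl fun S hS => (PK_fiber p U S (Finset.mem_powerset.1 hS)).symm]
  rw [Finset.sum_fiberwise_of_maps_to]
  · have h1 := sum_bx U (Finset.range (U.card+2)) (fun i => (if i < U.card+1 then p * (1-p)^i else (1-p)^(U.card+1)))
    rw [h1]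
    have h2 := tail_sum p (U.card+1) 0 (by omega)
    rw [← Finset.range_eq_Ico] at h2
    rw [show U.card + 2 = U.card+1+1 from rfl, h2]; simp
  · intro f _
    rw [Finset.mem_powerset]
    exact Finset.filter_subset _ _
end parking

section parking2
open Classical

lemma rot_exists (m : ℕ) (f : Fin m → ℕ) (hf : ∀ v, f v < m + 1) :
    ∃ s < m + 1, ∀ g : Fin m → ℕ, (∀ v, g v + s = f v + (if f v < s then m+1 else 0)) →
      g ∈ GD (Finset.univ : Finset (Fin m)) ∧ ∑ v, g v ≤ ∑ v, f v := by
  set N : ℕ → ℕ := fun t => ∑ v, if f v < t then 1 else 0 with hN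
  obtain ⟨s, hs, hmin⟩ := Finset.exists_min_image (Finset.range (m+1))
    (fun s => ((m:ℤ)+1) * N s - m * s) ⟨0, by simp⟩
  have hN0 : N 0 = 0 := by simp [hN]
  have hNm : N (m+1) = m := by simp [hN, hf]
  have hmin' : ∀ t ≤ m+1, ((m:ℤ)+1) * N s - m * s ≤ ((m:ℤ)+1) * N t - m * t := by
    intro t ht
    rcases Nat.lt_or_ge t (m+1) with h | h
    · exact hmin t (Finset.mem_range.2 h)
    · have : t = m+1 := by omega
      rw [this, hNm]
      have := hmin 0 (by simp)
      rw [hN0] at this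
      push_cast at this ⊢
      linarith
  rw [Finset.mem_range] at hs
  refine ⟨s, hs, ?_⟩
  intro g hg
  have hgm : ∀ v, g v < m + 1 := by
    intro v
    have h1 := hg v
    have h2 := hf v
    split_ifs at h1 <;> omega
  constructor
  · rw [mem_GD, mem_bx]
    refine ⟨⟨fun v _ => by simpa using hgm v, by simp⟩, ?_⟩
    rw [Finset.card_univ, Fintype.card_fin]
    intro t ht1 ht2
    rw [Finset.card_filter]
    have key : ((m:ℤ)+1) * (∑ v, if g v < t then 1 else 0 : ℕ) ≥ m * t := by
      rcases le_or_gt (s+t) (m+1) with h | h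
      · have h1 : N (s+t) ≤ (∑ v, if g v < t then 1 else 0) + N s := by
          simp only [hN]
          rw [← Finset.sum_add_distrib]
          refine Finset.sum_le_sum fun v _ => ?_
          have h1 := hg v
          split_ifs at h1 ⊢ <;> omega
        have h2 := hmin' (s+t) h
        have h3 : (N (s+t) : ℤ) ≤ (∑ v, if g v < t then 1 else 0 : ℕ) + N s := by exact_mod_cast h1
        push_cast at h2 h3 ⊢
        nlinarith
      · obtain ⟨u, hu⟩ : ∃ u, u + (m+1) = s + t := ⟨s+t-(m+1), by omega⟩
        have h1 : m + N u ≤ (∑ v, if g v < t then 1 else 0) + N s := by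
          simp only [hN]
          have hm : ∑ v : Fin m, 1 = m := by simp
          refine le_trans (le_of_eq (congrArg (fun z => z + _) hm.symm)) ?_
          rw [← Finset.sum_add_distrib, ← Finset.sum_add_distrib]
          refine Finset.sum_le_sum fun v _ => ?_
          have h1 := hg v
          have h2 := hf v
          split_ifs at h1 ⊢ <;> omega
        have h2 := hmin' u (by omega)
        have h3 : (m:ℤ) + N u ≤ (∑ v, if g v < t then 1 else 0 : ℕ) + N s := by exact_mod_cast h1
        have h4 : (u:ℤ) + (m+1) = s + t := by exact_mod_cast hu
        push_cast at h2 h3 ⊢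
        have h5 : (u:ℤ) = s + t - (m+1) := by linarith
        rw [h5] at h2
        nlinarith
    by_contra hlt
    push Not at hlt
    have h6 : ((∑ v, if g v < t then 1 else 0 : ℕ) : ℤ) ≤ t - 1 := by omega
    have h7 : (t:ℤ) ≤ m := by exact_mod_cast ht2
    nlinarith
  · have h1 : ∑ v, (g v + s) = ∑ v, (f v + (if f v < s then m+1 else 0)) :=
      Finset.sum_congr rfl fun v _ => hg v
    rw [Finset.sum_add_distrib, Finset.sum_add_distrib] at h1
    have h2 : ∑ v, (if f v < s then m+1 else 0) = (m+1) * N s := by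
      simp only [hN, Finset.mul_sum]
      refine Finset.sum_congr rfl fun v _ => ?_
      split_ifs <;> simp
    rw [h2] at h1
    simp only [Finset.sum_const, Finset.card_univ, Fintype.card_fin, smul_eq_mul] at h1
    have h3 := hmin' 0 (by omega)
    rw [hN0] at h3
    have h4 : (m+1) * N s ≤ m * s := by
      have : ((m:ℤ)+1) * N s ≤ m * s := by push_cast at h3; linarith
      exact_mod_cast this
    omega

lemma rot_sum (m : ℕ) (r : ℝ) (h0 : 0 ≤ r) (h1 : r ≤ 1) :
    ∑ f ∈ bx (Finset.univ : Finset (Fin m)) (Finset.range (m+1)), r ^ (∑ v, f v) ≤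
    ((m:ℝ)+1) * ∑ f ∈ GD (Finset.univ : Finset (Fin m)), r ^ (∑ v, f v) := by
  have hf : ∀ f ∈ bx (Finset.univ : Finset (Fin m)) (Finset.range (m+1)), ∀ v, f v < m + 1 := by
    intro f hf v
    rw [mem_bx] at hf
    simpa using hf.1 v (by simp)
  choose! s hs hgs using fun f => rot_exists m f
  set G : (Fin m → ℕ) → (Fin m → ℕ) := fun f v => if f v < s f then f v + (m+1) - s f else f v - s f with hG
  have hGe : ∀ f, (∀ v, f v < m+1) → ∀ v, G f v + s f = f v + (if f v < s f then m+1 else 0) := by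
    intro f hf v
    have := hs f hf
    simp only [hG]
    split_ifs <;> omega
  set J : (Fin m → ℕ) → (Fin m → ℕ) × ℕ := fun f => (G f, s f) with hJ
  have hinj : Set.InjOn J (bx (Finset.univ : Finset (Fin m)) (Finset.range (m+1)) : Set _) := by
    intro f hfm g hgm hfg
    simp only [hJ, Prod.mk.injEq] at hfg
    have hf' := hf f hfm
    have hg' := hf g hgm
    funext v
    have e1 := hGe f hf' v
    have e2 := hGe g hg' v
    rw [hfg.1, hfg.2] at e1
    have := hf' v
    have := hg' v
    split_ifs at e1 e2 <;> omega
  calc ∑ f ∈ bx (Finset.univ : Finset (Fin m)) (Finset.range (m+1)), r ^ (∑ v, f v)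
      ≤ ∑ f ∈ bx (Finset.univ : Finset (Fin m)) (Finset.range (m+1)), r ^ (∑ v, (J f).1 v) := by
        refine Finset.sum_le_sum fun f hfm => ?_
        exact pow_le_pow_of_le_one h0 h1 (hgs f (hf f hfm) _ (hGe f (hf f hfm))).2
    _ = ∑ x ∈ (bx (Finset.univ : Finset (Fin m)) (Finset.range (m+1))).image J, r ^ (∑ v, x.1 v) := by
        rw [Finset.sum_image hinj]
    _ ≤ ∑ x ∈ GD (Finset.univ : Finset (Fin m)) ×ˢ Finset.range (m+1), r ^ (∑ v, x.1 v) := by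
        refine Finset.sum_le_sum_of_subset_of_nonneg ?_ (fun _ _ _ => by positivity)
        intro x hx
        rw [Finset.mem_image] at hx
        obtain ⟨f, hfm, rfl⟩ := hx
        rw [Finset.mem_product, Finset.mem_range]
        exact ⟨(hgs f (hf f hfm) _ (hGe f (hf f hfm))).1, hs f (hf f hfm)⟩
    _ = _ := by
        rw [Finset.sum_product_right]
        simp

/-- number of good (parking) functions -/
def tm (m : ℕ) : ℝ := (GD (Finset.univ : Finset (Fin m))).card

lemma cc_formula (p : ℝ) (m : ℕ) :
    cc p m = p ^ m * ∑ f ∈ GD (Finset.univ : Finset (Fin m)), (1-p) ^ (∑ v, f v) := by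
  have := PK_eq p (Finset.univ : Finset (Fin m))
  rw [Finset.card_univ, Fintype.card_fin] at this
  rw [← this, PK, Finset.mul_sum]
  refine Finset.sum_congr rfl fun f _ => ?_
  rw [Finset.prod_mul_distrib, Finset.prod_const, Finset.prod_pow_eq_pow_sum]
  simp

lemma tm_nonneg (m : ℕ) : 0 ≤ tm m := by unfold tm; positivity

lemma tm_zero : tm 0 = 1 := by
  unfold tm GD bx; simp

lemma cc_nonneg (p : ℝ) (h0 : 0 ≤ p) (h1 : p ≤ 1) (m : ℕ) : 0 ≤ cc p m := by
  rw [cc_formula]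
  have : 0 ≤ 1 - p := by linarith
  positivity

lemma cc_le_tm (p : ℝ) (h0 : 0 ≤ p) (h1 : p ≤ 1) (m : ℕ) : cc p m ≤ p ^ m * tm m := by
  rw [cc_formula]
  refine mul_le_mul_of_nonneg_left ?_ (by positivity)
  calc _ ≤ ∑ f ∈ GD (Finset.univ : Finset (Fin m)), (1:ℝ) :=
        Finset.sum_le_sum fun f _ => pow_le_one₀ (by linarith) (by linarith)
    _ = _ := by simp [tm]

lemma cc_ge_tm (p : ℝ) (h0 : 0 ≤ p) (h1 : p ≤ 1) (m : ℕ) : p ^ m * ((1-p)^(m*m) * tm m) ≤ cc p m := by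
  rw [cc_formula]
  refine mul_le_mul_of_nonneg_left ?_ (by positivity)
  calc _ = ∑ f ∈ GD (Finset.univ : Finset (Fin m)), (1-p)^(m*m) := by simp [tm, mul_comm]
    _ ≤ _ := by
      refine Finset.sum_le_sum fun f hf => ?_
      refine pow_le_pow_of_le_one (by linarith) (by linarith) ?_
      rw [mem_GD, mem_bx] at hf
      calc ∑ v, f v ≤ ∑ v : Fin m, m := Finset.sum_le_sum fun v _ => by
            have := hf.1.1 v (by simp)
            simp at this
            omega
        _ = m * m := by simp

lemma bx_geom (p : ℝ) (m : ℕ) : p ^ m * ∑ f ∈ bx (Finset.univ : Finset (Fin m)) (Finset.range (m+1)), (1-p) ^ (∑ v, f v)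
    = (1 - (1-p)^(m+1))^m := by
  have h := sum_bx (Finset.univ : Finset (Fin m)) (Finset.range (m+1)) (fun i => (1-p)^i)
  rw [Finset.card_univ, Fintype.card_fin] at h
  have h2 : ∀ f : Fin m → ℕ, ∏ v, (1-p)^(f v) = (1-p)^(∑ v, f v) := fun f => by
    rw [Finset.prod_pow_eq_pow_sum]
  rw [Finset.sum_congr rfl fun f _ => h2 f] at h
  rw [h, ← mul_pow]
  have := mul_neg_geom_sum (1-p) (m+1)
  rw [← this]; congr 1; ring

lemma cc_upper (p : ℝ) (h0 : 0 ≤ p) (h1 : p ≤ 1) (m : ℕ) : cc p m ≤ (1 - (1-p)^(m+1))^m := by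
  rw [cc_formula, ← bx_geom]
  refine mul_le_mul_of_nonneg_left ?_ (by positivity)
  refine Finset.sum_le_sum_of_subset_of_nonneg ?_ ?_
  · intro f hf
    have := ((mem_GD _ _).1 hf).1
    simpa using this
  · intro f _ _
    have : 0 ≤ 1 - p := by linarith
    positivity

lemma cc_lower (p : ℝ) (h0 : 0 ≤ p) (h1 : p ≤ 1) (m : ℕ) : (1 - (1-p)^(m+1))^m ≤ ((m:ℝ)+1) * cc p m := by
  rw [cc_formula, ← bx_geom]
  have := mul_le_mul_of_nonneg_left (rot_sum m (1-p) (by linarith) (by linarith)) (show 0 ≤ p^m by positivity)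
  linarith

lemma tm_lower (m : ℕ) : ((m:ℝ)+1)^m ≤ ((m:ℝ)+1) * tm m := by
  have h := rot_sum m 1 (by norm_num) le_rfl
  have h2 := sum_bx (Finset.univ : Finset (Fin m)) (Finset.range (m+1)) (fun i => 1)
  simp only [one_pow, Finset.prod_const_one, Finset.sum_const, Finset.card_range, Finset.card_univ, Fintype.card_fin, nsmul_eq_mul, mul_one] at h h2
  rw [h2] at h
  unfold tm
  push_cast at h
  exact h

lemma tm_pos (m : ℕ) : 0 < tm m := by
  have h := tm_lower m
  have h2 : 0 < ((m:ℝ)+1)^m := by positivity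
  by_contra hc
  have : tm m = 0 := le_antisymm (not_lt.1 hc) (tm_nonneg m)
  rw [this] at h; linarith
end parking2

def PN (p : ℝ) (N k : ℕ) : ℝ := (N.choose k : ℝ) * cc p k * (1-p)^((k+1)*(N-k))

lemma PN_nonneg (p : ℝ) (h0 : 0 ≤ p) (h1 : p ≤ 1) (N k : ℕ) : 0 ≤ PN p N k := by
  unfold PN
  have := cc_nonneg p h0 h1 k
  have : 0 ≤ 1 - p := by linarith
  positivity

lemma PN_sum (p : ℝ) (N : ℕ) : ∑ k ∈ Finset.range (N+1), PN p N k = 1 := cc_rec p N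

def EN (p : ℝ) (N : ℕ) : ℝ := ∑ k ∈ Finset.range (N+1), ((k:ℝ)+1) * PN p N k

lemma EN_rec (p : ℝ) (h0 : 0 ≤ p) (h1 : p ≤ 1) (N : ℕ) : EN p (N+1) ≤ 1 + (N+1) * p * EN p N := by
  have e1 : EN p (N+1) = 1 + ∑ k ∈ Finset.range (N+1+1), (k:ℝ) * PN p (N+1) k := by
    unfold EN
    refine Eq.trans ?_ (congrArg (fun z => z + _) (PN_sum p (N+1)))
    rw [← Finset.sum_add_distrib]
    exact Finset.sum_congr rfl fun k _ => by ring
  have e2 : ∑ k ∈ Finset.range (N+1+1), ((N:ℝ)+1-k) * PN p (N+1) k =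
      (N+1) - ∑ k ∈ Finset.range (N+1+1), (k:ℝ) * PN p (N+1) k := by
    have : ((N:ℝ)+1) = ∑ k ∈ Finset.range (N+1+1), ((N:ℝ)+1) * PN p (N+1) k := by
      rw [← Finset.mul_sum, PN_sum, mul_one]
    conv_rhs => rw [this]
    rw [← Finset.sum_sub_distrib]
    exact Finset.sum_congr rfl fun k _ => by ring
  have e3 : ((N:ℝ)+1) - (N+1) * p * EN p N ≤ ∑ k ∈ Finset.range (N+1+1), ((N:ℝ)+1-k) * PN p (N+1) k := by
    rw [Finset.sum_range_succ]
    have : ((N:ℝ)+1) - (N+1) * p * EN p N = ∑ k ∈ Finset.range (N+1), ((N:ℝ)+1) * (PN p N k * (1 - p * (k+1))) := by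
      unfold EN
      rw [← Finset.mul_sum, mul_assoc, Finset.mul_sum]
      have : ∀ a b c : ℝ, b = 1 - c → a - a * c = a * b := by intros; subst_vars; ring
      apply this
      refine Eq.trans ?_ (congrArg (fun z => z - _) (PN_sum p N))
      rw [← Finset.sum_sub_distrib]
      exact Finset.sum_congr rfl fun k _ => by ring
    rw [this]
    push_cast
    simp only [sub_self, zero_mul, add_zero]
    refine Finset.sum_le_sum fun k hk => ?_
    have hk' : k ≤ N := by simpa [Nat.lt_succ_iff] using hk
    have hb : 1 - p * (k+1) ≤ (1-p)^(k+1) := by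
      have := one_add_mul_le_pow (show (-2:ℝ) ≤ -p by linarith) (k+1)
      push_cast at this
      calc 1 - p * (k+1) = 1 + (k+1) * -p := by ring
        _ ≤ _ := this
        _ = _ := by congr 1
    have hch : ((N:ℝ)+1-k) * ((N+1).choose k : ℝ) = (N+1) * (N.choose k : ℝ) := by
      have h := Nat.choose_mul_succ_eq N k
      have h2 : ((N.choose k * (N+1) : ℕ) : ℝ) = (((N+1).choose k * (N+1-k) : ℕ) : ℝ) := by rw [h]
      rw [Nat.cast_mul, Nat.cast_mul, Nat.cast_sub (by omega)] at h2
      push_cast at h2; linarith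
    have hPN : ((N:ℝ)+1-k) * PN p (N+1) k = ((N:ℝ)+1) * (PN p N k * (1-p)^(k+1)) := by
      unfold PN
      have : (k+1) * (N+1-k) = (k+1)*(N-k) + (k+1) := by
        rw [show N+1-k = (N-k)+1 by omega]; ring
      rw [this, pow_add]
      calc _ = (((N:ℝ)+1-k) * ((N+1).choose k : ℝ)) * (cc p k * ((1-p)^((k+1)*(N-k)) * (1-p)^(k+1))) := by ring
        _ = _ := by rw [hch]; ring
    rw [hPN]
    have := PN_nonneg p h0 h1 N k
    gcongr
  linarith

lemma EN_le (p y : ℝ) (h0 : 0 ≤ p) (h1 : p ≤ 1) (hy0 : 0 ≤ y) (hy : y < 1) (M : ℕ) (hM : M * p ≤ y) :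
    ∀ N ≤ M, EN p N ≤ 1 / (1-y) := by
  intro N
  have hy' : 0 < 1 - y := by linarith
  induction N with
  | zero =>
    intro _
    have : EN p 0 = 1 := by
      have := PN_sum p 0
      unfold EN
      simpa using this
    rw [this, le_div_iff₀ hy']; linarith
  | succ N ih =>
    intro h
    have h2 := ih (by omega)
    have h3 := EN_rec p h0 h1 N
    have h4 : ((N:ℝ)+1) * p ≤ y := by
      refine le_trans ?_ hM
      gcongr
      exact_mod_cast h
    have h5 : ((N:ℝ)+1) * p * EN p N ≤ y * (1/(1-y)) := by
      have : 0 ≤ 1/(1-y) := by positivity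
      have h6 : 0 ≤ ((N:ℝ)+1) * p := by positivity
      nlinarith
    refine h3.trans ?_
    have : 1 / (1-y) = 1 + y * (1/(1-y)) := by field_simp; ring
    linarith

lemma PN_tail (p y : ℝ) (h0 : 0 ≤ p) (h1 : p ≤ 1) (hy0 : 0 ≤ y) (hy : y < 1) (N : ℕ) (hM : N * p ≤ y) (K : ℕ) (hK : 1 ≤ K) (hKN : K ≤ N+1) :
    1 - 1/((1-y)*K) ≤ ∑ k ∈ Finset.range K, PN p N k := by
  have h := EN_le p y h0 h1 hy0 hy N hM N le_rfl
  have hs := PN_sum p N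
  rw [← Finset.sum_range_add_sum_Ico _ hKN] at hs
  have h2 : (K:ℝ) * ∑ k ∈ Finset.Ico K (N+1), PN p N k ≤ EN p N := by
    unfold EN
    rw [Finset.mul_sum, ← Finset.sum_range_add_sum_Ico _ hKN]
    have h3 : 0 ≤ ∑ k ∈ Finset.range K, ((k:ℝ)+1) * PN p N k :=
      Finset.sum_nonneg fun k _ => mul_nonneg (by positivity) (PN_nonneg p h0 h1 N k)
    have h4 : ∑ k ∈ Finset.Ico K (N+1), (K:ℝ) * PN p N k ≤ ∑ k ∈ Finset.Ico K (N+1), ((k:ℝ)+1) * PN p N k := by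
      refine Finset.sum_le_sum fun k hk => ?_
      refine mul_le_mul_of_nonneg_right ?_ (PN_nonneg p h0 h1 N k)
      have : (K:ℝ) ≤ k := by exact_mod_cast (Finset.mem_Ico.1 hk).1
      linarith
    linarith
  have hKp : (0:ℝ) < K := by exact_mod_cast hK
  have hy' : 0 < 1 - y := by linarith
  have h5 : ∑ k ∈ Finset.Ico K (N+1), PN p N k ≤ 1/((1-y)*K) := by
    rw [le_div_iff₀ (by positivity)]
    have : (1-y) * (1/(1-y)) = 1 := by field_simp
    nlinarith
  linarith

lemma PN_tendsto (y : ℝ) (hy : 0 < y) (k : ℕ) : Tendsto (fun N : ℕ => PN (y/N) N k) atTop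
    (𝓝 (tm k * y^k / k.factorial * Real.exp (-(y*(k+1))))) := by
  have hp : Tendsto (fun n : ℕ => y / (n:ℝ)) atTop (𝓝 0) := tendsto_const_div_atTop_nhds_zero_nat y
  have h1 : Tendsto (fun n : ℕ => n * (y / (n:ℝ))) atTop (𝓝 y) := by
    refine tendsto_const_nhds.congr' ?_
    filter_upwards [eventually_gt_atTop 0] with n hn
    have : (n:ℝ) ≠ 0 := by positivity
    field_simp
  have h2 := ProbabilityTheory.tendsto_choose_mul_pow_atTop k h1
  have h3 : Tendsto (fun n : ℕ => (1 - y/(n:ℝ))^(n)) atTop (𝓝 (Real.exp (-y))) := by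
    refine (Real.tendsto_one_add_div_pow_exp (-y)).congr fun n => ?_
    congr 1; ring
  have hev : ∀ᶠ n : ℕ in atTop, y / (n:ℝ) < 1 := hp.eventually (gt_mem_nhds one_pos)
  have h4 : Tendsto (fun n : ℕ => (1 - y/(n:ℝ))^((k+1)*(n-k))) atTop (𝓝 (Real.exp (-(y*(k+1))))) := by
    have h5 : Tendsto (fun n : ℕ => (1 - y/(n:ℝ))) atTop (𝓝 (1-0)) := hp.const_sub 1
    have h6 := (h3.pow (k+1)).div (h5.pow ((k+1)*k)) (by simp)
    have h7 : Real.exp (-y) ^ (k+1) / (1-0)^((k+1)*k) = Real.exp (-(y*(k+1))) := by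
      rw [← Real.exp_nat_mul]; simp; ring
    rw [h7] at h6
    refine h6.congr' ?_
    filter_upwards [eventually_ge_atTop k, hev] with n hn hn1
    have : (1 - y/(n:ℝ)) ≠ 0 := by linarith
    simp only [Pi.div_apply]
    rw [div_eq_iff (by positivity), ← pow_add, ← pow_mul]
    congr 1
    rw [← mul_add, Nat.sub_add_cancel hn]; ring
  have h8 : Tendsto (fun n : ℕ => (n.choose k : ℝ) * cc (y/n) k) atTop (𝓝 (y^k/k.factorial * tm k)) := by
    have hr : Tendsto (fun n : ℕ => (1 - y/(n:ℝ))^(k*k) * tm k) atTop (𝓝 ((1-0)^(k*k) * tm k)) :=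
      ((hp.const_sub 1).pow _).mul_const _
    rw [sub_zero, one_pow, one_mul] at hr
    have ha := h2.mul hr
    have hb := h2.mul_const (tm k)
    refine tendsto_of_tendsto_of_tendsto_of_le_of_le' ha hb ?_ ?_
    · filter_upwards [hev] with n hn
      have := cc_ge_tm (y/n) (by positivity) hn.le k
      rw [mul_assoc]
      gcongr
    · filter_upwards [hev] with n hn
      have := cc_le_tm (y/n) (by positivity) hn.le k
      rw [mul_assoc]
      gcongr
  have := h8.mul h4
  have e : y ^ k / ↑k.factorial * tm k * Real.exp (-(y * (↑k + 1))) = tm k * y^k / k.factorial * Real.exp (-(y*(k+1))) := by ring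
  rw [← e]
  exact this

def QK (K : ℕ) (y : ℝ) : ℝ := ∑ k ∈ Finset.range K, tm k * y^k / k.factorial * Real.exp (-(y*(k+1)))

lemma QK_tendsto (K : ℕ) (y : ℝ) (hy : 0 < y) :
    Tendsto (fun N : ℕ => ∑ k ∈ Finset.range K, PN (y/N) N k) atTop (𝓝 (QK K y)) :=
  tendsto_finsetSum _ fun k _ => PN_tendsto y hy k

lemma QK_le (K : ℕ) (y : ℝ) (hy : 0 < y) : QK K y ≤ 1 := by
  refine le_of_tendsto (QK_tendsto K y hy) ?_
  have hp : Tendsto (fun n : ℕ => y / (n:ℝ)) atTop (𝓝 0) := tendsto_const_div_atTop_nhds_zero_nat y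
  filter_upwards [hp.eventually (gt_mem_nhds one_pos), eventually_ge_atTop K] with n hn hK
  rw [← PN_sum (y/n) n]
  refine Finset.sum_le_sum_of_subset_of_nonneg ?_ fun k _ _ => PN_nonneg _ (by positivity) hn.le _ _
  intro k; simp; omega

lemma QK_ge (K : ℕ) (hK : 1 ≤ K) (y : ℝ) (hy : 0 < y) (hy1 : y < 1) : 1 - 1/((1-y)*K) ≤ QK K y := by
  refine ge_of_tendsto (QK_tendsto K y hy) ?_
  have hp : Tendsto (fun n : ℕ => y / (n:ℝ)) atTop (𝓝 0) := tendsto_const_div_atTop_nhds_zero_nat y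
  filter_upwards [hp.eventually (gt_mem_nhds one_pos), eventually_ge_atTop K, eventually_gt_atTop 0] with n hn hKn hn0
  refine PN_tail (y/n) y (by positivity) hn.le hy.le hy1 n ?_ K hK (by omega)
  have : (n:ℝ) ≠ 0 := by positivity
  field_simp; rfl

lemma QK_nonneg (K : ℕ) (y : ℝ) (hy : 0 ≤ y) : 0 ≤ QK K y := by
  refine Finset.sum_nonneg fun k _ => ?_
  have := tm_nonneg k
  positivity

def TK (K : ℕ) (z : ℝ) : ℝ := ∑ k ∈ Finset.range K, tm k * z^(k+1) / (k+1).factorial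

lemma TK_deriv (K : ℕ) (y : ℝ) : HasDerivAt (fun y => TK K (y * Real.exp (-y))) ((1-y) * QK K y) y := by
  unfold TK QK
  rw [Finset.mul_sum]
  refine HasDerivAt.fun_sum fun k _ => ?_
  have h1 : HasDerivAt (fun y : ℝ => y * Real.exp (-y)) (1 * Real.exp (-y) + y * (Real.exp (-y) * (-1))) y :=
    (hasDerivAt_id y).mul ((hasDerivAt_neg y).exp)
  have h2 := ((h1.pow (k+1)).const_mul (tm k)).div_const ((k+1).factorial : ℝ)
  refine HasDerivAt.congr_deriv (f := fun y => tm k * (y * Real.exp (-y))^(k+1) / ((k+1).factorial : ℝ)) h2 ?_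
  rw [Nat.factorial_succ]
  have e : Real.exp (-(y*(k+1))) = Real.exp (-y)^(k+1) := by
    rw [← Real.exp_nat_mul]; push_cast; ring_nf
  rw [e]
  push_cast
  field_simp
  ring

lemma TK_upper (K : ℕ) (y : ℝ) (h0 : 0 ≤ y) (h1 : y ≤ 1) : TK K (y * Real.exp (-y)) ≤ y - y^2/2 := by
  have hd : ∀ y, HasDerivAt (fun y => (y - y^2/2) - TK K (y * Real.exp (-y))) ((1 - y) - (1-y) * QK K y) y := by
    intro y
    have h2 : HasDerivAt (fun y : ℝ => y - y^2/2) (1 - (2 * y^(2-1))/2) y := by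
      have := (hasDerivAt_id y).sub ((hasDerivAt_pow 2 y).div_const 2)
      exact_mod_cast this
    have := h2.sub (TK_deriv K y)
    refine HasDerivAt.congr_deriv this ?_
    norm_num
  have hm : MonotoneOn (fun y => (y - y^2/2) - TK K (y * Real.exp (-y))) (Icc 0 1) := by
    refine monotoneOn_of_deriv_nonneg (convex_Icc 0 1) ?_ ?_ ?_
    · exact fun y _ => (hd y).continuousAt.continuousWithinAt
    · exact fun y _ => (hd y).differentiableAt.differentiableWithinAt
    · intro y hy
      rw [interior_Icc] at hy
      rw [(hd y).deriv]
      have := QK_le K y hy.1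
      nlinarith [hy.2]
  have := hm (⟨le_rfl, zero_le_one⟩ : (0:ℝ) ∈ Icc (0:ℝ) 1) ⟨h0, h1⟩ h0
  simp [TK] at this
  simp [TK]
  linarith

lemma TK_lower (K : ℕ) (hK : 1 ≤ K) (y : ℝ) (h0 : 0 ≤ y) (h1 : y ≤ 1) : y - y^2/2 - y/K ≤ TK K (y * Real.exp (-y)) := by
  have hd : ∀ y, HasDerivAt (fun y => TK K (y * Real.exp (-y)) - (y - y^2/2 - y/K)) ((1-y) * QK K y - ((1 - y) - 1/K)) y := by
    intro y
    have h2 : HasDerivAt (fun y : ℝ => y - y^2/2 - y/K) (1 - (2 * y^(2-1))/2 - 1/K) y := by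
      have := ((hasDerivAt_id y).sub ((hasDerivAt_pow 2 y).div_const 2)).sub ((hasDerivAt_id y).div_const (K:ℝ))
      exact_mod_cast this
    have := (TK_deriv K y).sub h2
    refine HasDerivAt.congr_deriv this ?_
    norm_num
  have hm : MonotoneOn (fun y => TK K (y * Real.exp (-y)) - (y - y^2/2 - y/K)) (Icc 0 1) := by
    refine monotoneOn_of_deriv_nonneg (convex_Icc 0 1) ?_ ?_ ?_
    · exact fun y _ => (hd y).continuousAt.continuousWithinAt
    · exact fun y _ => (hd y).differentiableAt.differentiableWithinAt
    · intro y hy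
      rw [interior_Icc] at hy
      rw [(hd y).deriv]
      have := QK_ge K hK y hy.1 hy.2
      have hy2 : 0 < 1 - y := by linarith [hy.2]
      have hKp : (0:ℝ) < K := by exact_mod_cast hK
      have h3 : (1-y) * (1 - 1/((1-y)*K)) = (1-y) - 1/K := by field_simp
      nlinarith
  have := hm (⟨le_rfl, zero_le_one⟩ : (0:ℝ) ∈ Icc (0:ℝ) 1) ⟨h0, h1⟩ h0
  simp [TK] at this
  simp [TK]
  linarith

lemma fact_upper (n : ℕ) (hn : 1 ≤ n) : (n.factorial : ℝ) * Real.exp n ≤ Real.exp 1 * (n:ℝ)^(n+1) := by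
  induction n, hn using Nat.le_induction with
  | base => simp
  | succ n hn ih =>
    have hn0 : (0:ℝ) < n := by exact_mod_cast hn
    have h1 : Real.exp 1 * (n:ℝ)^(n+1) ≤ ((n:ℝ)+1)^(n+1) := by
      have h2 : (n:ℝ)/(n+1) ≤ Real.exp (-(1/((n:ℝ)+1))) := by
        have := Real.add_one_le_exp (-(1/((n:ℝ)+1)))
        refine le_trans (le_of_eq ?_) this
        field_simp; ring
      have h3 : ((n:ℝ)/(n+1))^(n+1) ≤ (Real.exp (-(1/((n:ℝ)+1))))^(n+1) :=
        pow_le_pow_left₀ (by positivity) h2 _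
      rw [← Real.exp_nat_mul, div_pow, div_le_iff₀ (by positivity)] at h3
      have h4 : ((n+1:ℕ):ℝ) * -(1/((n:ℝ)+1)) = -1 := by push_cast; field_simp
      rw [h4] at h3
      calc Real.exp 1 * (n:ℝ)^(n+1) ≤ Real.exp 1 * (Real.exp (-1) * ((n:ℝ)+1)^(n+1)) := by gcongr
        _ = (Real.exp 1 * Real.exp (-1)) * ((n:ℝ)+1)^(n+1) := by ring
        _ = _ := by rw [← Real.exp_add]; simp
    rw [Nat.factorial_succ]
    push_cast
    rw [Real.exp_add]
    calc ((n:ℝ)+1) * n.factorial * (Real.exp n * Real.exp 1) = ((n:ℝ)+1) * Real.exp 1 * (n.factorial * Real.exp n) := by ring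
      _ ≤ ((n:ℝ)+1) * Real.exp 1 * (Real.exp 1 * (n:ℝ)^(n+1)) := by gcongr
      _ ≤ ((n:ℝ)+1) * Real.exp 1 * ((n:ℝ)+1)^(n+1) := by gcongr
      _ = _ := by ring

lemma fact_lower (n : ℕ) : (n:ℝ)^n ≤ (n.factorial : ℝ) * Real.exp n := by
  have := Real.pow_div_factorial_le_exp (n:ℝ) (by positivity) n
  rw [div_le_iff₀ (by positivity)] at this
  linarith

lemma floor_bound (x : ℝ) (hx : 0 ≤ x) : Real.exp (x-2) / (x+1) ≤ x^⌊x⌋₊/(⌊x⌋₊.factorial : ℝ) := by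
  set m := ⌊x⌋₊ with hm
  have h1 : (m:ℝ) ≤ x := Nat.floor_le hx
  have h2 : x < m + 1 := Nat.lt_floor_add_one x
  rcases Nat.eq_zero_or_pos m with h | h
  · rw [h] at h2 ⊢
    simp only [pow_zero, Nat.factorial_zero, Nat.cast_one, div_one]
    rw [div_le_one (by positivity)]
    have : Real.exp (x-2) ≤ 1 := Real.exp_le_one_iff.2 (by norm_num at h2; linarith)
    linarith
  · have h3 := fact_upper m h
    have hm0 : (0:ℝ) < m := by exact_mod_cast h
    rw [div_le_div_iff₀ (by positivity) (by positivity)]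
    have h4 : Real.exp (x-2) * (m.factorial : ℝ) ≤ (m:ℝ)^(m+1) := by
      have h5 : Real.exp (x-2) ≤ Real.exp m * Real.exp (-1) := by
        rw [← Real.exp_add]; exact Real.exp_le_exp.2 (by linarith)
      calc Real.exp (x-2) * (m.factorial : ℝ) ≤ Real.exp m * Real.exp (-1) * m.factorial := by gcongr
        _ = Real.exp (-1) * (m.factorial * Real.exp m) := by ring
        _ ≤ Real.exp (-1) * (Real.exp 1 * (m:ℝ)^(m+1)) := by gcongr
        _ = (Real.exp (-1) * Real.exp 1) * (m:ℝ)^(m+1) := by ring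
        _ = _ := by rw [← Real.exp_add]; simp
    refine h4.trans ?_
    rw [pow_succ]
    gcongr
    linarith

lemma exp_le_one_sub (p : ℝ) (h0 : 0 ≤ p) (h1 : p ≤ 1/2) : Real.exp (-(2*p)) ≤ 1 - p := by
  have h2 := Real.add_one_le_exp (2*p)
  have h3 : 1 ≤ (1-p) * Real.exp (2*p) := by nlinarith
  rw [Real.exp_neg, inv_le_iff_one_le_mul₀ (Real.exp_pos _)]
  exact h3

lemma bb_nonneg (p q : ℝ) (h0 : 0 ≤ p) (h1 : p ≤ 1) (hq : 0 < q) (k : ℕ) : 0 ≤ bb p q k := by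
  unfold bb
  have := cc_nonneg p h0 h1 (k-1)
  have : 0 ≤ 1 - p := by linarith
  positivity

lemma bL_nonneg (p q ρ : ℝ) (h0 : 0 ≤ p) (h1 : p ≤ 1) (hq : 0 < q) (k : ℕ) : 0 ≤ bL p q ρ k := by
  unfold bL
  split_ifs
  · exact bb_nonneg p q h0 h1 hq k
  · exact le_rfl

lemma bG_nonneg (p q ρ : ℝ) (h0 : 0 ≤ p) (h1 : p ≤ 1) (hq : 0 < q) (k : ℕ) : 0 ≤ bG p q ρ k := by
  unfold bG
  split_ifs
  · exact le_rfl
  · exact bb_nonneg p q h0 h1 hq k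

lemma upper_aux (n : ℕ) (lam q δ ρ y : ℝ) (hn : 0 < n) (hl : 0 < lam) (hq : 0 < q) (hp : lam / n ≤ 1/2)
    (hρ : ρ ≤ δ * n) (hδ : 0 ≤ δ) (hy0 : 0 < y) (hy1 : y ≤ 1) (N : ℕ) :
    (n:ℝ)^N * expC (bL (lam/n) q ρ) N ≤ Real.exp (n * (q/lam * (y - y^2/2))) *
      (lam / (y * Real.exp (-y)))^N * Real.exp (lam * δ * N) := by
  have hn0 : (0:ℝ) < n := by exact_mod_cast hn
  set p := lam / n with hpdef
  have hp0 : 0 < p := by positivity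
  set z := n * (y * Real.exp (-y)) * Real.exp (-(lam*δ)) / lam with hz
  have hz0 : 0 < z := by positivity
  have h1 := expC_upper (bL p q ρ) (bL_nonneg p q ρ hp0.le (by linarith) hq) N z hz0.le
  have h2 : ∑ k ∈ Finset.range N, bL p q ρ (k+1) * z^(k+1) ≤ n * (q/lam * (y - y^2/2)) := by
    have h3 : ∀ k ∈ Finset.range N, bL p q ρ (k+1) * z^(k+1) ≤
        n * (q/lam) * (tm k * (y * Real.exp (-y))^(k+1) / (k+1).factorial) := by
      intro k _
      have := tm_nonneg k
      unfold bL
      split_ifs with hk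
      · unfold bb
        have e1 : Real.exp (-(lam*δ*(k+1))) ≤ (1-p)^((k+1).choose 2) := by
          calc Real.exp (-(lam*δ*(k+1))) ≤ Real.exp (-(2*p)*((k+1).choose 2 : ℕ)) := by
                apply Real.exp_le_exp.2
                rw [Nat.cast_choose_two]
                have e2 : p * ((k+1 : ℕ):ℝ) ≤ lam * δ := by
                  calc p * ((k+1 : ℕ):ℝ) ≤ p * (δ * n) := by gcongr; exact hk.trans hρ
                    _ = lam * δ := by rw [hpdef]; field_simp
                push_cast at e2 ⊢
                have e3 : p * k ≤ lam * δ := by linarith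
                nlinarith [mul_le_mul_of_nonneg_right e3 (show (0:ℝ) ≤ k+1 by positivity)]
            _ = Real.exp (-(2*p))^((k+1).choose 2) := by rw [← Real.exp_nat_mul]; ring_nf
            _ ≤ _ := pow_le_pow_left₀ (Real.exp_pos _).le (exp_le_one_sub p hp0.le hp) _
        have e4 : cc p k ≤ p^k * tm k := cc_le_tm p hp0.le (by linarith) k
        have e5 : 0 < Real.exp (-(lam*δ*(k+1))) := Real.exp_pos _
        have e6 := cc_nonneg p hp0.le (by linarith) k
        simp only [Nat.add_sub_cancel]
        calc q * (cc p k / ((1-p)^((k+1).choose 2) * ((k+1).factorial:ℝ))) * z^(k+1)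
            ≤ q * ((p^k * tm k) / (Real.exp (-(lam*δ*(k+1))) * ((k+1).factorial:ℝ))) * z^(k+1) := by gcongr
          _ = _ := by
            rw [hz]
            have e7 : Real.exp (-(lam*δ*(k+1))) = Real.exp (-(lam*δ))^(k+1) := by
              rw [← Real.exp_nat_mul]; push_cast; ring_nf
            rw [e7, hpdef]
            have := Real.exp_pos (-(lam*δ))
            simp only [div_pow, mul_pow]
            field_simp
            try ring
      · rw [zero_mul]; positivity
    refine (Finset.sum_le_sum h3).trans ?_
    rw [← Finset.mul_sum, mul_assoc]
    have := TK_upper N y hy0.le hy1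
    unfold TK at this
    gcongr
  have h4 : expC (bL p q ρ) N * z^N ≤ Real.exp (n * (q/lam * (y - y^2/2))) := h1.trans (Real.exp_le_exp.2 h2)
  have h5 : Real.exp (n * (q/lam * (y - y^2/2))) * (lam / (y * Real.exp (-y)))^N * Real.exp (lam * δ * N) =
      n^N * (Real.exp (n * (q/lam * (y - y^2/2))) / z^N) := by
    have e7 : Real.exp (lam*δ*N) = (Real.exp (-(lam*δ))^N)⁻¹ := by
      rw [← Real.exp_nat_mul, ← Real.exp_neg]; ring_nf
    rw [e7, hz]
    have := Real.exp_pos (-(lam*δ))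
    simp only [div_pow, mul_pow]
    field_simp
  rw [h5]
  have h6 : expC (bL p q ρ) N ≤ Real.exp (n * (q/lam * (y - y^2/2))) / z^N := by
    rw [le_div_iff₀ (by positivity)]; exact h4
  gcongr

def gam (lam q s : ℝ) : ℝ :=
  (q/lam) * (min (lam*s/q) 1 - (min (lam*s/q) 1)^2/2 - min (lam*s/q) 1 * Real.log (min (lam*s/q) 1)) +
    s * (min (lam*s/q) 1 + Real.log lam)

lemma gam_cont (lam q : ℝ) : Continuous (gam lam q) := by
  unfold gam
  have h : Continuous (fun s : ℝ => min (lam*s/q) 1) := by fun_prop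
  have h2 := Real.continuous_mul_log.comp h
  simp only [Function.comp_def] at h2
  fun_prop

lemma gam_eq (lam q s : ℝ) (hl : 0 < lam) (hq : 0 < q) (hs : 0 < s) :
    gam lam q s = (q/lam) * (min (lam*s/q) 1 - (min (lam*s/q) 1)^2/2) +
      s * Real.log (lam / (min (lam*s/q) 1 * Real.exp (-min (lam*s/q) 1))) := by
  have hy : 0 < min (lam*s/q) 1 := by positivity
  have h1 : Real.log (lam / (min (lam*s/q) 1 * Real.exp (-min (lam*s/q) 1))) =
      Real.log lam - Real.log (min (lam*s/q) 1) + min (lam*s/q) 1 := by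
    rw [Real.log_div hl.ne' (by positivity), Real.log_mul hy.ne' (by positivity), Real.log_exp]; ring
  rw [h1]
  unfold gam
  rcases le_total (lam*s/q) 1 with h | h
  · rw [min_eq_left h]
    field_simp; ring
  · rw [min_eq_right h]
    rw [Real.log_one]; ring

lemma upper_main (n : ℕ) (lam q δ ρ : ℝ) (hn : 0 < n) (hl : 0 < lam) (hq : 0 < q) (hp : lam / n ≤ 1/2)
    (hρ : ρ ≤ δ * n) (hδ : 0 ≤ δ) (N : ℕ) :
    (n:ℝ)^N * expC (bL (lam/n) q ρ) N ≤ Real.exp (n * gam lam q (N/n) + lam * δ * N) := by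
  have hn0 : (0:ℝ) < n := by exact_mod_cast hn
  rcases Nat.eq_zero_or_pos N with h | h
  · subst h
    simp [expC_zero, gam]
  · have hs : (0:ℝ) < N/n := by positivity
    set y := min (lam*((N:ℝ)/n)/q) 1 with hy
    have hy0 : 0 < y := by positivity
    refine (upper_aux n lam q δ ρ y hn hl hq hp hρ hδ hy0 (min_le_right _ _) N).trans (le_of_eq ?_)
    rw [gam_eq lam q _ hl hq hs, ← hy, Real.exp_add]
    congr 1
    rw [mul_add, Real.exp_add]
    congr 1
    have h3 : (n:ℝ) * (N/n * Real.log (lam / (y * Real.exp (-y)))) = N * Real.log (lam / (y * Real.exp (-y))) := by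
      field_simp
    rw [h3, Real.exp_nat_mul, Real.exp_log (by positivity)]

lemma fill_step (W : ℕ → ℝ) (hW : ∀ k, 0 ≤ W k) (k : ℕ) (hk : 1 ≤ k) (κ B : ℝ) (hκ : 0 ≤ κ)
    (h : κ * B ≤ k * W k) (N : ℕ) (hN : ((N + k : ℕ) : ℝ) ≤ B) :
    κ * expC W N ≤ expC W (N+k) := by
  have h1 := expC_step W hW k N hk
  have h2 := expC_nonneg W hW N
  have h3 : (0:ℝ) < ((N+k : ℕ):ℝ) := by exact_mod_cast (by omega)
  have h4 : κ * ((N+k:ℕ):ℝ) ≤ k * W k := (mul_le_mul_of_nonneg_left hN hκ).trans h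
  have h5 : ((N+k:ℕ):ℝ) * (κ * expC W N) ≤ ((N+k:ℕ):ℝ) * expC W (N+k) := by
    calc ((N+k:ℕ):ℝ) * (κ * expC W N) = (κ * ((N+k:ℕ):ℝ)) * expC W N := by ring
      _ ≤ (k * W k) * expC W N := by gcongr
      _ ≤ _ := h1
  exact le_of_mul_le_mul_left h5 h3

lemma fill_steps (W : ℕ → ℝ) (hW : ∀ k, 0 ≤ W k) (k : ℕ) (hk : 1 ≤ k) (κ B : ℝ) (hκ : 0 ≤ κ)
    (h : κ * B ≤ k * W k) (j : ℕ) : ∀ (N : ℕ) (_ : ((N + j*k : ℕ) : ℝ) ≤ B),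
    κ^j * expC W N ≤ expC W (N+j*k) := by
  induction j with
  | zero => intro N _; simp
  | succ j ih =>
    intro N hN
    have e : N + (j+1)*k = (N + j*k) + k := by ring
    rw [e] at hN ⊢
    have h1 := ih N (le_trans (by exact_mod_cast (by omega)) hN)
    have h2 := fill_step W hW k hk κ B hκ h (N+j*k) hN
    calc κ^(j+1) * expC W N = κ * (κ^j * expC W N) := by ring
      _ ≤ κ * expC W (N+j*k) := by gcongr
      _ ≤ _ := h2

/-- the coefficients of the limiting Poisson cluster counts -/
def aa (lam q z : ℝ) (k : ℕ) : ℝ := (q/lam) * (tm (k-1) * z^k / (k.factorial : ℝ))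

lemma aa_pos (lam q z : ℝ) (hl : 0 < lam) (hq : 0 < q) (hz : 0 < z) (k : ℕ) : 0 < aa lam q z k := by
  unfold aa
  have := tm_pos (k-1)
  positivity

lemma sum_Icc_shift (f : ℕ → ℝ) (K : ℕ) : ∑ k ∈ Finset.Icc 1 K, f k = ∑ k ∈ Finset.range K, f (k+1) := by
  induction K with
  | zero => simp
  | succ K ih => rw [Finset.sum_Icc_succ_top (by omega), Finset.sum_range_succ, ih]

lemma sum_aa (lam q z : ℝ) (K : ℕ) : ∑ k ∈ Finset.Icc 1 K, aa lam q z k = (q/lam) * TK K z := by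
  rw [sum_Icc_shift]
  unfold aa TK
  rw [Finset.mul_sum]
  simp

lemma sum_kaa (lam q y : ℝ) (K : ℕ) :
    ∑ k ∈ Finset.Icc 1 K, (k:ℝ) * aa lam q (y * Real.exp (-y)) k = (q/lam) * (y * QK K y) := by
  rw [sum_Icc_shift]
  unfold aa QK
  rw [Finset.mul_sum, Finset.mul_sum]
  refine Finset.sum_congr rfl fun k _ => ?_
  have e : Real.exp (-(y*(k+1))) = Real.exp (-y)^(k+1) := by
    rw [← Real.exp_nat_mul]; push_cast; ring_nf
  rw [e, Nat.factorial_succ, mul_pow]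
  push_cast
  have : (0:ℝ) < k.factorial := by positivity
  have : (0:ℝ) < (k:ℝ)+1 := by positivity
  field_simp
  ring

lemma lower_compare (n : ℕ) (lam q ρ z : ℝ) (K : ℕ) (hn : 0 < n) (hl : 0 < lam) (hq : 0 < q)
    (hp : lam / n ≤ 1/2) (hz : 0 < z) (hK : (K:ℝ) ≤ ρ) (N : ℕ) :
    (lam/z)^N * expC (fun k => if k ≤ K then (1-lam/n)^(K*K) * n * aa lam q z k else 0) N ≤
      (n:ℝ)^N * expC (bL (lam/n) q ρ) N := by
  have hn0 : (0:ℝ) < n := by exact_mod_cast hn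
  set p := lam / n with hpdef
  have hp0 : 0 < p := by positivity
  have hr : 0 < 1 - p := by linarith
  rw [← expC_scale, ← expC_scale]
  refine le_trans (le_of_eq (expC_congr _ (fun k => if k = 0 then 0 else (lam/z)^k * (if k ≤ K then (1-p)^(K*K) * n * aa lam q z k else 0)) N
    (by intro k hk _; exact (if_neg (by omega)).symm))) ?_
  apply expC_mono
  · intro k
    have := (aa_pos lam q z hl hq hz k).le
    split_ifs <;> positivity
  · intro k
    have hL := bL_nonneg p q ρ hp0.le (by linarith) hq k
    split_ifs with h1 h2
    · positivity
    · obtain ⟨m, rfl⟩ : ∃ m, k = m+1 := ⟨k-1, by omega⟩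
      unfold bL
      rw [if_pos (le_trans (by exact_mod_cast h2) hK)]
      unfold bb aa
      simp only [Nat.add_sub_cancel]
      have e1 := cc_ge_tm p hp0.le (by linarith) m
      have e2 : (1-p)^(K*K) ≤ (1-p)^(m*m) :=
        pow_le_pow_of_le_one hr.le (by linarith) (Nat.mul_le_mul (by omega) (by omega))
      have e3 : (1-p)^((m+1).choose 2) ≤ 1 := pow_le_one₀ hr.le (by linarith)
      have e4 := tm_nonneg m
      have e5 := cc_nonneg p hp0.le (by linarith) m
      have e6 : 0 < (1-p)^((m+1).choose 2) := by positivity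
      calc (lam/z)^(m+1) * ((1-p)^(K*K) * n * (q/lam * (tm m * z^(m+1) / ((m+1).factorial:ℝ))))
          = (n:ℝ)^(m+1) * (q * ((p^m * ((1-p)^(K*K) * tm m)) / (1 * ((m+1).factorial:ℝ)))) := by
            rw [hpdef]
            generalize (1 - lam/(n:ℝ))^(K*K) = R
            simp only [div_pow]
            field_simp
            ring
        _ ≤ (n:ℝ)^(m+1) * (q * (cc p m / ((1-p)^((m+1).choose 2) * ((m+1).factorial:ℝ)))) := by
            gcongr
            exact le_trans (by gcongr) e1
    · rw [mul_zero]; positivity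

lemma lower_fin (n : ℕ) (lam q ρ y s c : ℝ) (K : ℕ) (hn : 0 < n) (hl : 0 < lam) (hq : 0 < q)
    (hp : lam / n ≤ 1/2) (hy : 0 < y) (hys : q/lam*y ≤ s) (hs : 0 < s) (hK1 : 1 ≤ K) (hK : (K:ℝ) ≤ ρ)
    (hR : 1/2 ≤ (1-lam/n)^(K*K)) (hcn : c ≤ n)
    (N : ℕ) (hN1 : s * n ≤ N) (hN2 : (N:ℝ) ≤ s * n + c)
    (κ κ1 : ℝ) (hκ0 : 0 < κ) (hκ1 : κ ≤ 1) (hκ10 : 0 < κ1) (hκ11 : κ1 ≤ 1)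
    (hκ : κ * (2*(s+1)) ≤ K * aa lam q (y * Real.exp (-y)) K)
    (hκ' : κ1 * (2*(s+1)) ≤ aa lam q (y * Real.exp (-y)) 1) :
    Real.exp (N * Real.log (lam / (y * Real.exp (-y))) +
      ((1-lam/n)^(K*K) * n * (q/lam * TK K (y * Real.exp (-y))) - 2 * K -
        K * Real.log (n * (q/lam * TK K (y * Real.exp (-y))) + 1)) +
      ((s - (1-lam/n)^(K*K) * (q/lam*(y*QK K y))) * n + c + K*K)/K * Real.log κ + K * Real.log κ1) ≤
      (n:ℝ)^N * expC (bL (lam/n) q ρ) N := by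
  have hn0 : (0:ℝ) < n := by exact_mod_cast hn
  set z := y * Real.exp (-y) with hz
  have hz0 : 0 < z := by positivity
  have hKr : (0:ℝ) < K := by exact_mod_cast hK1
  set R := (1-lam/n)^(K*K) with hRdef
  have hR1 : R ≤ 1 := pow_le_one₀ (by linarith) (by have : 0 < lam/n := by positivity
                                                    linarith)
  have hR0 : 0 < R := by linarith
  have ha := aa_pos lam q z hl hq hz0
  set X : ℕ → ℝ := fun k => R * n * aa lam q z k with hX
  have hX0 : ∀ k, 0 < X k := fun k => by have := ha k; simp only [hX]; positivity
  set W : ℕ → ℝ := fun k => if k ≤ K then X k else 0 with hWdef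
  have hW0 : ∀ k, 0 ≤ W k := fun k => by
    simp only [hWdef]; split_ifs
    · exact (hX0 k).le
    · exact le_rfl
  set A := q/lam * TK K z with hA
  have hAsum : ∑ k ∈ Finset.Icc 1 K, aa lam q z k = A := sum_aa lam q z K
  have hQ1 := QK_le K y hy
  have hQ0 := QK_nonneg K y hy.le
  set a := q/lam * (y * QK K y) with hadef
  have hasum : ∑ k ∈ Finset.Icc 1 K, (k:ℝ) * aa lam q z k = a := sum_kaa lam q y K
  have has : a ≤ s := by
    refine le_trans ?_ hys
    rw [hadef, ← mul_assoc]
    exact mul_le_of_le_one_right (by positivity) hQ1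
  have ha0 : 0 ≤ a := by positivity
  have hA0 : 0 ≤ A := by rw [← hAsum]; exact Finset.sum_nonneg fun k _ => (ha k).le
  -- the product
  set m : ℕ → ℕ := fun k => ⌊X k⌋₊ with hm
  set M := ∑ k ∈ Finset.Icc 1 K, m k * k with hM
  have hprod : Real.exp (R*n*A - 2*K) / (n*A+1)^K ≤ expC W M := by
    refine le_trans ?_ (expC_prod X (fun k => (hX0 k).le) m K)
    have h1 : ∀ k ∈ Finset.Icc 1 K, Real.exp (X k - 2) / (n*A+1) ≤ (X k)^(m k)/((m k).factorial:ℝ) := by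
      intro k hk
      refine le_trans ?_ (floor_bound (X k) (hX0 k).le)
      have h2 : X k ≤ n * A := by
        have h3 : aa lam q z k ≤ A := by
          rw [← hAsum]
          exact Finset.single_le_sum (f := aa lam q z) (fun k _ => (ha k).le) hk
        simp only [hX]
        have := (ha k).le
        calc R * n * aa lam q z k ≤ 1 * n * A := by gcongr
          _ = _ := by ring
      have := hX0 k
      gcongr
    refine le_trans (le_of_eq ?_) (Finset.prod_le_prod (fun k _ => by positivity) h1)
    rw [Finset.prod_div_distrib, ← Real.exp_sum, Finset.prod_const, Finset.sum_sub_distrib]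
    simp only [Nat.card_Icc, Nat.add_sub_cancel, Finset.sum_const, nsmul_eq_mul, hX]
    rw [← Finset.mul_sum, hAsum]
    ring_nf
  have hMup : (M:ℝ) ≤ R * n * a := by
    rw [hM, ← hasum]
    push_cast
    rw [Finset.mul_sum]
    refine Finset.sum_le_sum fun k _ => ?_
    have : (m k : ℝ) ≤ X k := Nat.floor_le (hX0 k).le
    calc (m k:ℝ) * k ≤ X k * k := by gcongr
      _ = _ := by simp only [hX]; ring
  have hMlo : R * n * a - K*K ≤ (M:ℝ) := by
    have : ∑ k ∈ Finset.Icc 1 K, (R * n * ((k:ℝ) * aa lam q z k) - K) ≤ ∑ k ∈ Finset.Icc 1 K, (m k * k : ℝ) := by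
      refine Finset.sum_le_sum fun k hk => ?_
      have h1 : X k < m k + 1 := Nat.lt_floor_add_one _
      have hkK : (k:ℝ) ≤ K := by exact_mod_cast (Finset.mem_Icc.1 hk).2
      simp only [hX] at h1
      have hk0 : (0:ℝ) ≤ k := by positivity
      nlinarith
    rw [Finset.sum_sub_distrib, ← Finset.mul_sum, hasum] at this
    simp only [Nat.card_Icc, Nat.add_sub_cancel, Finset.sum_const, nsmul_eq_mul] at this
    rw [hM]; push_cast; exact this
  have hMN : M ≤ N := by
    have : (M:ℝ) ≤ N := by
      calc (M:ℝ) ≤ R * n * a := hMup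
        _ ≤ 1 * n * s := by gcongr
        _ ≤ N := by linarith
    exact_mod_cast this
  set D := N - M with hD
  set j := D / K with hj
  set i := D % K with hi
  have hDji : M + j * K + i = N := by
    have := Nat.div_add_mod D K
    rw [← hj, ← hi] at this
    have : j * K = K * j := by ring
    omega
  have hiK : i < K := Nat.mod_lt _ (by omega)
  have hNB : (N:ℝ) ≤ (s+1)*n := by linarith
  have hfill1 := fill_steps W hW0 K hK1 κ ((s+1)*n) hκ0.le (by
    simp only [hWdef, le_refl, if_true, hX]
    have := (ha K)
    calc κ * ((s+1)*n) = (1/2 * n) * (κ * (2*(s+1))) := by ring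
      _ ≤ (1/2 * n) * (K * aa lam q z K) := by gcongr
      _ ≤ (R * n) * (K * aa lam q z K) := by gcongr
      _ = _ := by ring) j M (le_trans (by exact_mod_cast (by omega)) hNB)
  have hfill2 := fill_steps W hW0 1 le_rfl κ1 ((s+1)*n) hκ10.le (by
    simp only [hWdef, hK1, if_true, hX]
    have := (ha 1)
    calc κ1 * ((s+1)*n) = (1/2 * n) * (κ1 * (2*(s+1))) := by ring
      _ ≤ (1/2 * n) * (aa lam q z 1) := by gcongr
      _ ≤ (R * n) * (aa lam q z 1) := by gcongr
      _ = _ := by push_cast; ring) i (M + j*K) (le_trans (by exact_mod_cast (by omega)) hNB)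
  rw [mul_one, hDji] at hfill2
  have hcmp := lower_compare n lam q ρ z K hn hl hq hp hz0 hK N
  have hall : (lam/z)^N * (κ1^i * (κ^j * (Real.exp (R*n*A - 2*K) / (n*A+1)^K))) ≤
      (n:ℝ)^N * expC (bL (lam/n) q ρ) N := by
    refine le_trans ?_ hcmp
    gcongr
    refine le_trans ?_ hfill2
    gcongr
    refine le_trans ?_ hfill1
    gcongr
  have hnA : 0 < n*A+1 := by positivity
  refine le_trans ?_ hall
  rw [← Real.exp_log (x := (lam/z)^N * (κ1^i * (κ^j * (Real.exp (R*n*A - 2*K) / (n*A+1)^K)))) (by positivity)]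
  apply Real.exp_le_exp.2
  have hlz : 0 < lam / z := by positivity
  rw [Real.log_mul (x := (lam/z)^N) (by positivity) (by positivity), Real.log_mul (x := κ1^i) (by positivity) (by positivity),
    Real.log_mul (x := κ^j) (by positivity) (by positivity), Real.log_div (x := Real.exp (R*n*A - 2*K)) (by positivity) (by positivity),
    Real.log_exp, Real.log_pow, Real.log_pow, Real.log_pow, Real.log_pow]
  have hl1 : Real.log κ ≤ 0 := Real.log_nonpos hκ0.le hκ1
  have hl2 : Real.log κ1 ≤ 0 := Real.log_nonpos hκ10.le hκ11
  have hjle : (j:ℝ) ≤ ((s - R * a) * n + c + K*K)/K := by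
    rw [le_div_iff₀ hKr]
    have h1 : (M:ℝ) + j * K ≤ N := by exact_mod_cast (by omega)
    linarith
  have h1 := mul_le_mul_of_nonpos_right hjle hl1
  have h2 : (K:ℝ) * Real.log κ1 ≤ i * Real.log κ1 :=
    mul_le_mul_of_nonpos_right (by exact_mod_cast hiK.le) hl2
  linarith

lemma log_div_tendsto : Tendsto (fun n : ℕ => Real.log n / n) atTop (𝓝 0) := by
  have := (Real.isLittleO_log_id_atTop.tendsto_div_nhds_zero).comp (tendsto_natCast_atTop_atTop (R := ℝ))
  exact this

lemma lower_K (lam q s ε c η y : ℝ) (K : ℕ) (hl : 0 < lam) (hq : 0 < q) (hs : 0 < s) (hε : 0 < ε)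
    (hη : 0 < η) (hc : 0 ≤ c) (hK1 : 1 ≤ K) (hy : 0 < y) (hys : q/lam*y ≤ s) :
    ∀ᶠ n : ℕ in atTop, ∀ N : ℕ, s * n ≤ N → (N:ℝ) ≤ s * n + c →
      Real.exp (n * (s * Real.log (lam / (y * Real.exp (-y))) + q/lam * TK K (y * Real.exp (-y)) +
        (s - q/lam*(y*QK K y))/K * Real.log (min 1 (K * aa lam q (y * Real.exp (-y)) K / (2*(s+1)))) - η)) ≤
      (n:ℝ)^N * expC (bL (lam/n) q (ε * n)) N := by
  set z := y * Real.exp (-y) with hz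
  have hz0 : 0 < z := by positivity
  have hKr : (0:ℝ) < K := by exact_mod_cast hK1
  have ha := aa_pos lam q z hl hq hz0
  have haK := ha K
  have ha1 := ha 1
  set κ := min 1 (K * aa lam q z K / (2*(s+1))) with hκd
  set κ1 := min 1 (aa lam q z 1 / (2*(s+1))) with hκ1d
  have hκ0 : 0 < κ := by positivity
  have hκ10 : 0 < κ1 := by positivity
  set A := q/lam * TK K z with hA
  have hA0 : 0 ≤ A := by
    rw [hA, ← sum_aa]; exact Finset.sum_nonneg fun k _ => (ha k).le
  set a := q/lam * (y * QK K y) with hadef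
  set L := Real.log (lam / z) with hL
  have hpt : Tendsto (fun n : ℕ => lam / (n:ℝ)) atTop (𝓝 0) := tendsto_const_div_atTop_nhds_zero_nat lam
  have hRt : Tendsto (fun n : ℕ => (1 - lam / (n:ℝ))^(K*K)) atTop (𝓝 1) := by
    have := (tendsto_const_nhds (x := (1:ℝ)).sub hpt).pow (K*K)
    simpa using this
  have hEt : Tendsto (fun n : ℕ => s * L + (1 - lam / (n:ℝ))^(K*K) * A +
      (s - (1 - lam / (n:ℝ))^(K*K) * a)/K * Real.log κ +
      (-(c*|L|) - 2*K + (c+K*K)/K * Real.log κ + K * Real.log κ1 - K * Real.log (A+1)) / n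
      - K * (Real.log n / n)) atTop (𝓝 (s * L + 1 * A + (s - 1 * a)/K * Real.log κ + 0 - K * 0)) := by
    refine (((tendsto_const_nhds.add (hRt.mul_const A)).add
      (((tendsto_const_nhds.sub (hRt.mul_const a)).div_const _).mul_const _)).add
      (tendsto_const_div_atTop_nhds_zero_nat _)).sub (log_div_tendsto.const_mul _)
  have hev := hEt.eventually (lt_mem_nhds (a := s * L + A + (s - a)/K * Real.log κ - η) (by
    simp only [one_mul, mul_zero, add_zero, sub_zero]; linarith))
  have hεn : ∀ᶠ n : ℕ in atTop, (K:ℝ) ≤ ε * n := by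
    filter_upwards [tendsto_natCast_atTop_atTop.eventually_ge_atTop ((K:ℝ)/ε)] with n hn
    rw [div_le_iff₀ hε] at hn; linarith
  filter_upwards [hev, hεn, hpt.eventually (ge_mem_nhds (show (0:ℝ) < 1/2 by norm_num)),
    hRt.eventually (le_mem_nhds (show (1/2:ℝ) < 1 by norm_num)), eventually_gt_atTop 0,
    tendsto_natCast_atTop_atTop.eventually_ge_atTop c] with n h1 h2 h3 h4 h5 h6 N hN1 hN2
  have hn0 : (0:ℝ) < n := by exact_mod_cast h5
  refine le_trans ?_ (lower_fin n lam q (ε*n) y s c K h5 hl hq h3 hy hys hs hK1 h2 h4 h6 N hN1 hN2 κ κ1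
    hκ0 (min_le_left _ _) hκ10 (min_le_left _ _) ?_ ?_)
  · apply Real.exp_le_exp.2
    rw [← hz, ← hA, ← hadef, ← hL]
    set R := (1-lam/n)^(K*K) with hR
    have e1 := mul_le_mul_of_nonneg_left h1.le hn0.le
    refine e1.trans ?_
    have e2 : Real.log (n * A + 1) ≤ Real.log n + Real.log (A+1) := by
      rw [← Real.log_mul hn0.ne' (by positivity)]
      apply Real.log_le_log (by positivity)
      have : (1:ℝ) ≤ n := by exact_mod_cast h5
      nlinarith
    have e3 : s * n * L - c * |L| ≤ N * L := by
      have e4 : |((N:ℝ) - s*n) * L| ≤ c * |L| := by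
        rw [abs_mul]
        gcongr
        rw [abs_le]; constructor <;> linarith
      have := (abs_le.1 e4).1
      linarith
    have e5 : (n:ℝ) * (s * L + R * A + (s - R * a)/K * Real.log κ +
      (-(c*|L|) - 2*K + (c+K*K)/K * Real.log κ + K * Real.log κ1 - K * Real.log (A+1)) / n
      - K * (Real.log n / n)) = s * n * L - c * |L| + (R * n * A - 2*K - K * (Real.log n + Real.log (A+1))) +
       ((s - R * a) * n + c + K*K)/K * Real.log κ + K * Real.log κ1 := by
      field_simp; ring
    rw [e5]
    have e6 := mul_le_mul_of_nonneg_left e2 hKr.le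
    linarith
  · rw [← le_div_iff₀ (by positivity)]; exact min_le_right _ _
  · rw [← le_div_iff₀ (by positivity)]; exact min_le_right _ _

lemma lower_main (lam q s ε c η : ℝ) (hl : 0 < lam) (hq : 0 < q) (hs : 0 < s) (hε : 0 < ε)
    (hη : 0 < η) (hc : 0 ≤ c) :
    ∀ᶠ n : ℕ in atTop, ∀ N : ℕ, s * n ≤ N → (N:ℝ) ≤ s * n + c →
      Real.exp (n * (gam lam q s - η)) ≤ (n:ℝ)^N * expC (bL (lam/n) q (ε * n)) N := by
  have hy : 0 < min (lam*s/q) 1 := by positivity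
  have hge := gam_eq lam q s hl hq hs
  set y := min (lam*s/q) 1 with hyd
  have hy1 : y ≤ 1 := min_le_right _ _
  have hys : q/lam*y ≤ s := by
    calc q/lam*y ≤ q/lam * (lam*s/q) := by gcongr; exact min_le_left _ _
      _ = s := by field_simp
  set z := y * Real.exp (-y) with hz
  have hz0 : 0 < z := by positivity
  set C1 := |Real.log (q/lam/(2*(s+1)*Real.exp 1))| with hC1
  obtain ⟨B, hB⟩ : ∃ B : ℝ, ∀ K : ℕ, 1 ≤ K → -(B/K) ≤ (s - q/lam*(y*QK K y)) * (1 + Real.log z) := by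
    have hlz : Real.log z = Real.log y - y := by
      rw [hz, Real.log_mul hy.ne' (by positivity), Real.log_exp]; ring
    rcases eq_or_lt_of_le hy1 with h | h
    · refine ⟨0, fun K _ => ?_⟩
      rw [hlz, h]; simp
    · have hse : s = q/lam*y := by
        have : y = lam*s/q := by
          rw [hyd]; apply min_eq_left
          by_contra hh
          push Not at hh
          rw [hyd, min_eq_right hh.le] at h
          exact lt_irrefl _ h
        rw [this]; field_simp
      refine ⟨q/lam*y/(1-y) * |1 + Real.log z|, fun K hK => ?_⟩
      have hKr : (0:ℝ) < K := by exact_mod_cast hK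
      have h1y : 0 < 1 - y := by linarith
      have e1 := QK_ge K hK y hy h
      have e2 : s - q/lam*(y*QK K y) ≤ q/lam*y/((1-y)*K) := by
        calc s - q/lam*(y*QK K y) = q/lam*y*(1 - QK K y) := by rw [hse]; ring
          _ ≤ q/lam*y*(1/((1-y)*K)) := by gcongr; linarith
          _ = _ := by ring
      have e3 : 0 ≤ s - q/lam*(y*QK K y) := by
        have := QK_le K y hy
        calc (0:ℝ) ≤ q/lam*y*(1 - QK K y) := by
              have : 0 ≤ 1 - QK K y := by linarith
              positivity
          _ = s - q/lam*(y*QK K y) := by rw [hse]; ring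
      have e4 := neg_abs_le (1 + Real.log z)
      calc -(q/lam*y/(1-y) * |1 + Real.log z|/K) = -(q/lam*y/((1-y)*K) * |1 + Real.log z|) := by
            field_simp
        _ ≤ -((s - q/lam*(y*QK K y)) * |1 + Real.log z|) := by gcongr
        _ ≤ _ := by nlinarith
  have hκ : ∀ K : ℕ, 1 ≤ K → K * (1 + Real.log z) - 2 * Real.log K - C1 ≤
      Real.log (min 1 (K * aa lam q z K / (2*(s+1)))) := by
    intro K hK
    have hKr : (0:ℝ) < K := by exact_mod_cast hK
    have hK1 : (1:ℝ) ≤ K := by exact_mod_cast hK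
    have haK := aa_pos lam q z hl hq hz0 K
    have e1 : q/lam/(2*(s+1)*Real.exp 1) * (Real.exp 1 * z)^K / (K:ℝ)^2 ≤ K * aa lam q z K / (2*(s+1)) := by
      obtain ⟨m, rfl⟩ : ∃ m, K = m+1 := ⟨K-1, by omega⟩
      have e2 := tm_lower m
      have e3 := fact_upper (m+1) (by omega)
      unfold aa
      simp only [Nat.add_sub_cancel]
      have hfac : (0:ℝ) < ((m+1).factorial : ℝ) := by positivity
      have e4 : Real.exp ((m+1:ℕ):ℝ) = Real.exp 1^(m+1) := by rw [← Real.exp_nat_mul]; simp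
      rw [e4] at e3
      have hE := Real.exp_pos 1
      set k : ℝ := ((m+1:ℕ):ℝ) with hk
      have e2' : k^m ≤ k * tm m := by rw [hk]; push_cast; exact e2
      have e5 : Real.exp 1^(m+1) / (k^2 * Real.exp 1) ≤ k * tm m / ((m+1).factorial:ℝ) := by
        rw [div_le_div_iff₀ (by positivity) hfac]
        calc Real.exp 1^(m+1) * ((m+1).factorial:ℝ) ≤ Real.exp 1 * k^(m+1+1) := by linarith
          _ = k^m * (k^2 * Real.exp 1) := by ring
          _ ≤ _ := by gcongr
      calc q/lam/(2*(s+1)*Real.exp 1) * (Real.exp 1 * z)^(m+1) / k^2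
          = (q/lam/(2*(s+1)) * z^(m+1)) * (Real.exp 1^(m+1) / (k^2 * Real.exp 1)) := by
            rw [mul_pow]; field_simp
        _ ≤ (q/lam/(2*(s+1)) * z^(m+1)) * (k * tm m / ((m+1).factorial:ℝ)) := by gcongr
        _ = _ := by field_simp
    have hlogz : 1 + Real.log z ≤ 0 := by
      have : Real.log z = Real.log y - y := by
        rw [hz, Real.log_mul hy.ne' (by positivity), Real.log_exp]; ring
      rw [this]
      have := Real.log_le_sub_one_of_pos hy
      linarith
    rw [← Real.log_exp (K * (1 + Real.log z) - 2 * Real.log K - C1)]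
    apply Real.log_le_log (Real.exp_pos _)
    apply le_min
    · apply Real.exp_le_one_iff.2
      have : 0 ≤ C1 := abs_nonneg _
      have := Real.log_nonneg hK1
      nlinarith
    · refine le_trans ?_ e1
      have hpos : 0 < q/lam/(2*(s+1)*Real.exp 1) := by positivity
      rw [← Real.exp_log (x := q/lam/(2*(s+1)*Real.exp 1) * (Real.exp 1 * z)^K / (K:ℝ)^2) (by positivity)]
      apply Real.exp_le_exp.2
      rw [Real.log_div (x := q/lam/(2*(s+1)*Real.exp 1) * (Real.exp 1 * z)^K) (by positivity) (by positivity),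
        Real.log_mul (x := q/lam/(2*(s+1)*Real.exp 1)) (by positivity) (by positivity), Real.log_pow, Real.log_pow,
        Real.log_mul (x := Real.exp 1) (by positivity) (by positivity), Real.log_exp]
      have := neg_abs_le (Real.log (q/lam/(2*(s+1)*Real.exp 1)))
      push_cast
      linarith
  have hHt : Tendsto (fun K : ℕ => -((q/lam*y + B + s * C1)/K) - 2*s*(Real.log K/K)) atTop (𝓝 (-0 - 2*s*0)) :=
    (tendsto_const_div_atTop_nhds_zero_nat _).neg.sub (log_div_tendsto.const_mul _)
  obtain ⟨K, hK, hK1⟩ := ((hHt.eventually (lt_mem_nhds (a := -(η/2)) (by simp; linarith))).and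
    (eventually_ge_atTop 1)).exists
  filter_upwards [lower_K lam q s ε c (η/2) y K hl hq hs hε (by linarith) hc hK1 hy hys] with n hn N hN1 hN2
  refine le_trans ?_ (hn N hN1 hN2)
  apply Real.exp_le_exp.2
  apply mul_le_mul_of_nonneg_left _ (by positivity)
  have hKr : (0:ℝ) < K := by exact_mod_cast hK1
  have hK1r : (1:ℝ) ≤ K := by exact_mod_cast hK1
  have f1 := TK_lower K hK1 y hy.le hy1
  have f2 := hB K hK1
  have f3 := hκ K hK1
  rw [← hz] at f1 ⊢
  have g1 : 0 ≤ s - q/lam*(y*QK K y) := by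
    have := QK_le K y hy
    have : q/lam*(y*QK K y) ≤ q/lam*(y * 1) := by gcongr
    linarith
  have g2 : s - q/lam*(y*QK K y) ≤ s := by
    have := QK_nonneg K y hy.le
    have : 0 ≤ q/lam*(y*QK K y) := by positivity
    linarith
  have g3 : 0 ≤ 2 * Real.log K + C1 := by
    have : 0 ≤ C1 := abs_nonneg _
    have := Real.log_nonneg hK1r
    linarith
  have h1 : -(B/K) - s * (2 * Real.log K + C1)/K ≤ (s - q/lam*(y*QK K y))/K *
      Real.log (min 1 (K * aa lam q z K / (2*(s+1)))) := by
    calc -(B/K) - s * (2 * Real.log K + C1)/K ≤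
        (s - q/lam*(y*QK K y)) * (1 + Real.log z) - (s - q/lam*(y*QK K y)) * (2 * Real.log K + C1)/K := by
          gcongr
      _ = (s - q/lam*(y*QK K y))/K * (K * (1 + Real.log z) - 2 * Real.log K - C1) := by
          field_simp; ring
      _ ≤ _ := by gcongr
  have h2 : q/lam * (y - y^2/2) - q/lam*y/K ≤ q/lam * TK K z := by
    calc q/lam * (y - y^2/2) - q/lam*y/K = q/lam * (y - y^2/2 - y/K) := by ring
      _ ≤ _ := by gcongr
  have h3 : -(η/2) < -((q/lam*y + B + s*C1)/K) - 2*s*(Real.log K/K) := hK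
  have h4 : -((q/lam*y + B + s*C1)/K) - 2*s*(Real.log K/K) = - (q/lam*y/K) + (-(B/K) - s * (2 * Real.log K + C1)/K) := by
    field_simp; ring
  rw [hge]
  linarith

/-- exponential rate of one cluster with density `α` -/
def phf (lam α : ℝ) : ℝ := α * Real.log (1 - Real.exp (-(lam*α))) + lam*α^2/2 - α * Real.log α + α

def ee (p : ℝ) (k : ℕ) : ℝ := (1-(1-p)^k)^k / ((1-p)^(k.choose 2) * (k.factorial:ℝ))

lemma exp_lt_one_of_neg_arg (x : ℝ) (hx : x < 0) : Real.exp x < 1 := by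
  rw [← Real.exp_zero]; exact Real.exp_lt_exp.2 hx

lemma exp_phf (lam : ℝ) (hl : 0 < lam) (n k : ℕ) (hn : 0 < n) (hk : 0 < k) :
    Real.exp (n * phf lam (k/n)) = (n:ℝ)^k * ((1 - Real.exp (-(lam/n*k)))^k * Real.exp (lam/n*k^2/2) * (Real.exp k / (k:ℝ)^k)) := by
  have hn0 : (0:ℝ) < n := by exact_mod_cast hn
  have hk0 : (0:ℝ) < k := by exact_mod_cast hk
  have e0 : lam * ((k:ℝ)/n) = lam/n*k := by ring
  have h1 : 0 < 1 - Real.exp (-(lam/n*k)) := by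
    have : Real.exp (-(lam/n*k)) < 1 := exp_lt_one_of_neg_arg _ (neg_lt_zero.2 (by positivity))
    linarith
  rw [← Real.exp_log (x := (n:ℝ)^k * ((1 - Real.exp (-(lam/n*k)))^k * Real.exp (lam/n*k^2/2) * (Real.exp k / (k:ℝ)^k))) (by positivity)]
  congr 1
  rw [Real.log_mul (by positivity) (by positivity), Real.log_mul (by positivity) (by positivity),
    Real.log_mul (by positivity) (by positivity), Real.log_div (by positivity) (by positivity), Real.log_exp, Real.log_exp,
    Real.log_pow, Real.log_pow, Real.log_pow]
  unfold phf
  rw [e0, Real.log_div hk0.ne' hn0.ne']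
  field_simp
  ring

lemma one_sub_pow_ge (p : ℝ) (h1 : p ≤ 1) (k : ℕ) : 1 - Real.exp (-(p*k)) ≤ 1 - (1-p)^k := by
  have : (1-p)^k ≤ Real.exp (-p)^k := pow_le_pow_left₀ (by linarith) (Real.one_sub_le_exp_neg p) k
  rw [← Real.exp_nat_mul] at this
  have e : (k:ℝ) * -p = -(p*k) := by ring
  rw [e] at this; linarith

lemma exp_le_one_sub' (p : ℝ) (h0 : 0 ≤ p) (h1 : p ≤ 1/2) : Real.exp (-(p+p^2)) ≤ 1 - p := by
  have h2 := Real.quadratic_le_exp_of_nonneg (show 0 ≤ p+p^2 by positivity)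
  have h3 : 1 ≤ (1-p) * Real.exp (p+p^2) := by
    have h4 : 1 ≤ (1-p) * (1 + (p+p^2) + (p+p^2)^2/2) := by
      have e : (1-p) * (1 + (p+p^2) + (p+p^2)^2/2) = 1 + p^2 * ((1/2-p)*(1+p)) + (1-p)*(p^4/2) := by ring
      rw [e]
      have : 0 ≤ 1/2 - p := by linarith
      have : 0 ≤ 1 - p := by linarith
      have : 0 ≤ p^2 * ((1/2-p)*(1+p)) := by positivity
      have : 0 ≤ (1-p)*(p^4/2) := by positivity
      linarith
    have : 0 ≤ 1 - p := by linarith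
    exact h4.trans (by gcongr)
  rw [Real.exp_neg, inv_le_iff_one_le_mul₀ (Real.exp_pos _)]
  exact h3

lemma ee_lower (lam : ℝ) (hl : 0 < lam) (n k : ℕ) (hn : 0 < n) (hk : 0 < k) (hkn : k ≤ n) (hp : lam/n ≤ 1/2) :
    Real.exp (n * phf lam (k/n)) * (Real.exp (-lam) / (Real.exp 1 * k)) ≤ (n:ℝ)^k * ee (lam/n) k := by
  have hn0 : (0:ℝ) < n := by exact_mod_cast hn
  have hk0 : (0:ℝ) < k := by exact_mod_cast hk
  have hkn' : (k:ℝ) ≤ n := by exact_mod_cast hkn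
  rw [exp_phf lam hl n k hn hk, mul_assoc]
  have hpn : lam / n * n = lam := by field_simp
  set p := lam / n with hpd
  have hp0 : 0 < p := by positivity
  have h1 : 0 ≤ 1 - Real.exp (-(p*k)) := by
    have : Real.exp (-(p*k)) ≤ 1 := Real.exp_le_one_iff.2 (by have : 0 < p*k := by positivity
                                                              linarith)
    linarith
  have h2 := one_sub_pow_ge p (by linarith) k
  have h3 : (1-p)^(k.choose 2) ≤ Real.exp (-(p*k^2/2)) * Real.exp lam := by
    calc (1-p)^(k.choose 2) ≤ Real.exp (-p)^(k.choose 2) := pow_le_pow_left₀ (by linarith) (Real.one_sub_le_exp_neg p) _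
      _ ≤ _ := by
        rw [← Real.exp_nat_mul, ← Real.exp_add, Nat.cast_choose_two]
        apply Real.exp_le_exp.2
        nlinarith
  have h4 := fact_upper k hk
  have hr : 0 < 1 - p := by linarith
  unfold ee
  gcongr
  calc (1 - Real.exp (-(p*k)))^k * Real.exp (p*k^2/2) * (Real.exp k / (k:ℝ)^k) * (Real.exp (-lam) / (Real.exp 1 * k))
      = (1 - Real.exp (-(p*k)))^k / ((Real.exp (-(p*k^2/2)) * Real.exp lam) * ((Real.exp 1 * (k:ℝ)^(k+1)) / Real.exp k)) := by
        rw [Real.exp_neg (p*k^2/2), Real.exp_neg lam]; field_simp; ring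
    _ ≤ _ := by
        have h6 : 0 ≤ 1 - (1-p)^k := h1.trans h2
        gcongr
        rw [le_div_iff₀ (Real.exp_pos _)]; exact h4

lemma ee_upper (lam : ℝ) (hl : 0 < lam) (n k : ℕ) (hn : 0 < n) (hk : 0 < k) (hkn : k ≤ n) (hp : lam/n ≤ 1/2) :
    (n:ℝ)^k * ee (lam/n) k ≤ Real.exp (n * phf lam (k/n)) * Real.exp (lam + lam^2) := by
  have hn0 : (0:ℝ) < n := by exact_mod_cast hn
  have hk0 : (0:ℝ) < k := by exact_mod_cast hk
  have hkn' : (k:ℝ) ≤ n := by exact_mod_cast hkn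
  rw [exp_phf lam hl n k hn hk, mul_assoc]
  have hpn : lam / n * n = lam := by field_simp
  set p := lam / n with hpd
  have hp0 : 0 < p := by positivity
  have hpk : p * k ≤ lam := by rw [← hpn]; gcongr
  have hr : 0 < 1 - p := by linarith
  have hu : 0 ≤ p * k := by positivity
  have h0 := exp_le_one_sub' p hp0.le hp
  have h1 : 0 ≤ 1 - Real.exp (-(p*k)) := by
    have : Real.exp (-(p*k)) ≤ 1 := Real.exp_le_one_iff.2 (by linarith)
    linarith
  have h2 : 1 - (1-p)^k ≤ (1 + p) * (1 - Real.exp (-(p*k))) := by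
    have e1 : Real.exp (-(p*k)) * Real.exp (-(p*k*p)) ≤ (1-p)^k := by
      rw [← Real.exp_add]
      calc Real.exp (-(p*k) + -(p*k*p)) = Real.exp (-(p+p^2))^k := by rw [← Real.exp_nat_mul]; ring_nf
        _ ≤ _ := pow_le_pow_left₀ (Real.exp_pos _).le h0 _
    have e2 := Real.one_sub_le_exp_neg (p*k*p)
    have e3 : p*k * Real.exp (-(p*k)) ≤ 1 - Real.exp (-(p*k)) := by
      have := Real.add_one_le_exp (p*k)
      have e4 : Real.exp (p*k) * Real.exp (-(p*k)) = 1 := by rw [← Real.exp_add]; simp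
      have := mul_le_mul_of_nonneg_right this (Real.exp_pos (-(p*k))).le
      linarith
    have e5 := mul_le_mul_of_nonneg_left e2 (Real.exp_pos (-(p*k))).le
    have e6 := mul_le_mul_of_nonneg_left e3 hp0.le
    linarith
  have h2' : 0 ≤ 1 - (1-p)^k := by
    have : (1-p)^k ≤ 1 := pow_le_one₀ hr.le (by linarith)
    linarith
  have h3 : (1 - (1-p)^k)^k ≤ Real.exp lam * (1 - Real.exp (-(p*k)))^k := by
    calc (1 - (1-p)^k)^k ≤ ((1 + p) * (1 - Real.exp (-(p*k))))^k := pow_le_pow_left₀ h2' h2 _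
      _ = (1+p)^k * (1 - Real.exp (-(p*k)))^k := mul_pow _ _ _
      _ ≤ Real.exp p^k * (1 - Real.exp (-(p*k)))^k := by
          gcongr; linarith [Real.add_one_le_exp p]
      _ ≤ _ := by
          rw [← Real.exp_nat_mul]
          gcongr; linarith
  have h4 : Real.exp (-(p*k^2/2)) * Real.exp (-lam^2) ≤ (1-p)^(k.choose 2) := by
    calc Real.exp (-(p*k^2/2)) * Real.exp (-lam^2) ≤ Real.exp (-(p+p^2))^(k.choose 2) := by
          rw [← Real.exp_nat_mul, ← Real.exp_add, Nat.cast_choose_two]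
          apply Real.exp_le_exp.2
          have : (p*k)^2 ≤ lam^2 := by gcongr
          nlinarith [mul_pos hp0 hk0, mul_pos (mul_pos hp0 hp0) hk0]
      _ ≤ _ := pow_le_pow_left₀ (Real.exp_pos _).le h0 _
  have h5 := fact_lower k
  unfold ee
  gcongr
  calc (1 - (1-p)^k)^k / ((1-p)^(k.choose 2) * (k.factorial:ℝ))
      ≤ (Real.exp lam * (1 - Real.exp (-(p*k)))^k) / ((Real.exp (-(p*k^2/2)) * Real.exp (-lam^2)) * ((k:ℝ)^k / Real.exp k)) := by
        gcongr
        rw [div_le_iff₀ (Real.exp_pos _)]; exact h5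
    _ = _ := by
        rw [Real.exp_neg (p*k^2/2), Real.exp_neg (lam^2), Real.exp_add]
        field_simp

lemma ee_nonneg (p : ℝ) (h0 : 0 ≤ p) (h1 : p ≤ 1) (k : ℕ) : 0 ≤ ee p k := by
  unfold ee
  have hr : 0 ≤ 1 - p := by linarith
  have : 0 ≤ 1 - (1-p)^k := by
    have : (1-p)^k ≤ 1 := pow_le_one₀ hr (by linarith)
    linarith
  positivity

lemma ee_mul (p : ℝ) (h0 : 0 ≤ p) (h1 : p < 1) (k l : ℕ) : ee p k * ee p l ≤ ee p (k+l) := by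
  have hr : 0 < 1 - p := by linarith
  have hr1 : 1 - p ≤ 1 := by linarith
  set r := 1 - p with hrd
  have hk : 0 ≤ 1 - r^k := by have : r^k ≤ 1 := pow_le_one₀ hr.le hr1
                              linarith
  have hl : 0 ≤ 1 - r^l := by have : r^l ≤ 1 := pow_le_one₀ hr.le hr1
                              linarith
  have hb : (1-r^k)^k * (r^k * (1-r^l))^l * ((k+l).choose k : ℕ) ≤ (1 - r^(k+l))^(k+l) := by
    have e : 1 - r^(k+l) = (1-r^k) + r^k * (1-r^l) := by rw [pow_add]; ring
    rw [e, add_pow]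
    have := Finset.single_le_sum (f := fun m => (1-r^k)^m * (r^k * (1-r^l))^(k+l-m) * ((k+l).choose m : ℕ))
      (s := Finset.range (k+l+1)) (fun m _ => by positivity) (a := k) (by simp)
    simpa using this
  have hc : (k+l).choose 2 = k.choose 2 + l.choose 2 + k*l := by
    have h2 : (((k+l).choose 2 : ℕ):ℝ) = ((k.choose 2 + l.choose 2 + k*l : ℕ):ℝ) := by
      push_cast
      rw [Nat.cast_choose_two, Nat.cast_choose_two, Nat.cast_choose_two]
      push_cast; ring
    exact_mod_cast h2
  have hf : ((k+l).choose k : ℝ) * (k.factorial * l.factorial) = ((k+l).factorial:ℝ) := by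
    have h2 : (k+l).choose k * k.factorial * l.factorial = (k+l).factorial := by
      have := Nat.choose_mul_factorial_mul_factorial (show k ≤ k + l by omega)
      simpa using this
    have h3 : (((k+l).choose k * k.factorial * l.factorial : ℕ):ℝ) = ((k+l).factorial:ℝ) := by rw [h2]
    push_cast at h3
    linarith
  unfold ee
  rw [← hrd]
  rw [div_mul_div_comm, div_le_div_iff₀ (by positivity) (by positivity), hc, ← hf]
  calc (1-r^k)^k * (1-r^l)^l * (r^(k.choose 2 + l.choose 2 + k*l) * ((((k+l).choose k : ℕ):ℝ) * (k.factorial * l.factorial)))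
      = ((1-r^k)^k * (r^k * (1-r^l))^l * ((k+l).choose k : ℕ)) * (r^(k.choose 2) * k.factorial * (r^(l.choose 2) * l.factorial)) := by
        rw [pow_add, pow_add, mul_pow, pow_mul]; ring
    _ ≤ _ := by gcongr

lemma ee_list (p : ℝ) (h0 : 0 ≤ p) (h1 : p < 1) (l : List ℕ) : (l.map (ee p)).prod ≤ ee p l.sum := by
  induction l with
  | nil => simp [ee]
  | cons k l ih =>
    simp only [List.map_cons, List.prod_cons, List.sum_cons]
    have := ee_nonneg p h0 h1.le k
    exact (mul_le_mul_of_nonneg_left ih this).trans (ee_mul p h0 h1 k l.sum)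

lemma bb_lower (p q : ℝ) (h0 : 0 ≤ p) (h1 : p < 1) (hq : 0 < q) (k : ℕ) (hk : 0 < k) :
    q / k * ee p k ≤ bb p q k := by
  obtain ⟨m, rfl⟩ : ∃ m, k = m+1 := ⟨k-1, by omega⟩
  have hr : 0 < 1 - p := by linarith
  have hx1 : 1 - (1-p)^(m+1) ≤ 1 := by have : 0 < (1-p)^(m+1) := by positivity
                                       linarith
  have hx0 : 0 ≤ 1 - (1-p)^(m+1) := by have : (1-p)^(m+1) ≤ 1 := pow_le_one₀ hr.le (by linarith)
                                       linarith
  have h2 := cc_lower p h0 h1.le m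
  unfold ee bb
  simp only [Nat.add_sub_cancel]
  have h3 : (1 - (1-p)^(m+1))^(m+1) ≤ ((m+1:ℕ):ℝ) * cc p m := by
    push_cast
    refine le_trans ?_ h2
    exact pow_le_pow_of_le_one hx0 hx1 (by omega)
  have hm : (0:ℝ) < ((m+1:ℕ):ℝ) := by positivity
  calc q / ((m+1:ℕ):ℝ) * ((1 - (1-p)^(m+1))^(m+1) / ((1-p)^((m+1).choose 2) * ((m+1).factorial:ℝ)))
      ≤ q / ((m+1:ℕ):ℝ) * ((((m+1:ℕ):ℝ) * cc p m) / ((1-p)^((m+1).choose 2) * ((m+1).factorial:ℝ))) := by gcongr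
    _ = _ := by field_simp

lemma bb_upper (p q d : ℝ) (h0 : 0 ≤ p) (h1 : p < 1) (hq : 0 < q) (hd : 0 < d) (k : ℕ) (hk : 0 < k) (hdk : d ≤ p * k) :
    bb p q k ≤ q / (1 - Real.exp (-d)) * ee p k := by
  have hx := one_sub_pow_ge p h1.le k
  have hd1 : 0 < 1 - Real.exp (-d) := by
    have : Real.exp (-d) < 1 := exp_lt_one_of_neg_arg _ (by linarith)
    linarith
  have hd2 : 1 - Real.exp (-d) ≤ 1 - Real.exp (-(p*k)) := by gcongr
  obtain ⟨m, rfl⟩ : ∃ m, k = m+1 := ⟨k-1, by omega⟩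
  have hr : 0 < 1 - p := by linarith
  have h2 := cc_upper p h0 h1.le m
  unfold ee bb
  simp only [Nat.add_sub_cancel]
  set x := 1 - (1-p)^(m+1) with hxd
  have h3 : cc p m ≤ x^(m+1) / (1 - Real.exp (-d)) := by
    rw [le_div_iff₀ hd1, pow_succ]
    have : 0 ≤ x := by linarith
    exact mul_le_mul h2 (hd2.trans hx) hd1.le (by positivity)
  calc q * (cc p m / ((1-p)^((m+1).choose 2) * ((m+1).factorial:ℝ)))
      ≤ q * ((x^(m+1) / (1 - Real.exp (-d))) / ((1-p)^((m+1).choose 2) * ((m+1).factorial:ℝ))) := by gcongr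
    _ = _ := by ring

lemma phf_cont (lam : ℝ) (hl : 0 < lam) : ContinuousOn (phf lam) (Ioi 0) := by
  unfold phf
  have h1 : ContinuousOn (fun α : ℝ => Real.log (1 - Real.exp (-(lam*α)))) (Ioi 0) := by
    apply ContinuousOn.log (by fun_prop)
    intro x hx
    have : Real.exp (-(lam*x)) < 1 := exp_lt_one_of_neg_arg _ (neg_lt_zero.2 (mul_pos hl hx))
    linarith
  have h2 : ContinuousOn (fun α : ℝ => Real.log α) (Ioi 0) :=
    ContinuousOn.log (by fun_prop) (fun x hx => (ne_of_gt hx))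
  exact (((continuousOn_id.mul h1).add (by fun_prop)).sub (continuousOn_id.mul h2)).add continuousOn_id

lemma list_prod_le (f g : ℕ → ℝ) (C : ℝ) (l : List ℕ) (h : ∀ k ∈ l, 0 ≤ f k ∧ 0 ≤ g k ∧ f k ≤ C * g k) (hC : 0 ≤ C) :
    (l.map f).prod ≤ C^l.length * (l.map g).prod := by
  have key : 0 ≤ (l.map f).prod ∧ (l.map f).prod ≤ C^l.length * (l.map g).prod := by
    induction l with
    | nil => simp
    | cons k l ih =>
      simp only [List.map_cons, List.prod_cons, List.length_cons]
      obtain ⟨i1, i2⟩ := ih (fun x hx => h x (List.mem_cons_of_mem _ hx))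
      obtain ⟨h1, h2, h3⟩ := h k List.mem_cons_self
      refine ⟨mul_nonneg h1 i1, ?_⟩
      calc f k * (l.map f).prod ≤ (C * g k) * (C^l.length * (l.map g).prod) := mul_le_mul h3 i2 i1 (mul_nonneg hC h2)
        _ = _ := by ring
  exact key.2

lemma list_len_bound (x : ℝ) (l : List ℕ) (h : ∀ k ∈ l, x ≤ (k:ℝ)) : (l.length : ℝ) * x ≤ ((l.sum : ℕ):ℝ) := by
  induction l with
  | nil => simp
  | cons k l ih =>
    have i := ih (fun x hx => h x (List.mem_cons_of_mem _ hx))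
    have j := h k List.mem_cons_self
    simp only [List.length_cons, List.sum_cons]
    push_cast at i ⊢
    linarith

lemma big_lower (lam q ρ : ℝ) (n m : ℕ) (hl : 0 < lam) (hq : 0 < q) (hp : lam/n ≤ 1/2) (hn : 0 < n)
    (hm0 : 0 < m) (hmn : m ≤ n) (hm : ρ < m) :
    Real.exp (n * phf lam (m/n)) * (q * Real.exp (-lam) / (Real.exp 1 * n^2)) ≤ (n:ℝ)^m * expC (bG (lam/n) q ρ) m := by
  have hn0 : (0:ℝ) < n := by exact_mod_cast hn
  have hm0' : (0:ℝ) < m := by exact_mod_cast hm0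
  have hmn' : (m:ℝ) ≤ n := by exact_mod_cast hmn
  have hp0 : 0 < lam / n := by positivity
  have h1 := expC_step (bG (lam/n) q ρ) (bG_nonneg _ q ρ hp0.le (by linarith) hq) m 0 hm0
  rw [expC_zero, mul_one, zero_add] at h1
  have h2 := le_of_mul_le_mul_left h1 hm0'
  have h3 : bG (lam/n) q ρ m = bb (lam/n) q m := by unfold bG; rw [if_neg (by linarith)]
  rw [h3] at h2
  have h4 := bb_lower (lam/n) q hp0.le (by linarith) hq m hm0
  have h5 := ee_lower lam hl n m hn hm0 hmn hp
  calc Real.exp (n * phf lam (m/n)) * (q * Real.exp (-lam) / (Real.exp 1 * n^2))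
      ≤ Real.exp (n * phf lam (m/n)) * (q * Real.exp (-lam) / (Real.exp 1 * m^2)) := by gcongr
    _ = q / m * (Real.exp (n * phf lam (m/n)) * (Real.exp (-lam) / (Real.exp 1 * m))) := by field_simp
    _ ≤ q / m * ((n:ℝ)^m * ee (lam/n) m) := by gcongr
    _ = (n:ℝ)^m * (q / m * ee (lam/n) m) := by ring
    _ ≤ _ := by gcongr; exact h4.trans h2

lemma big_upper (lam q ε : ℝ) (n m J : ℕ) (hl : 0 < lam) (hq : 0 < q) (hp : lam/n ≤ 1/2) (hn : 0 < n)
    (hm0 : 0 < m) (hmn : m ≤ n) (hε : 0 < ε) (hm : ε * n < m) (hJ : 1/ε ≤ J) :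
    (n:ℝ)^m * expC (bG (lam/n) q (ε*n)) m ≤
      (n * max 1 (q / (1 - Real.exp (-(lam*ε)))))^J * (Real.exp (n * phf lam (m/n)) * Real.exp (lam + lam^2)) := by
  have hn0 : (0:ℝ) < n := by exact_mod_cast hn
  have hn1 : (1:ℝ) ≤ n := by exact_mod_cast hn
  have hmn' : (m:ℝ) ≤ n := by exact_mod_cast hmn
  have hp0 : 0 < lam / n := by positivity
  have hb := bG_nonneg (lam/n) q (ε*n) hp0.le (by linarith) hq
  have hpos : 0 < expC (bG (lam/n) q (ε*n)) m := by
    have h1 := big_lower lam q (ε*n) n m hl hq hp hn hm0 hmn hm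
    have h2 := lt_of_lt_of_le (by positivity) h1
    exact pos_of_mul_pos_right h2 (by positivity)
  obtain ⟨l, hl1, hl2, hl3⟩ := expC_list_upper (bG (lam/n) q (ε*n)) hb n m hn hmn hpos
  have hlε : ∀ k ∈ l, ε * n < (k:ℝ) ∧ bG (lam/n) q (ε*n) k = bb (lam/n) q k := by
    intro k hk
    have h1 := (hl1 k hk).2
    unfold bG at h1 ⊢
    split_ifs at h1 ⊢ with h2
    · exact absurd h1 (lt_irrefl _)
    · exact ⟨not_le.1 h2, rfl⟩
  have hlen : l.length ≤ J := by
    have h1 := list_len_bound (ε*n) l (fun k hk => (hlε k hk).1.le)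
    rw [hl2] at h1
    have h2 : (l.length:ℝ) * ε * n ≤ 1 * n := by linarith
    have h3 := le_of_mul_le_mul_right h2 hn0
    rw [← le_div_iff₀ hε] at h3
    exact_mod_cast h3.trans hJ
  set D := max 1 (q / (1 - Real.exp (-(lam*ε)))) with hD
  have hD1 : 1 ≤ D := le_max_left _ _
  have hprod : (l.map (bG (lam/n) q (ε*n))).prod ≤ D^l.length * (l.map (ee (lam/n))).prod := by
    apply list_prod_le
    · intro k hk
      have he := ee_nonneg (lam/n) hp0.le (by linarith) k
      refine ⟨hb k, he, ?_⟩
      rw [(hlε k hk).2]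
      have h1 := bb_upper (lam/n) q (lam*ε) hp0.le (by linarith) hq (by positivity) k (hl1 k hk).1 (by
        have := (hlε k hk).1
        calc lam*ε = lam/n*(ε*n) := by field_simp
          _ ≤ _ := by gcongr)
      refine h1.trans ?_
      gcongr
      exact le_max_right _ _
    · linarith
  have he := ee_list (lam/n) hp0.le (by linarith) l
  rw [hl2] at he
  have hu := ee_upper lam hl n m hn hm0 hmn hp
  have heN := ee_nonneg (lam/n) hp0.le (by linarith) m
  have hnD : 1 ≤ n * D := one_le_mul_of_one_le_of_one_le hn1 hD1
  calc (n:ℝ)^m * expC (bG (lam/n) q (ε*n)) m ≤ (n:ℝ)^m * (n^l.length * (D^l.length * ee (lam/n) m)) := by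
        gcongr
        refine hl3.trans ?_
        gcongr
        refine hprod.trans ?_
        gcongr
    _ = (n*D)^l.length * ((n:ℝ)^m * ee (lam/n) m) := by rw [mul_pow]; ring
    _ ≤ (n*D)^J * (Real.exp (n * phf lam (m/n)) * Real.exp (lam + lam^2)) := by
        gcongr

lemma floor_div_tendsto (θ : ℝ) (hθ : 0 ≤ θ) : Tendsto (fun n : ℕ => (⌊θ*(n:ℝ)⌋₊ : ℝ)/n) atTop (𝓝 θ) :=
  (tendsto_nat_floor_mul_div_atTop hθ).comp (tendsto_natCast_atTop_atTop (R := ℝ))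

lemma big_lim (lam q ε θ : ℝ) (hl : 0 < lam) (hq : 0 < q) (hε : 0 < ε) (hθ : ε < θ) (hθ1 : θ ≤ 1) :
    (∀ᶠ n : ℕ in atTop, 0 < expC (bG (lam/n) q (ε*n)) ⌊θ*(n:ℝ)⌋₊) ∧
    Tendsto (fun n : ℕ => 1/(n:ℝ) * Real.log ((n:ℝ)^⌊θ*(n:ℝ)⌋₊ * expC (bG (lam/n) q (ε*n)) ⌊θ*(n:ℝ)⌋₊)) atTop
      (𝓝 (phf lam θ)) := by
  have hθ0 : 0 < θ := hε.trans hθ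
  have hpt : Tendsto (fun n : ℕ => lam / (n:ℝ)) atTop (𝓝 0) := tendsto_const_div_atTop_nhds_zero_nat lam
  have hfl := floor_div_tendsto θ hθ0.le
  have hev : ∀ᶠ n : ℕ in atTop, 0 < n ∧ lam/n ≤ 1/2 ∧ 0 < ⌊θ*(n:ℝ)⌋₊ ∧ ⌊θ*(n:ℝ)⌋₊ ≤ n ∧ ε * n < (⌊θ*(n:ℝ)⌋₊:ℝ) := by
    filter_upwards [eventually_gt_atTop 0, hpt.eventually (ge_mem_nhds (show (0:ℝ) < 1/2 by norm_num)),
      hfl.eventually (lt_mem_nhds hθ)] with n h1 h2 h3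
    have hn0 : (0:ℝ) < n := by exact_mod_cast h1
    rw [lt_div_iff₀ hn0] at h3
    refine ⟨h1, h2, ?_, ?_, h3⟩
    · have : (0:ℝ) < (⌊θ*(n:ℝ)⌋₊:ℝ) := lt_trans (by positivity) h3
      exact_mod_cast this
    · apply Nat.floor_le_of_le
      exact mul_le_of_le_one_left hn0.le hθ1
  constructor
  · filter_upwards [hev] with n ⟨h1, h2, h3, h4, h5⟩
    have hn0 : (0:ℝ) < n := by exact_mod_cast h1
    have h6 := lt_of_lt_of_le (by positivity) (big_lower lam q (ε*n) n _ hl hq h2 h1 h3 h4 h5)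
    exact pos_of_mul_pos_right h6 (by positivity)
  obtain ⟨J, hJ⟩ := exists_nat_ge (1/ε)
  set D := max 1 (q / (1 - Real.exp (-(lam*ε)))) with hD
  have hD1 : 1 ≤ D := le_max_left _ _
  have hphi : Tendsto (fun n : ℕ => phf lam ((⌊θ*(n:ℝ)⌋₊ : ℝ)/n)) atTop (𝓝 (phf lam θ)) :=
    ((phf_cont lam hl).continuousAt (Ioi_mem_nhds hθ0)).tendsto.comp hfl
  have hlow : Tendsto (fun n : ℕ => phf lam ((⌊θ*(n:ℝ)⌋₊ : ℝ)/n) + (Real.log q - lam - 1)/n - 2 * (Real.log n/n))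
      atTop (𝓝 (phf lam θ + 0 - 2*0)) :=
    (hphi.add (tendsto_const_div_atTop_nhds_zero_nat _)).sub (log_div_tendsto.const_mul _)
  have hup : Tendsto (fun n : ℕ => phf lam ((⌊θ*(n:ℝ)⌋₊ : ℝ)/n) + (lam+lam^2 + J * Real.log D)/n + J * (Real.log n/n))
      atTop (𝓝 (phf lam θ + 0 + J*0)) :=
    (hphi.add (tendsto_const_div_atTop_nhds_zero_nat _)).add (log_div_tendsto.const_mul _)
  simp only [mul_zero, add_zero, sub_zero] at hlow hup
  refine tendsto_of_tendsto_of_tendsto_of_le_of_le' hlow hup ?_ ?_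
  · filter_upwards [hev] with n ⟨h1, h2, h3, h4, h5⟩
    have hn0 : (0:ℝ) < n := by exact_mod_cast h1
    have h6 := Real.log_le_log (by positivity) (big_lower lam q (ε*n) n _ hl hq h2 h1 h3 h4 h5)
    rw [Real.log_mul (x := Real.exp _) (by positivity) (by positivity), Real.log_exp, Real.log_div (by positivity) (by positivity), Real.log_mul (x := q) (by positivity) (by positivity),
      Real.log_exp, Real.log_mul (x := Real.exp _) (by positivity) (by positivity), Real.log_exp, Real.log_pow] at h6
    rw [one_div, inv_mul_eq_div, le_div_iff₀ hn0]
    refine le_trans (le_of_eq ?_) h6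
    push_cast
    field_simp
    ring
  · filter_upwards [hev] with n ⟨h1, h2, h3, h4, h5⟩
    have hn0 : (0:ℝ) < n := by exact_mod_cast h1
    have h7 := lt_of_lt_of_le (by positivity) (big_lower lam q (ε*n) n _ hl hq h2 h1 h3 h4 h5)
    have h6 := Real.log_le_log h7 (big_upper lam q ε n _ J hl hq h2 h1 h3 h4 hε h5 hJ)
    rw [← hD, Real.log_mul (x := _ ^ J) (by positivity) (by positivity), Real.log_mul (x := Real.exp _) (by positivity) (by positivity),
      Real.log_exp, Real.log_exp, Real.log_pow, Real.log_mul (x := (n:ℝ)) (by positivity) (by positivity)] at h6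
    rw [one_div, inv_mul_eq_div, div_le_iff₀ hn0]
    refine h6.trans (le_of_eq ?_)
    field_simp
    ring

lemma single_low (lam q ε α η : ℝ) (hl : 0 < lam) (hq : 0 < q) (hα : 0 < α) (hα1 : α ≤ 1) (hαε : α ≤ ε) (hη : 0 < η) :
    ∀ᶠ n : ℕ in atTop, 1 ≤ ⌊α*(n:ℝ)⌋₊ ∧
      Real.exp (n * (phf lam α - η)) * n ≤ (n:ℝ)^⌊α*(n:ℝ)⌋₊ * bL (lam/n) q (ε*n) ⌊α*(n:ℝ)⌋₊ := by
  have hpt : Tendsto (fun n : ℕ => lam / (n:ℝ)) atTop (𝓝 0) := tendsto_const_div_atTop_nhds_zero_nat lam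
  have hfl := floor_div_tendsto α hα.le
  have hphi : Tendsto (fun n : ℕ => phf lam ((⌊α*(n:ℝ)⌋₊ : ℝ)/n)) atTop (𝓝 (phf lam α)) :=
    ((phf_cont lam hl).continuousAt (Ioi_mem_nhds hα)).tendsto.comp hfl
  have hlow : Tendsto (fun n : ℕ => phf lam ((⌊α*(n:ℝ)⌋₊ : ℝ)/n) + (Real.log q - lam - 1)/n - 3 * (Real.log n/n))
      atTop (𝓝 (phf lam α + 0 - 3*0)) :=
    (hphi.add (tendsto_const_div_atTop_nhds_zero_nat _)).sub (log_div_tendsto.const_mul _)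
  simp only [mul_zero, add_zero, sub_zero] at hlow
  filter_upwards [eventually_gt_atTop 0, hpt.eventually (ge_mem_nhds (show (0:ℝ) < 1/2 by norm_num)),
      hfl.eventually (lt_mem_nhds hα), hlow.eventually (lt_mem_nhds (show phf lam α - η < phf lam α by linarith))] with n h1 h2 h3 h4
  have hn0 : (0:ℝ) < n := by exact_mod_cast h1
  have hk0 : 0 < ⌊α*(n:ℝ)⌋₊ := by
    have := (div_pos_iff_of_pos_right hn0).1 h3
    exact_mod_cast this
  have hkα : (⌊α*(n:ℝ)⌋₊:ℝ) ≤ α * n := Nat.floor_le (by positivity)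
  have hkn : ⌊α*(n:ℝ)⌋₊ ≤ n := Nat.floor_le_of_le (mul_le_of_le_one_left hn0.le hα1)
  set k := ⌊α*(n:ℝ)⌋₊ with hk
  refine ⟨hk0, ?_⟩
  have hkn' : (k:ℝ) ≤ n := by exact_mod_cast hkn
  have hk0' : (0:ℝ) < k := by exact_mod_cast hk0
  have hp0 : 0 < lam/n := by positivity
  have hbL : bL (lam/n) q (ε*n) k = bb (lam/n) q k := by
    unfold bL; rw [if_pos (hkα.trans (by gcongr))]
  rw [hbL]
  have g1 := bb_lower (lam/n) q hp0.le (by linarith) hq k hk0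
  have g2 := ee_lower lam hl n k h1 hk0 hkn h2
  have g3 : Real.exp (n * phf lam (k/n)) * (q * Real.exp (-lam) / (Real.exp 1 * n^2)) ≤ (n:ℝ)^k * bb (lam/n) q k := by
    calc Real.exp (n * phf lam (k/n)) * (q * Real.exp (-lam) / (Real.exp 1 * n^2))
      ≤ Real.exp (n * phf lam (k/n)) * (q * Real.exp (-lam) / (Real.exp 1 * k^2)) := by gcongr
    _ = q / k * (Real.exp (n * phf lam (k/n)) * (Real.exp (-lam) / (Real.exp 1 * k))) := by field_simp
    _ ≤ q / k * ((n:ℝ)^k * ee (lam/n) k) := by gcongr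
    _ = (n:ℝ)^k * (q / k * ee (lam/n) k) := by ring
    _ ≤ _ := by gcongr
  refine le_trans ?_ g3
  rw [← Real.exp_log (x := Real.exp (n * phf lam (k/n)) * (q * Real.exp (-lam) / (Real.exp 1 * n^2))) (by positivity)]
  have e : Real.exp (n * (phf lam α - η)) * n = Real.exp (n * (phf lam α - η) + Real.log n) := by
    rw [Real.exp_add, Real.exp_log hn0]
  rw [e]
  apply Real.exp_le_exp.2
  rw [Real.log_mul (x := Real.exp _) (by positivity) (by positivity), Real.log_exp, Real.log_div (by positivity) (by positivity), Real.log_mul (x := q) (by positivity) (by positivity),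
      Real.log_exp, Real.log_mul (x := Real.exp _) (by positivity) (by positivity), Real.log_exp, Real.log_pow]
  have h5 := mul_le_mul_of_nonneg_left h4.le hn0.le
  have h6 : (n:ℝ) * (phf lam (k/n) + (Real.log q - lam - 1)/n - 3 * (Real.log n/n)) =
      n * phf lam (k/n) + (Real.log q - lam - 1) - 3 * Real.log n := by
    field_simp
  rw [h6] at h5
  push_cast
  linarith

lemma list_low (lam q ε : ℝ) (hl : 0 < lam) (hq : 0 < q) (αs : List ℝ)
    (hα : ∀ α ∈ αs, 0 < α ∧ α ≤ 1 ∧ α ≤ ε) : ∀ η : ℝ, 0 < η →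
    ∀ᶠ n : ℕ in atTop, (∀ k ∈ αs.map (fun α => ⌊α*(n:ℝ)⌋₊), 1 ≤ k) ∧
      Real.exp (n * ((αs.map (phf lam)).sum - η)) * (n:ℝ)^αs.length ≤
        (n:ℝ)^(αs.map (fun α => ⌊α*(n:ℝ)⌋₊)).sum *
          ((αs.map (fun α => ⌊α*(n:ℝ)⌋₊)).map (bL (lam/n) q (ε*n))).prod := by
  induction αs with
  | nil =>
    intro η hη
    filter_upwards with n
    refine ⟨by simp, ?_⟩
    simp
    positivity
  | cons α αs ih =>
    intro η hη
    obtain ⟨a1, a2, a3⟩ := hα α List.mem_cons_self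
    have ih' := ih (fun x hx => hα x (List.mem_cons_of_mem _ hx)) (η/2) (by linarith)
    have h1 := single_low lam q ε α (η/2) hl hq a1 a2 a3 (by linarith)
    filter_upwards [ih', h1] with n ⟨i1, i2⟩ ⟨j1, j2⟩
    simp only [List.map_cons, List.sum_cons, List.prod_cons, List.length_cons, List.mem_cons]
    refine ⟨?_, ?_⟩
    · rintro k (rfl | hk)
      · exact j1
      · exact i1 k hk
    · have e : (n:ℝ) * (phf lam α + (αs.map (phf lam)).sum - η) = n * (phf lam α - η/2) + n * ((αs.map (phf lam)).sum - η/2) := by ring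
      rw [e, Real.exp_add]
      simp only [pow_add, pow_one]
      have := mul_le_mul j2 i2 (by positivity) (le_trans (by positivity) j2)
      linarith

lemma floor_sum (αs : List ℝ) (hα : ∀ α ∈ αs, 0 < α) (n : ℕ) :
    (((αs.map (fun α => ⌊α*(n:ℝ)⌋₊)).sum : ℕ):ℝ) ≤ αs.sum * n ∧
    αs.sum * n - αs.length ≤ (((αs.map (fun α => ⌊α*(n:ℝ)⌋₊)).sum : ℕ):ℝ) := by
  induction αs with
  | nil => simp
  | cons α αs ih =>
    obtain ⟨i1, i2⟩ := ih (fun x hx => hα x (List.mem_cons_of_mem _ hx))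
    have a := hα α List.mem_cons_self
    have h1 : (⌊α*(n:ℝ)⌋₊:ℝ) ≤ α * n := Nat.floor_le (by positivity)
    have h2 := Nat.lt_floor_add_one (α*(n:ℝ))
    simp only [List.map_cons, List.sum_cons, List.length_cons]
    push_cast at i1 i2 ⊢
    constructor <;> linarith

lemma K_low (lam q ε s0 : ℝ) (hl : 0 < lam) (hq : 0 < q) (hε : 0 < ε) (αs : List ℝ)
    (hα : ∀ α ∈ αs, 0 < α ∧ α ≤ 1 ∧ α ≤ ε) (hs : 0 < s0 - αs.sum) (η : ℝ) (hη : 0 < η) :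
    ∀ᶠ n : ℕ in atTop, ∀ N : ℕ, N ≤ n → s0 * n ≤ N → (N:ℝ) ≤ s0 * n + 1 →
      Real.exp (n * ((αs.map (phf lam)).sum + gam lam q (s0 - αs.sum) - η)) ≤
        (n:ℝ)^N * expC (bL (lam/n) q (ε*n)) N := by
  have hpt : Tendsto (fun n : ℕ => lam / (n:ℝ)) atTop (𝓝 0) := tendsto_const_div_atTop_nhds_zero_nat lam
  filter_upwards [list_low lam q ε hl hq αs hα (η/2) (by linarith),
    lower_main lam q (s0 - αs.sum) ε (1+αs.length) (η/2) hl hq hs hε (by linarith) (by positivity),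
    eventually_gt_atTop 0, hpt.eventually (ge_mem_nhds (show (0:ℝ) < 1/2 by norm_num))] with n ⟨h1, h2⟩ h3 h4 h5 N hNn hN1 hN2
  have hn0 : (0:ℝ) < n := by exact_mod_cast h4
  have hp0 : 0 < lam/n := by positivity
  obtain ⟨f1, f2⟩ := floor_sum αs (fun α h => (hα α h).1) n
  set l := αs.map (fun α => ⌊α*(n:ℝ)⌋₊) with hld
  have hlen : l.length = αs.length := by rw [hld]; simp
  have hlN : l.sum ≤ N := by
    have : ((l.sum : ℕ):ℝ) ≤ N := by nlinarith
    exact_mod_cast this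
  have hcast : (((N - l.sum : ℕ)):ℝ) = N - (l.sum:ℕ) := by rw [Nat.cast_sub hlN]
  have h6 := h3 (N - l.sum) (by rw [hcast]; linarith) (by rw [hcast]; linarith)
  have h7 := expC_list_lower (bL (lam/n) q (ε*n)) (bL_nonneg _ q _ hp0.le (by linarith) hq) n l h1 (N - l.sum) (by omega)
  rw [Nat.sub_add_cancel hlN, hlen] at h7
  have e : (n:ℝ) * ((αs.map (phf lam)).sum + gam lam q (s0 - αs.sum) - η) =
    n * ((αs.map (phf lam)).sum - η/2) + n * (gam lam q (s0 - αs.sum) - η/2) := by ring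
  rw [e, Real.exp_add]
  have h8 := mul_le_mul h2 h6 (by positivity) (le_trans (by positivity) h2)
  have hpow : (n:ℝ)^N = n^l.sum * n^(N - l.sum) := by rw [← pow_add, Nat.add_sub_cancel' hlN]
  have hnl : (0:ℝ) < (n:ℝ)^αs.length := by positivity
  refine le_of_mul_le_mul_right ?_ hnl
  calc Real.exp (n * ((αs.map (phf lam)).sum - η/2)) * Real.exp (n * (gam lam q (s0 - αs.sum) - η/2)) * (n:ℝ)^αs.length
      = Real.exp (n * ((αs.map (phf lam)).sum - η/2)) * (n:ℝ)^αs.length * Real.exp (n * (gam lam q (s0 - αs.sum) - η/2)) := by ring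
    _ ≤ _ := h8
    _ = (n:ℝ)^N * ((l.map (bL (lam/n) q (ε*n))).prod * expC (bL (lam/n) q (ε*n)) (N - l.sum)) := by rw [hpow]; ring
    _ ≤ (n:ℝ)^N * (n^αs.length * expC (bL (lam/n) q (ε*n)) N) := by gcongr
    _ = _ := by ring

lemma list_prod_phf (lam : ℝ) (hl : 0 < lam) (n : ℕ) (hn : 0 < n) (hp : lam/n ≤ 1/2) (l : List ℕ) (h : ∀ k ∈ l, 0 < k ∧ k ≤ n) :
    (n:ℝ)^l.sum * (l.map (ee (lam/n))).prod ≤ Real.exp (lam+lam^2)^l.length * Real.exp (n * (l.map (fun k : ℕ => phf lam ((k:ℝ)/n))).sum) := by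
  induction l with
  | nil => simp
  | cons k l ih =>
    have i := ih (fun x hx => h x (List.mem_cons_of_mem _ hx))
    obtain ⟨h1, h2⟩ := h k List.mem_cons_self
    have hp0 : 0 < lam/n := by have : (0:ℝ) < n := by exact_mod_cast hn
                               positivity
    have hu := ee_upper lam hl n k hn h1 h2 hp
    have hee := ee_nonneg (lam/n) hp0.le (by linarith) k
    have hpp : 0 ≤ (l.map (ee (lam/n))).prod := by
      apply List.prod_nonneg
      intro x hx
      obtain ⟨k, _, rfl⟩ := List.mem_map.1 hx
      exact ee_nonneg (lam/n) hp0.le (by linarith) k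
    simp only [List.map_cons, List.sum_cons, List.prod_cons, List.length_cons]
    rw [mul_add, Real.exp_add (n * phf lam (k/n))]
    simp only [pow_add, pow_one]
    have := mul_le_mul hu i (by positivity) (by positivity)
    linarith

lemma K_up (lam q ε δ : ℝ) (n N J : ℕ) (hl : 0 < lam) (hq : 0 < q) (hp : lam/n ≤ 1/2) (hn : 0 < n)
    (hNn : N ≤ n) (hδ : 0 < δ) (hδε : δ ≤ ε) (hJ : 1/δ ≤ J)
    (hpos : 0 < expC (bL (lam/n) q (ε*n)) N) :
    ∃ l : List ℕ, (∀ k ∈ l, δ * n < k ∧ (k:ℝ) ≤ ε * n) ∧ l.sum ≤ N ∧ l.length ≤ J ∧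
      (n:ℝ)^N * expC (bL (lam/n) q (ε*n)) N ≤
        (n+1) * (n * (max 1 (q / (1 - Real.exp (-(lam*δ)))) * Real.exp (lam+lam^2)))^J *
        Real.exp (n * ((l.map (fun k : ℕ => phf lam ((k:ℝ)/n))).sum + gam lam q (((N - l.sum : ℕ):ℝ)/n) + lam * δ)) := by
  have hn0 : (0:ℝ) < n := by exact_mod_cast hn
  have hn1 : (1:ℝ) ≤ n := by exact_mod_cast hn
  have hNn' : (N:ℝ) ≤ n := by exact_mod_cast hNn
  have hp0 : 0 < lam / n := by positivity
  set p := lam/n with hpd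
  set bM : ℕ → ℝ := fun k => if δ*n < (k:ℝ) ∧ (k:ℝ) ≤ ε*n then bb p q k else 0 with hbM
  have hbM0 : ∀ k, 0 ≤ bM k := by
    intro k; simp only [hbM]; split_ifs
    · exact bb_nonneg p q hp0.le (by linarith) hq k
    · exact le_rfl
  have hδεn : δ * n ≤ ε * n := by gcongr
  have hsplit : bL p q (ε*n) = fun k => bL p q (δ*n) k + bM k := by
    funext k
    simp only [bL, hbM]
    by_cases h1 : (k:ℝ) ≤ δ*n
    · rw [if_pos (h1.trans hδεn), if_pos h1, if_neg (by intro h; linarith [h.1])]; ring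
    · by_cases h2 : (k:ℝ) ≤ ε*n
      · rw [if_pos h2, if_neg h1, if_pos ⟨not_le.1 h1, h2⟩]; ring
      · rw [if_neg h2, if_neg h1, if_neg (by intro h; exact h2 h.2)]; ring
  have hb0 := bL_nonneg p q (δ*n) hp0.le (by linarith) hq
  have hadd : expC (bL p q (ε*n)) N = ∑ i ∈ Finset.range (N+1), expC (bL p q (δ*n)) i * expC bM (N-i) := by
    rw [hsplit, expC_add]
  obtain ⟨i, hi, himax⟩ := Finset.exists_max_image (Finset.range (N+1)) (fun i => expC (bL p q (δ*n)) i * expC bM (N-i)) ⟨0, by simp⟩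
  have hsum : expC (bL p q (ε*n)) N ≤ (n+1) * (expC (bL p q (δ*n)) i * expC bM (N-i)) := by
    rw [hadd]
    refine (Finset.sum_le_card_nsmul _ _ _ himax).trans ?_
    rw [nsmul_eq_mul, Finset.card_range]
    have := expC_nonneg _ hb0 i
    have := expC_nonneg _ hbM0 (N-i)
    push_cast
    gcongr
  have hiN : i ≤ N := by have := Finset.mem_range.1 hi; omega
  have hposM : 0 < expC bM (N-i) := by
    rcases (expC_nonneg _ hbM0 (N-i)).lt_or_eq with h | h
    · exact h
    · rw [← h, mul_zero, mul_zero] at hsum; linarith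
  obtain ⟨l, hl1, hl2, hl3⟩ := expC_list_upper bM hbM0 n (N-i) hn (by omega) hposM
  have hlε : ∀ k ∈ l, (δ * n < (k:ℝ) ∧ (k:ℝ) ≤ ε*n) ∧ bM k = bb p q k := by
    intro k hk
    have h1 := (hl1 k hk).2
    simp only [hbM] at h1 ⊢
    split_ifs at h1 ⊢ with h2
    · exact ⟨h2, rfl⟩
    · exact absurd h1 (lt_irrefl _)
  have hlen : l.length ≤ J := by
    have h1 := list_len_bound (δ*n) l (fun k hk => (hlε k hk).1.1.le)
    rw [hl2] at h1
    have h0 : ((N - i : ℕ):ℝ) ≤ n := by exact_mod_cast (by omega)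
    have h2 : (l.length:ℝ) * δ * n ≤ 1 * n := by linarith
    have h3 := le_of_mul_le_mul_right h2 hn0
    rw [← le_div_iff₀ hδ] at h3
    exact_mod_cast h3.trans hJ
  refine ⟨l, fun k hk => (hlε k hk).1, by omega, hlen, ?_⟩
  set D := max 1 (q / (1 - Real.exp (-(lam*δ)))) with hD
  have hD1 : 1 ≤ D := le_max_left _ _
  have hprod : (l.map bM).prod ≤ D^l.length * (l.map (ee p)).prod := by
    apply list_prod_le
    · intro k hk
      have he := ee_nonneg p hp0.le (by linarith) k
      refine ⟨hbM0 k, he, ?_⟩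
      rw [(hlε k hk).2]
      have h1 := bb_upper p q (lam*δ) hp0.le (by linarith) hq (by positivity) k (hl1 k hk).1 (by
        have := (hlε k hk).1.1
        calc lam*δ = lam/n*(δ*n) := by field_simp
          _ ≤ _ := by rw [hpd]; gcongr)
      refine h1.trans ?_
      gcongr
      exact le_max_right _ _
    · linarith
  have hkn : ∀ k ∈ l, 0 < k ∧ k ≤ n := by
    intro k hk
    refine ⟨(hl1 k hk).1, ?_⟩
    have := List.single_le_sum (fun x _ => Nat.zero_le x) k hk
    omega
  have hphi := list_prod_phf lam hl n hn hp l hkn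
  have hE1 : 1 ≤ Real.exp (lam+lam^2) := Real.one_le_exp (by positivity)
  have hupM : (n:ℝ)^l.sum * expC bM (N-i) ≤ (n * (D * Real.exp (lam+lam^2)))^J * Real.exp (n * (l.map (fun k : ℕ => phf lam ((k:ℝ)/n))).sum) := by
    calc (n:ℝ)^l.sum * expC bM (N-i) ≤ (n:ℝ)^l.sum * (n^l.length * (D^l.length * (l.map (ee p)).prod)) := by
          gcongr
          refine hl3.trans ?_
          gcongr
      _ = n^l.length * D^l.length * ((n:ℝ)^l.sum * (l.map (ee p)).prod) := by ring
      _ ≤ n^l.length * D^l.length * (Real.exp (lam+lam^2)^l.length * Real.exp (n * (l.map (fun k : ℕ => phf lam ((k:ℝ)/n))).sum)) := by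
          gcongr
      _ = (n * (D * Real.exp (lam+lam^2)))^l.length * Real.exp (n * (l.map (fun k : ℕ => phf lam ((k:ℝ)/n))).sum) := by
          rw [mul_pow, mul_pow]; ring
      _ ≤ _ := by
          gcongr
          exact one_le_mul_of_one_le_of_one_le hn1 (one_le_mul_of_one_le_of_one_le hD1 hE1)
  have hupL := upper_main n lam q δ (δ*n) hn hl hq hp le_rfl hδ.le i
  have hil : N - l.sum = i := by omega
  rw [hil]
  have hupL' : (n:ℝ)^i * expC (bL p q (δ*n)) i ≤ Real.exp (n * (gam lam q ((i:ℝ)/n) + lam*δ)) := by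
    refine hupL.trans (Real.exp_le_exp.2 ?_)
    have : (i:ℝ) ≤ n := by exact_mod_cast (by omega)
    have : lam*δ*i ≤ lam*δ*n := by gcongr
    linarith
  have hpow : (n:ℝ)^N = n^l.sum * n^i := by rw [← pow_add]; congr 1; omega
  have hex := expC_nonneg _ hbM0 (N-i)
  have hey := expC_nonneg _ hb0 i
  calc (n:ℝ)^N * expC (bL p q (ε*n)) N ≤ (n:ℝ)^N * ((n+1) * (expC (bL p q (δ*n)) i * expC bM (N-i))) := by gcongr
    _ = (n+1) * (((n:ℝ)^l.sum * expC bM (N-i)) * ((n:ℝ)^i * expC (bL p q (δ*n)) i)) := by rw [hpow]; ring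
    _ ≤ (n+1) * (((n * (D * Real.exp (lam+lam^2)))^J * Real.exp (n * (l.map (fun k : ℕ => phf lam ((k:ℝ)/n))).sum)) *
         Real.exp (n * (gam lam q ((i:ℝ)/n) + lam*δ))) := by gcongr
    _ = _ := by
      have hexp : Real.exp (n * ((l.map (fun k : ℕ => phf lam ((k:ℝ)/n))).sum + gam lam q ((i:ℝ)/n) + lam*δ)) =
          Real.exp (n * (l.map (fun k : ℕ => phf lam ((k:ℝ)/n))).sum) * Real.exp (n * (gam lam q ((i:ℝ)/n) + lam*δ)) := by
        rw [← Real.exp_add]; congr 1; ring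
      rw [hexp]; ring

lemma le_inv_log (n : ℕ) (hn : 0 < n) (A Y : ℝ) (h : Real.exp (n * A) ≤ Y) : A ≤ 1/(n:ℝ) * Real.log Y := by
  have hn0 : (0:ℝ) < n := by exact_mod_cast hn
  have h1 := (Real.le_log_iff_exp_le (lt_of_lt_of_le (Real.exp_pos _) h)).2 h
  rw [one_div, inv_mul_eq_div, le_div_iff₀ hn0]; linarith

lemma inv_log_le (n : ℕ) (hn : 0 < n) (A Y : ℝ) (hY : 0 < Y) (h : Y ≤ Real.exp (n * A)) : 1/(n:ℝ) * Real.log Y ≤ A := by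
  have hn0 : (0:ℝ) < n := by exact_mod_cast hn
  have h1 := (Real.log_le_iff_le_exp hY).2 h
  rw [one_div, inv_mul_eq_div, div_le_iff₀ hn0]; linarith

lemma list_sum_close (f g : ℕ → ℝ) (c : ℝ) (l : List ℕ) (h : ∀ k ∈ l, f k ≤ g k + c) :
    (l.map f).sum ≤ (l.map g).sum + l.length * c := by
  induction l with
  | nil => simp
  | cons k l ih =>
    have i := ih (fun x hx => h x (List.mem_cons_of_mem _ hx))
    have j := h k List.mem_cons_self
    simp only [List.map_cons, List.sum_cons, List.length_cons]
    push_cast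
    linarith

lemma list_shift_sum (n : ℕ) (l : List ℕ) :
    (l.map (fun k : ℕ => ((k:ℝ)-1)/n)).sum = ((l.sum:ℕ) - (l.length:ℝ))/n := by
  induction l with
  | nil => simp
  | cons k l ih =>
    simp only [List.map_cons, List.sum_cons, List.length_cons, ih]
    push_cast
    ring

lemma err_tendsto (C : ℝ) (J : ℕ) :
    Tendsto (fun n : ℕ => (Real.log 2 + J * Real.log C)/n + (J+1) * (Real.log n/n)) atTop (𝓝 0) := by
  have := (tendsto_const_div_atTop_nhds_zero_nat (Real.log 2 + J * Real.log C)).add (log_div_tendsto.const_mul ((J:ℝ)+1))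
  simpa using this

lemma err_bound (C : ℝ) (hC : 0 < C) (J n : ℕ) (hn : 0 < n) :
    ((n:ℝ)+1) * (n*C)^J ≤ Real.exp (n * ((Real.log 2 + J * Real.log C)/n + (J+1) * (Real.log n/n))) := by
  have hn0 : (0:ℝ) < n := by exact_mod_cast hn
  have hn1 : (1:ℝ) ≤ n := by exact_mod_cast hn
  have e : (n:ℝ) * ((Real.log 2 + J * Real.log C)/n + (J+1) * (Real.log n/n)) = Real.log ((2*n)*(n*C)^J) := by
    rw [Real.log_mul (by positivity) (by positivity), Real.log_mul (by positivity) (by positivity), Real.log_pow,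
      Real.log_mul (by positivity) (by positivity)]
    field_simp
    ring
  rw [e, Real.exp_log (by positivity)]
  gcongr
  linarith

lemma unif_of_cont (f : ℝ → ℝ) (a b : ℝ) (hf : ContinuousOn f (Icc a b)) (κ : ℝ) (hκ : 0 < κ) :
    ∃ d > 0, ∀ x ∈ Icc a b, ∀ y ∈ Icc a b, |x - y| < d → f x ≤ f y + κ := by
  have h := isCompact_Icc.uniformContinuousOn_of_continuous hf
  rw [Metric.uniformContinuousOn_iff] at h
  obtain ⟨d, hd, h⟩ := h κ hκ
  refine ⟨d, hd, fun x hx y hy hxy => ?_⟩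
  have := h x hx y hy (by rwa [Real.dist_eq])
  rw [Real.dist_eq] at this
  linarith [(abs_lt.1 this).2]

lemma K3 (lam q ε s0 : ℝ) (hl : 0 < lam) (hq : 0 < q) (hε : 0 < ε) (hs0 : 0 < s0) (hs1 : s0 ≤ 1)
    (Nn : ℕ → ℕ) (hN0 : ∀ n, Nn n ≤ n) (hN1 : ∀ n : ℕ, s0 * n ≤ Nn n) (hN2 : ∀ n : ℕ, (Nn n : ℝ) < s0 * n + 1)
    (η : ℝ) (hη : 0 < η) :
    ∀ᶠ n : ℕ in atTop, ∀ᶠ m : ℕ in atTop,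
      1/(n:ℝ) * Real.log ((n:ℝ)^(Nn n) * expC (bL (lam/n) q (ε*n)) (Nn n)) - η ≤
      1/(m:ℝ) * Real.log ((m:ℝ)^(Nn m) * expC (bL (lam/m) q (ε*m)) (Nn m)) := by
  obtain ⟨δ, hδ, hδε, hδη⟩ : ∃ δ : ℝ, 0 < δ ∧ δ ≤ ε ∧ lam * δ ≤ η/8 := by
    refine ⟨min ε (η/(8*lam)), by positivity, min_le_left _ _, ?_⟩
    calc lam * min ε (η/(8*lam)) ≤ lam * (η/(8*lam)) := by gcongr; exact min_le_right _ _
      _ = η/8 := by field_simp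
  obtain ⟨J, hJ⟩ := exists_nat_ge (1/δ)
  obtain ⟨d1, hd1, hphi⟩ := unif_of_cont (phf lam) (δ/2) 1
    ((phf_cont lam hl).mono (fun x hx => lt_of_lt_of_le (by positivity) hx.1)) (η/(8*(J+1))) (by positivity)
  obtain ⟨d2, hd2, hgam⟩ := unif_of_cont (gam lam q) 0 1 (gam_cont lam q).continuousOn (η/8) (by positivity)
  set C := max 1 (q / (1 - Real.exp (-(lam*δ)))) * Real.exp (lam+lam^2) with hCdef
  have hC : 0 < C := by positivity
  have hpt : Tendsto (fun n : ℕ => lam / (n:ℝ)) atTop (𝓝 0) := tendsto_const_div_atTop_nhds_zero_nat lam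
  filter_upwards [eventually_gt_atTop 0, hpt.eventually (ge_mem_nhds (show (0:ℝ) < 1/2 by norm_num)),
    (tendsto_const_div_atTop_nhds_zero_nat (2:ℝ)).eventually (gt_mem_nhds hδ),
    (tendsto_const_div_atTop_nhds_zero_nat (1:ℝ)).eventually (gt_mem_nhds hd1),
    (tendsto_const_div_atTop_nhds_zero_nat (1+J:ℝ)).eventually (gt_mem_nhds hd2),
    (err_tendsto C J).eventually (gt_mem_nhds (show 0 < η/8 by linarith)),
    lower_main lam q s0 ε 1 1 hl hq hs0 hε one_pos zero_le_one] with n h1 h2 h3 h4 h5 h6 h7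
  have hn0 : (0:ℝ) < n := by exact_mod_cast h1
  have hYpos := lt_of_lt_of_le (Real.exp_pos _) (h7 (Nn n) (hN1 n) (hN2 n).le)
  have hEpos : 0 < expC (bL (lam/n) q (ε*n)) (Nn n) := (pos_iff_pos_of_mul_pos hYpos).1 (by positivity)
  obtain ⟨l, hl1, hl2, hl3, hl4⟩ := K_up lam q ε δ n (Nn n) J hl hq h2 h1 (hN0 n) hδ hδε hJ hEpos
  rw [div_lt_iff₀ hn0] at h3
  have hk : ∀ k ∈ l, (k:ℝ) ≤ n := by
    intro k hk
    have := List.single_le_sum (fun x _ => Nat.zero_le x) k hk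
    have := hN0 n
    exact_mod_cast (by omega)
  have hα : ∀ k ∈ l, δ/2 ≤ ((k:ℝ)-1)/n ∧ ((k:ℝ)-1)/n ≤ 1 ∧ ((k:ℝ)-1)/n ≤ ε := by
    intro k hkl
    obtain ⟨a, b⟩ := hl1 k hkl
    have c := hk k hkl
    refine ⟨?_, ?_, ?_⟩
    · rw [le_div_iff₀ hn0]; linarith
    · rw [div_le_iff₀ hn0]; linarith
    · rw [div_le_iff₀ hn0]; linarith
  set αs := l.map (fun k : ℕ => ((k:ℝ)-1)/n) with hαs
  have hsum : αs.sum = ((l.sum:ℕ) - (l.length:ℝ))/n := list_shift_sum n l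
  have hsum' : αs.sum * n = (l.sum:ℕ) - (l.length:ℝ) := by rw [hsum]; field_simp
  have hl2' : ((l.sum:ℕ):ℝ) ≤ Nn n := by exact_mod_cast hl2
  have hl3' : (l.length:ℝ) ≤ J := by exact_mod_cast hl3
  have hlen0 : (0:ℝ) ≤ l.length := by positivity
  have hα' : ∀ α ∈ αs, 0 < α ∧ α ≤ 1 ∧ α ≤ ε := by
    intro α h
    obtain ⟨k, hk, rfl⟩ := List.mem_map.1 h
    obtain ⟨a, b, c⟩ := hα k hk
    exact ⟨by linarith, b, c⟩
  have hs : 0 < s0 - αs.sum := by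
    rcases Nat.eq_zero_or_pos l.length with h | h
    · rw [List.length_eq_zero_iff] at h
      rw [hsum, h]; simpa using hs0
    · have h' : (1:ℝ) ≤ l.length := by exact_mod_cast h
      have : 0 < (s0 - αs.sum) * n := by rw [sub_mul, hsum']; linarith [hN2 n]
      exact (pos_iff_pos_of_mul_pos this).2 hn0
  have hαpos : 0 ≤ αs.sum := List.sum_nonneg (fun x hx => (hα' x hx).1.le)
  have hlow := K_low lam q ε s0 hl hq hε αs hα' hs (η/8) (by linarith)
  have hcast : (((Nn n - l.sum : ℕ)):ℝ) = Nn n - (l.sum:ℕ) := by rw [Nat.cast_sub hl2]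
  have hN0' : (Nn n:ℝ) ≤ n := by exact_mod_cast hN0 n
  have hg := hgam (((Nn n - l.sum : ℕ):ℝ)/n) ⟨by positivity, by
      rw [div_le_one hn0, hcast]
      have : (0:ℝ) ≤ (l.sum:ℕ) := by positivity
      linarith⟩ (s0 - αs.sum) ⟨hs.le, by linarith⟩ (by
      refine lt_of_le_of_lt ?_ h5
      have e : ((Nn n - l.sum : ℕ):ℝ)/n - (s0 - αs.sum) = ((Nn n:ℝ) - s0 * n - l.length)/n := by
        rw [hsum, hcast]; field_simp; ring
      rw [e, abs_div, abs_of_pos hn0]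
      gcongr
      rw [abs_le]
      constructor <;> linarith [hN1 n, hN2 n])
  have hp := list_sum_close (fun k : ℕ => phf lam ((k:ℝ)/n)) (fun k : ℕ => phf lam (((k:ℝ)-1)/n)) (η/(8*(J+1))) l (by
    intro k hkl
    obtain ⟨a, b, c⟩ := hα k hkl
    refine hphi _ ⟨a.trans (by gcongr; linarith), (div_le_one hn0).2 (hk k hkl)⟩ _ ⟨a, b⟩ ?_
    have e : (k:ℝ)/n - ((k:ℝ)-1)/n = 1/n := by ring
    rw [e, abs_of_pos (by positivity)]
    exact h4)
  have hmap : αs.map (phf lam) = l.map (fun k : ℕ => phf lam (((k:ℝ)-1)/n)) := by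
    rw [hαs, List.map_map]; rfl
  have hJκ : (l.length:ℝ) * (η/(8*(J+1))) ≤ η/8 := by
    calc (l.length:ℝ) * (η/(8*(J+1))) ≤ (J+1) * (η/(8*(J+1))) := by gcongr; linarith
      _ = η/8 := by field_simp
  have hup := inv_log_le n h1 _ _ hYpos (hl4.trans (by
    refine (mul_le_mul_of_nonneg_right (err_bound C hC J n h1) (Real.exp_pos _).le).trans ?_
    rw [← Real.exp_add, ← mul_add]))
  filter_upwards [hlow, eventually_gt_atTop 0] with m hm hm0
  have := le_inv_log m hm0 _ _ (hm (Nn m) (hN0 m) (hN1 m) (hN2 m).le)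
  rw [hmap] at this
  linarith

lemma K4 (L : ℕ → ℝ) (a b : ℝ) (ha : ∀ η > 0, ∀ᶠ n in atTop, a - η ≤ L n) (hb : ∀ η > 0, ∀ᶠ n in atTop, L n ≤ b + η)
    (h : ∀ η > 0, ∀ᶠ n in atTop, ∀ᶠ m in atTop, L n - η ≤ L m) :
    ∃ ℓ, Tendsto L atTop (𝓝 ℓ) ∧ a ≤ ℓ ∧ ℓ ≤ b := by
  set S : Set ℝ := {x | ∀ᶠ n in atTop, x ≤ L n} with hS
  have hbd : BddAbove S := by
    refine ⟨b+1, fun x hx => ?_⟩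
    obtain ⟨n, h1, h2⟩ := (hx.and (hb 1 one_pos)).exists
    linarith
  have hne : S.Nonempty := ⟨a-1, ha 1 one_pos⟩
  have hlim : Tendsto L atTop (𝓝 (sSup S)) := by
    rw [Metric.tendsto_nhds]
    intro η hη
    obtain ⟨x, hx, hx2⟩ := exists_lt_of_lt_csSup hne (show sSup S - η/2 < sSup S by linarith)
    filter_upwards [hx, h (η/2) (by linarith)] with n h1 h2
    have h3 : L n - η/2 ≤ sSup S := le_csSup hbd h2
    rw [Real.dist_eq, abs_lt]
    constructor <;> linarith
  refine ⟨sSup S, hlim, ?_, ?_⟩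
  · refine le_of_forall_pos_sub_le (fun η hη => ?_)
    exact ge_of_tendsto hlim (ha η hη)
  · refine le_of_forall_pos_le_add (fun η hη => ?_)
    exact le_of_tendsto hlim (hb η hη)

lemma K5 (lam q ε s0 : ℝ) (hl : 0 < lam) (hq : 0 < q) (hε : 0 < ε) (hs0 : 0 < s0) (hs1 : s0 ≤ 1)
    (Nn : ℕ → ℕ) (hN0 : ∀ n, Nn n ≤ n) (hN1 : ∀ n : ℕ, s0 * n ≤ Nn n) (hN2 : ∀ n : ℕ, (Nn n : ℝ) < s0 * n + 1) :
    (∀ᶠ n : ℕ in atTop, 0 < expC (bL (lam/n) q (ε*n)) (Nn n)) ∧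
    ∃ ℓ, Tendsto (fun n : ℕ => 1/(n:ℝ) * Real.log ((n:ℝ)^(Nn n) * expC (bL (lam/n) q (ε*n)) (Nn n))) atTop (𝓝 ℓ) ∧
      gam lam q s0 ≤ ℓ ∧ ℓ ≤ gam lam q s0 + lam * ε := by
  have hpt : Tendsto (fun n : ℕ => lam / (n:ℝ)) atTop (𝓝 0) := tendsto_const_div_atTop_nhds_zero_nat lam
  have hpos : ∀ᶠ n : ℕ in atTop, 0 < (n:ℝ)^(Nn n) * expC (bL (lam/n) q (ε*n)) (Nn n) := by
    filter_upwards [lower_main lam q s0 ε 1 1 hl hq hs0 hε one_pos zero_le_one] with n h7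
    exact lt_of_lt_of_le (Real.exp_pos _) (h7 (Nn n) (hN1 n) (hN2 n).le)
  constructor
  · filter_upwards [hpos, eventually_gt_atTop 0] with n h h1
    have hn0 : (0:ℝ) < n := by exact_mod_cast h1
    exact (pos_iff_pos_of_mul_pos h).1 (by positivity)
  · apply K4
    · intro η hη
      filter_upwards [lower_main lam q s0 ε 1 η hl hq hs0 hε hη zero_le_one, eventually_gt_atTop 0] with n h h0
      exact le_inv_log n h0 _ _ (h (Nn n) (hN1 n) (hN2 n).le)
    · intro η hη
      have hNlim : Tendsto (fun n : ℕ => (Nn n:ℝ)/n) atTop (𝓝 s0) := by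
        have hu : Tendsto (fun n : ℕ => s0 + 1/(n:ℝ)) atTop (𝓝 s0) := by
          simpa using tendsto_const_nhds.add (tendsto_const_div_atTop_nhds_zero_nat (1:ℝ)) (f := fun _ : ℕ => s0)
        refine tendsto_of_tendsto_of_tendsto_of_le_of_le' tendsto_const_nhds hu ?_ ?_
        · filter_upwards [eventually_gt_atTop 0] with n h
          have hn0 : (0:ℝ) < n := by exact_mod_cast h
          rw [le_div_iff₀ hn0]; exact hN1 n
        · filter_upwards [eventually_gt_atTop 0] with n h
          have hn0 : (0:ℝ) < n := by exact_mod_cast h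
          rw [div_le_iff₀ hn0, add_mul, one_div, inv_mul_cancel₀ hn0.ne']; exact (hN2 n).le
      have hg := ((gam_cont lam q).tendsto s0).comp hNlim
      filter_upwards [hpos, eventually_gt_atTop 0, hpt.eventually (ge_mem_nhds (show (0:ℝ) < 1/2 by norm_num)),
        hg.eventually (gt_mem_nhds (show gam lam q s0 < gam lam q s0 + η by linarith))] with n hY h0 h1 h2
      simp only [Function.comp] at h2
      have hn0 : (0:ℝ) < n := by exact_mod_cast h0
      refine inv_log_le n h0 _ _ hY ((upper_main n lam q ε (ε*n) h0 hl hq h1 le_rfl hε.le (Nn n)).trans (Real.exp_le_exp.2 ?_))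
      have hNn' : (Nn n:ℝ) ≤ n := by exact_mod_cast hN0 n
      have a1 : lam*ε*Nn n ≤ lam*ε*n := by gcongr
      have a2 := mul_le_mul_of_nonneg_left h2.le hn0.le
      linarith
    · intro η hη
      exact K3 lam q ε s0 hl hq hε hs0 hs1 Nn hN0 hN1 hN2 η hη

lemma fact_lim : Tendsto (fun n : ℕ => 1/(n:ℝ) * (Real.log (n.factorial:ℝ) - n * Real.log n)) atTop (𝓝 (-1)) := by
  have hu : Tendsto (fun n : ℕ => -1 + (1/(n:ℝ) + Real.log n/n)) atTop (𝓝 (-1)) := by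
    simpa using tendsto_const_nhds.add ((tendsto_const_div_atTop_nhds_zero_nat (1:ℝ)).add log_div_tendsto) (f := fun _ : ℕ => (-1:ℝ))
  refine tendsto_of_tendsto_of_tendsto_of_le_of_le' tendsto_const_nhds hu ?_ ?_
  · filter_upwards [eventually_gt_atTop 0] with n h
    have hn0 : (0:ℝ) < n := by exact_mod_cast h
    have hf : (0:ℝ) < n.factorial := by exact_mod_cast n.factorial_pos
    have h1 := Real.log_le_log (by positivity) (fact_lower n)
    rw [Real.log_mul (by positivity) (by positivity), Real.log_exp, Real.log_pow] at h1
    rw [one_div, inv_mul_eq_div, le_div_iff₀ hn0]; linarith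
  · filter_upwards [eventually_gt_atTop 0] with n h
    have hn0 : (0:ℝ) < n := by exact_mod_cast h
    have hf : (0:ℝ) < n.factorial := by exact_mod_cast n.factorial_pos
    have h1 := Real.log_le_log (by positivity) (fact_upper n h)
    rw [Real.log_mul (by positivity) (by positivity), Real.log_exp, Real.log_mul (by positivity) (by positivity), Real.log_exp, Real.log_pow] at h1
    push_cast at h1
    rw [one_div, inv_mul_eq_div, div_le_iff₀ hn0]
    have e : (-1 + ((n:ℝ)⁻¹ + Real.log n/n)) * n = -n + (1 + Real.log n) := by field_simp
    rw [e]; linarith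

lemma choose_lim (lam : ℝ) : Tendsto (fun n : ℕ => 1/(n:ℝ) * ((n.choose 2 : ℕ) * Real.log (1 - lam/n))) atTop (𝓝 (-lam/2)) := by
  have h1 := (Real.tendsto_mul_log_one_add_div_atTop (-lam)).comp tendsto_natCast_atTop_atTop
  have h2 : Tendsto (fun n : ℕ => (1 - 1/(n:ℝ))/2) atTop (𝓝 ((1-0)/2)) :=
    (tendsto_const_nhds.sub (tendsto_const_div_atTop_nhds_zero_nat (1:ℝ))).div_const 2
  have h3 := h2.mul h1
  have e : (1-0)/2 * -lam = -lam/2 := by ring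
  rw [e] at h3
  refine h3.congr' ?_
  filter_upwards [eventually_gt_atTop 0] with n h
  have hn0 : (0:ℝ) < n := by exact_mod_cast h
  simp only [Function.comp]
  rw [Nat.cast_choose_two, neg_div, ← sub_eq_add_neg]
  field_simp

lemma Psi_le_one (x : ℝ) (h0 : 0 < x) (h1 : x ≤ 1) : Psi x = 0 := by
  unfold Psi
  apply min_eq_right
  have h := Real.sinh_le_self_iff.2 (Real.log_nonpos h0.le h1)
  rw [Real.sinh_log h0] at h
  rw [one_div]; linarith

lemma Psi_ge_one (x : ℝ) (h1 : 1 ≤ x) : Psi x = Real.log x - (x - 1/x)/2 := by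
  unfold Psi
  apply min_eq_left
  have h := Real.self_le_sinh_iff.2 (Real.log_nonneg h1)
  rw [Real.sinh_log (by linarith)] at h
  rw [one_div]; linarith

lemma Phi_eq (θ lam q : ℝ) (hl : 0 < lam) (hq : 0 < q) (hθ1 : θ ≤ 1) :
    -1 + -lam/2 + phf lam θ + gam lam q (1-θ) = Phi θ lam q := by
  have hp : Real.log (1 - pi1 (lam*θ)) = -(lam*θ) := by
    unfold pi1; rw [sub_sub_cancel, Real.log_exp]
  have hp2 : pi1 (lam*θ) = 1 - Real.exp (-(lam*θ)) := rfl
  unfold Phi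
  rw [hp, hp2]
  unfold Sent phf
  rcases hθ1.eq_or_lt with h | h
  · subst h
    simp [gam]
    ring
  · obtain ⟨s, hs⟩ : ∃ s, s = 1 - θ := ⟨_, rfl⟩
    have hs0 : 0 < s := by linarith
    have hθ : θ = 1 - s := by linarith
    rw [← hs]
    have hx : 0 < lam*s/q := by positivity
    have hlog : Real.log (lam*s/q) = Real.log lam + Real.log s - Real.log q := by
      rw [Real.log_div (by positivity) (by positivity), Real.log_mul (by positivity) (by positivity)]
    rcases le_total (lam*s/q) 1 with h1 | h1
    · rw [Psi_le_one _ hx h1]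
      unfold gam
      rw [min_eq_left h1, hlog, hθ]
      field_simp
      ring
    · rw [Psi_ge_one _ h1]
      unfold gam
      rw [min_eq_right h1, hlog, hθ, Real.log_one]
      field_simp
      ring

lemma core (q θ lam ε : ℝ) (hq : 0 < q) (h0 : 0 ≤ θ) (h1 : θ ≤ 1) (hl : 0 < lam) (hε : 0 < ε) (hεθ : 0 < θ → ε < θ) :
    ∃ ℓ, Tendsto (fun n : ℕ => (1 / (n:ℝ)) *
            Real.log (Zrc n lam q {G | (Vbig G (ε * n)).ncard = ⌊θ * (n:ℝ)⌋₊})) atTop (𝓝 ℓ) ∧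
      |ℓ - Phi θ lam q| ≤ lam * ε := by
  have hG : (∀ᶠ n : ℕ in atTop, 0 < expC (bG (lam/n) q (ε*n)) ⌊θ*(n:ℝ)⌋₊) ∧
      Tendsto (fun n : ℕ => 1/(n:ℝ) * Real.log ((n:ℝ)^⌊θ*(n:ℝ)⌋₊ * expC (bG (lam/n) q (ε*n)) ⌊θ*(n:ℝ)⌋₊)) atTop (𝓝 (phf lam θ)) := by
    rcases h0.eq_or_lt with h | h
    · subst h
      simp [expC_zero, phf]
    · exact big_lim lam q ε θ hl hq hε (hεθ h) h1
  have hfle : ∀ n : ℕ, ⌊θ*(n:ℝ)⌋₊ ≤ n := fun n =>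
    Nat.floor_le_of_le (mul_le_of_le_one_left (by positivity) h1)
  have hfl1 : ∀ n : ℕ, (⌊θ*(n:ℝ)⌋₊:ℝ) ≤ θ * n := fun n => Nat.floor_le (by positivity)
  have hfl2 : ∀ n : ℕ, θ * n < ⌊θ*(n:ℝ)⌋₊ + 1 := fun n => Nat.lt_floor_add_one _
  have hL : (∀ᶠ n : ℕ in atTop, 0 < expC (bL (lam/n) q (ε*n)) (n - ⌊θ*(n:ℝ)⌋₊)) ∧
    ∃ ℓ, Tendsto (fun n : ℕ => 1/(n:ℝ) * Real.log ((n:ℝ)^(n - ⌊θ*(n:ℝ)⌋₊) * expC (bL (lam/n) q (ε*n)) (n - ⌊θ*(n:ℝ)⌋₊))) atTop (𝓝 ℓ) ∧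
      gam lam q (1-θ) ≤ ℓ ∧ ℓ ≤ gam lam q (1-θ) + lam * ε := by
    rcases h1.eq_or_lt with h | h
    · subst h
      refine ⟨?_, 0, ?_, ?_⟩
      · simp [expC_zero]
      · simp [expC_zero]
      · simp [gam]; positivity
    · refine K5 lam q ε (1-θ) hl hq hε (by linarith) (by linarith) (fun n => n - ⌊θ*(n:ℝ)⌋₊) (fun n => Nat.sub_le _ _) ?_ ?_
      · intro n
        rw [Nat.cast_sub (hfle n)]; linarith [hfl1 n]
      · intro n
        rw [Nat.cast_sub (hfle n)]; linarith [hfl2 n]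
  obtain ⟨hLp, ℓ, hLt, hL1, hL2⟩ := hL
  obtain ⟨hGp, hGt⟩ := hG
  refine ⟨-1 + -lam/2 + phf lam θ + ℓ, ?_, ?_⟩
  · refine (((fact_lim.add (choose_lim lam)).add hGt).add hLt).congr' ?_
    have hpt : Tendsto (fun n : ℕ => lam / (n:ℝ)) atTop (𝓝 0) := tendsto_const_div_atTop_nhds_zero_nat lam
    filter_upwards [hLp, hGp, eventually_gt_atTop 0, hpt.eventually (gt_mem_nhds (show (0:ℝ) < 1 by norm_num))] with n a b c d
    have hn0 : (0:ℝ) < n := by exact_mod_cast c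
    have hf : (0:ℝ) < n.factorial := by exact_mod_cast n.factorial_pos
    have hp : 0 < 1 - lam/n := by linarith
    rw [Zrc_eq n _ lam q (ε*n) hq d c (hfle n)]
    rw [Real.log_mul (x := (n:ℝ)^⌊θ*(n:ℝ)⌋₊) (by positivity) (by positivity),
      Real.log_mul (x := (n:ℝ)^(n - ⌊θ*(n:ℝ)⌋₊)) (by positivity) (by positivity),
      Real.log_mul (by positivity) (by positivity), Real.log_mul (x := (n.factorial:ℝ)) (by positivity) (by positivity),
      Real.log_mul (x := expC _ _) (by positivity) (by positivity), Real.log_pow, Real.log_pow, Real.log_pow,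
      Nat.cast_sub (hfle n)]
    ring
  · rw [← Phi_eq θ lam q hl hq h1, abs_le]
    have : 0 < lam * ε := by positivity
    constructor <;> linarith

/-- Fix `q > 0` and `λ > 0`. For every `θ ∈ [0,1]`,
`lim_{ε↓0} lim_{n→∞} (1/n) log Z_{n,λ,q}[|V_{εn}| = ⌊θn⌋] = Φ(θ,λ,q)`, and the
convergence is uniform for `λ` in compact subsets of `(0,∞) ∖ {q}`. -/
theorem stmt6 (q θ : ℝ) (hq : 0 < q) (hθ : θ ∈ Set.Icc (0:ℝ) 1) :
    ∃ f : ℝ → ℝ → ℝ,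
      (∀ lam : ℝ, 0 < lam → ∀ᶠ ε in 𝓝[>] (0:ℝ),
        Tendsto (fun n : ℕ => (1 / (n:ℝ)) *
            Real.log (Zrc n lam q {G | (Vbig G (ε * n)).ncard = ⌊θ * (n:ℝ)⌋₊}))
          atTop (𝓝 (f ε lam))) ∧
      (∀ lam : ℝ, 0 < lam →
        Tendsto (fun ε => f ε lam) (𝓝[>] (0:ℝ)) (𝓝 (Phi θ lam q))) ∧
      ∀ C : Set ℝ, IsCompact C → C ⊆ Set.Ioi (0:ℝ) \ {q} →
        TendstoUniformlyOn (fun (ε : ℝ) (lam : ℝ) => f ε lam)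
          (fun lam => Phi θ lam q) (𝓝[>] (0:ℝ)) C := by
  have key : ∀ ε lam : ℝ, ∃ ℓ : ℝ, (0 < ε ∧ (0 < θ → ε < θ)) → 0 < lam →
      Tendsto (fun n : ℕ => (1 / (n:ℝ)) *
            Real.log (Zrc n lam q {G | (Vbig G (ε * n)).ncard = ⌊θ * (n:ℝ)⌋₊})) atTop (𝓝 ℓ) ∧
      |ℓ - Phi θ lam q| ≤ lam * ε := by
    intro ε lam
    by_cases h : (0 < ε ∧ (0 < θ → ε < θ)) ∧ 0 < lam
    · obtain ⟨ℓ, h1⟩ := core q θ lam ε hq hθ.1 hθ.2 h.2 h.1.1 h.1.2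
      exact ⟨ℓ, fun _ _ => h1⟩
    · exact ⟨0, fun a b => absurd ⟨a, b⟩ h⟩
  choose f hf using key
  have hev : ∀ᶠ ε in 𝓝[>] (0:ℝ), 0 < ε ∧ (0 < θ → ε < θ) := by
    rcases hθ.1.eq_or_lt with h | h
    · filter_upwards [self_mem_nhdsWithin] with ε he
      exact ⟨he, fun h' => absurd h' (by rw [← h]; exact lt_irrefl _)⟩
    · filter_upwards [Ioo_mem_nhdsGT h] with ε he
      exact ⟨he.1, fun _ => he.2⟩
  have hunif : ∀ B : ℝ, 0 < B → ∀ κ > 0, ∀ᶠ ε in 𝓝[>] (0:ℝ), ∀ lam, 0 < lam → lam ≤ B → |f ε lam - Phi θ lam q| < κ := by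
    intro B hB κ hκ
    filter_upwards [hev, Ioo_mem_nhdsGT (show 0 < κ/B by positivity)] with ε he he2 lam hl hlB
    refine lt_of_le_of_lt (hf ε lam he hl).2 ?_
    calc lam * ε ≤ B * ε := by gcongr; exact he.1.le
      _ < B * (κ/B) := by gcongr; exact he2.2
      _ = κ := by field_simp
  refine ⟨f, ?_, ?_, ?_⟩
  · intro lam hl
    filter_upwards [hev] with ε he
    exact (hf ε lam he hl).1
  · intro lam hl
    rw [Metric.tendsto_nhds]
    intro κ hκ
    filter_upwards [hunif lam hl κ hκ] with ε he
    rw [Real.dist_eq]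
    exact he lam hl le_rfl
  · intro C hC hCs
    rw [Metric.tendstoUniformlyOn_iff]
    intro κ hκ
    obtain ⟨B, hB⟩ := hC.bddAbove
    filter_upwards [hunif (max B 1) (by positivity) κ hκ] with ε he lam hlam
    rw [dist_comm, Real.dist_eq]
    exact he lam (hCs hlam).1 ((hB hlam).trans (le_max_left _ _))
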